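/- Let 1 < p < ∞, let Ω ⊂ ℝ³ be open, and let w : ℝ³ → [0, ∞) be locally integrable, positive almost everywhere, and satisfy the Muckenhoupt A_p condition: there exists C₀ such that for every cube Q ⊂ ℝ³, (⨍_Q w dx) · (⨍_Q w^{−1/(p−1)} dx)^{p−1} ≤ C₀. Then there exists a constant C = C(w, Ω, p) such that for every u ∈ C_c^∞(Ω; ℝ³): (∫_Ω w |∇u|^p dx)^{1/p} ≤ C [ (∫_Ω w |div u|^p dx)^{1/p} + (∫_Ω w |curl u|^p dx)^{1/p} ]. -/

import Mathlib

noncomputable section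

open MeasureTheory Real Filter Topology Bornology ENNReal NNReal

/-- Euclidean 3-space. -/
abbrev E3 : Type := EuclideanSpace ℝ (Fin 3)

/-- Euclidean 2-space. -/
abbrev E2 : Type := EuclideanSpace ℝ (Fin 2)

/-- The `i`-th standard basis vector of `E3`. -/
def ee (i : Fin 3) : E3 := EuclideanSpace.single i 1

/-- Partial derivative `∂ᵢ f` of a scalar function. -/
def pds (f : E3 → ℝ) (i : Fin 3) (x : E3) : ℝ := fderiv ℝ f x (ee i)

/-- Partial derivative `∂ᵢ vⱼ` of a vector field. -/
def pd (v : E3 → E3) (i j : Fin 3) (x : E3) : ℝ := fderiv ℝ v x (ee i) j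

/-- Build a vector of `E3` from coordinates. -/
def mk3 (a b c : ℝ) : E3 := (WithLp.equiv 2 (Fin 3 → ℝ)).symm ![a, b, c]

/-- Build a vector of `E2` from coordinates. -/
def mk2 (a b : ℝ) : E2 := (WithLp.equiv 2 (Fin 2 → ℝ)).symm ![a, b]

/-- First two coordinates `x'` of a point of `E3`. -/
def proj12 (y : E3) : E2 := mk2 (y 0) (y 1)

/-- Gradient of a scalar function, as a vector field. -/
def grad3 (f : E3 → ℝ) (x : E3) : E3 := mk3 (pds f 0 x) (pds f 1 x) (pds f 2 x)

/-- Gradient matrix `(∇v)ᵢⱼ = ∂ᵢ vⱼ` of a vector field. -/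
def gradv (v : E3 → E3) (x : E3) (i j : Fin 3) : ℝ := pd v i j x

/-- Divergence of a vector field. -/
def vdiv (v : E3 → E3) (x : E3) : ℝ := ∑ i, pd v i i x

/-- Curl `∇ × v` of a vector field. -/
def vcurl (v : E3 → E3) (x : E3) : E3 :=
  mk3 (pd v 1 2 x - pd v 2 1 x) (pd v 2 0 x - pd v 0 2 x) (pd v 0 1 x - pd v 1 0 x)

/-- Curl computed from a (weak) gradient matrix `G`, `(curl v)₁ = G₂₃ - G₃₂` etc. -/
def curlOf (G : E3 → Fin 3 → Fin 3 → ℝ) (x : E3) : E3 :=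
  mk3 (G x 1 2 - G x 2 1) (G x 2 0 - G x 0 2) (G x 0 1 - G x 1 0)

/-- Divergence computed from a (weak) gradient matrix. -/
def divOf (G : E3 → Fin 3 → Fin 3 → ℝ) (x : E3) : ℝ := ∑ i, G x i i

/-- Cross product on `E3`. -/
def cross3 (a b : E3) : E3 :=
  mk3 (a 1 * b 2 - a 2 * b 1) (a 2 * b 0 - a 0 * b 2) (a 0 * b 1 - a 1 * b 0)

/-- Euclidean dot product on `E3`. -/
def dot3 (a b : E3) : ℝ := ∑ i, a i * b i

/-- Frobenius (double-dot) product of two 3×3 matrices. -/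
def mdot (A B : Fin 3 → Fin 3 → ℝ) : ℝ := ∑ i, ∑ j, A i j * B i j

/-- Frobenius (Euclidean) norm of a 3×3 matrix. -/
def frob (M : Fin 3 → Fin 3 → ℝ) : ℝ := Real.sqrt (∑ i, ∑ j, (M i j) ^ 2)

/-- Symmetric part of a 3×3 matrix. -/
def symm3 (M : Fin 3 → Fin 3 → ℝ) (i j : Fin 3) : ℝ := (M i j + M j i) / 2

/-- Distance to the boundary of `Ω`. -/
def dB (Ω : Set E3) (x : E3) : ℝ := Metric.infDist x (frontier Ω)

/-- Scalar test functions: smooth compactly supported inside `Ω`. -/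
structure IsTestS (Ω : Set E3) (ψ : E3 → ℝ) : Prop where
  smooth : ContDiff ℝ (⊤ : ℕ∞) ψ
  compsupp : HasCompactSupport ψ
  suppin : tsupport ψ ⊆ Ω

/-- Vector test functions: smooth compactly supported inside `Ω`. -/
structure IsTest (Ω : Set E3) (φ : E3 → E3) : Prop where
  smooth : ContDiff ℝ (⊤ : ℕ∞) φ
  compsupp : HasCompactSupport φ
  suppin : tsupport φ ⊆ Ω

/-- Solenoidal (divergence-free) vector test functions `C^∞_{0,σ}(Ω)`. -/
structure IsTestSol (Ω : Set E3) (φ : E3 → E3) extends IsTest Ω φ : Prop where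
  sol : ∀ x, vdiv φ x = 0

/-- `G` is the distributional gradient of the vector field `v` on `Ω`. -/
def HasWeakGrad (Ω : Set E3) (v : E3 → E3) (G : E3 → Fin 3 → Fin 3 → ℝ) : Prop :=
  ∀ ψ : E3 → ℝ, IsTestS Ω ψ → ∀ i j,
    ∫ x in Ω, v x j * pds ψ i x = - ∫ x in Ω, G x i j * ψ x

/-- `G` is the distributional gradient of the scalar function `u` on `Ω`. -/
def HasWeakGradS (Ω : Set E3) (u : E3 → ℝ) (G : E3 → E3) : Prop :=
  ∀ ψ : E3 → ℝ, IsTestS Ω ψ → ∀ i,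
    ∫ x in Ω, u x * pds ψ i x = - ∫ x in Ω, G x i * ψ x

/-- Membership `v ∈ W^{1,p}_{0,σ}(Ω, d^α)` (with distributional gradient `G`):
`v` is measurable, `G` is its distributional gradient, the weighted norm is finite and
`v` is approximated by smooth compactly supported *solenoidal* fields in the weighted norm.
The unweighted space corresponds to `α = 0`. -/
structure MemW1pSigma (Ω : Set E3) (p α : ℝ) (v : E3 → E3)
    (G : E3 → Fin 3 → Fin 3 → ℝ) : Prop where
  meas : AEStronglyMeasurable v (volume.restrict Ω)
  weak_grad : HasWeakGrad Ω v G
  finite : IntegrableOn (fun x => dB Ω x ^ α * (‖v x‖ ^ p + frob (G x) ^ p)) Ω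
  approx : ∃ φ : ℕ → E3 → E3, (∀ n, IsTestSol Ω (φ n)) ∧
    Tendsto (fun n => ∫ x in Ω, dB Ω x ^ α *
        (‖v x - φ n x‖ ^ p + frob (fun i j => G x i j - gradv (φ n) x i j) ^ p))
      atTop (nhds 0)

/-- Membership `v ∈ W^{1,p}_0(Ω, d^α)` (with distributional gradient `G`):
as `MemW1pSigma` but approximating fields need not be divergence free. -/
structure MemW1p0 (Ω : Set E3) (p α : ℝ) (v : E3 → E3)
    (G : E3 → Fin 3 → Fin 3 → ℝ) : Prop where
  meas : AEStronglyMeasurable v (volume.restrict Ω)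
  weak_grad : HasWeakGrad Ω v G
  finite : IntegrableOn (fun x => dB Ω x ^ α * (‖v x‖ ^ p + frob (G x) ^ p)) Ω
  approx : ∃ φ : ℕ → E3 → E3, (∀ n, IsTest Ω (φ n)) ∧
    Tendsto (fun n => ∫ x in Ω, dB Ω x ^ α *
        (‖v x - φ n x‖ ^ p + frob (fun i j => G x i j - gradv (φ n) x i j) ^ p))
      atTop (nhds 0)

/-- A bounded open set of `ℝ³` with Lipschitz (`C^{0,1}`) boundary: near every boundary
point, after a rigid change of coordinates, the boundary is the graph of a Lipschitz
function `a` (with Lipschitz constant `r < 1`) and `Ω` lies locally above the graph. -/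
structure IsLipschitzDomain (Ω : Set E3) : Prop where
  nonempty : Ω.Nonempty
  isOpen : IsOpen Ω
  isBounded : IsBounded Ω
  charts : ∀ P ∈ frontier Ω, ∃ (f : E3 ≃ᵢ E3) (R R' r : ℝ) (a : E2 → ℝ),
    f P = 0 ∧ 0 < R ∧ 0 < R' ∧ 0 < r ∧ r < 1 ∧
    LipschitzWith (Real.toNNReal r) a ∧
    (∀ x' : E2, ‖x'‖ < R → |a x'| < R') ∧
    (∀ y : E3, ‖proj12 y‖ < R → |y 2| < R' →
      (f.symm y ∈ frontier Ω ↔ y 2 = a (proj12 y))) ∧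
    (∀ y : E3, ‖proj12 y‖ < R →
      a (proj12 y) < y 2 → y 2 < a (proj12 y) + R' → f.symm y ∈ Ω)

/-- A bounded open set of `ℝ³` with smooth (`C^∞`) boundary. -/
structure IsSmoothDomain (Ω : Set E3) : Prop where
  nonempty : Ω.Nonempty
  isOpen : IsOpen Ω
  isBounded : IsBounded Ω
  charts : ∀ P ∈ frontier Ω, ∃ (f : E3 ≃ᵢ E3) (R R' : ℝ) (a : E2 → ℝ),
    f P = 0 ∧ 0 < R ∧ 0 < R' ∧ ContDiff ℝ (⊤ : ℕ∞) a ∧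
    (∀ x' : E2, ‖x'‖ < R → |a x'| < R') ∧
    (∀ y : E3, ‖proj12 y‖ < R → |y 2| < R' →
      (f.symm y ∈ frontier Ω ↔ y 2 = a (proj12 y))) ∧
    (∀ y : E3, ‖proj12 y‖ < R →
      a (proj12 y) < y 2 → y 2 < a (proj12 y) + R' → f.symm y ∈ Ω)

/-- The axis-parallel closed cube with center `c` and half side-length `h`. -/
def cube (c : E3) (h : ℝ) : Set E3 := {x | ∀ i, |x i - c i| ≤ h}

/-- Average of (the nonnegative part of) `f` over a set, valued in `ℝ≥0∞`. -/
def lavg (s : Set E3) (f : E3 → ℝ) : ℝ≥0∞ :=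
  (∫⁻ x in s, ENNReal.ofReal (f x)) / volume s

/-- The Muckenhoupt `A_p` condition for a weight `w` on `ℝ³`:
`(⨍_Q w)(⨍_Q w^{-1/(p-1)})^{p-1} ≤ C` uniformly over all cubes `Q`. -/
def IsMuckenhouptAp (w : E3 → ℝ) (p : ℝ) : Prop :=
  ∃ C : ℝ, ∀ (c : E3) (h : ℝ), 0 < h →
    lavg (cube c h) w * (lavg (cube c h) (fun x => w x ^ (-1 / (p - 1)))) ^ (p - 1)
      ≤ ENNReal.ofReal C

open Metric (ball closedBall)


/-- Uncentered maximal function over Euclidean balls w.r.t. a measure `ν`. -/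
def MM (ν : Measure E3) (g : E3 → ℝ≥0∞) (x : E3) : ℝ≥0∞ :=
  ⨆ (c : E3) (r : ℝ) (_ : x ∈ ball c r), (∫⁻ y in ball c r, g y ∂ν) / ν (ball c r)

lemma le_MM (ν : Measure E3) (g : E3 → ℝ≥0∞) {x c : E3} {r : ℝ} (h : x ∈ ball c r) :
    (∫⁻ y in ball c r, g y ∂ν) / ν (ball c r) ≤ MM ν g x :=
  le_iSup_of_le c (le_iSup_of_le r (le_iSup_of_le h le_rfl))

lemma lt_MM_iff (ν : Measure E3) (g : E3 → ℝ≥0∞) {x : E3} {t : ℝ≥0∞} :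
    t < MM ν g x ↔ ∃ c r, x ∈ ball c r ∧ t < (∫⁻ y in ball c r, g y ∂ν) / ν (ball c r) := by
  simp only [MM, lt_iSup_iff, exists_prop]

lemma MM_measurable (ν : Measure E3) (g : E3 → ℝ≥0∞) : Measurable (MM ν g) := by
  apply measurable_of_Ioi
  intro t
  apply IsOpen.measurableSet
  rw [isOpen_iff_mem_nhds]
  intro x hx
  obtain ⟨c, r, hxr, h⟩ := (lt_MM_iff ν g).1 hx
  filter_upwards [Metric.isOpen_ball.mem_nhds hxr] with y hy
  exact (lt_MM_iff ν g).2 ⟨c, r, hy, h⟩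

/-- doubling with positive finite measure of balls -/
structure Dbl (ν : Measure E3) (D : ℝ≥0∞) : Prop where
  top : D ≠ ∞
  pos : ∀ c r, 0 < r → 0 < ν (ball c r)
  fin : ∀ c r, ν (ball c r) < ∞
  dbl : ∀ c r, 0 < r → ν (ball c (5 * r)) ≤ D * ν (ball c r)

lemma MM_weak {ν : Measure E3} {D : ℝ≥0∞} (hν : Dbl ν D) (g : E3 → ℝ≥0∞) 
    (t : ℝ≥0∞) :
    t * ν {x | t < MM ν g x} ≤ D * ∫⁻ y, g y ∂ν := by
  have key : ∀ n : ℕ, t * ν {x | ∃ c r, r ≤ (n : ℝ) ∧ x ∈ ball c r ∧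
      t < (∫⁻ y in ball c r, g y ∂ν) / ν (ball c r)} ≤ D * ∫⁻ y, g y ∂ν := by
    intro n
    let T : Set (E3 × ℝ) := {a | a.2 ≤ (n : ℝ) ∧ 0 < a.2 ∧
      t < (∫⁻ y in ball a.1 a.2, g y ∂ν) / ν (ball a.1 a.2)}
    obtain ⟨u, huT, hdisj, hcov⟩ := Vitali.exists_disjoint_subfamily_covering_enlargement_closedBall
      T (fun a => a.1) (fun a => a.2) n (fun a ha => ha.1) 4 (by norm_num)
    have hdisj' : u.PairwiseDisjoint fun a => ball a.1 a.2 :=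
      hdisj.mono (fun a => Metric.ball_subset_closedBall)
    have hcount : u.Countable := hdisj'.countable_of_isOpen (fun a _ => Metric.isOpen_ball)
      (fun a ha => Metric.nonempty_ball.2 (huT ha).2.1)
    have hsub : {x | ∃ c r, r ≤ (n : ℝ) ∧ x ∈ ball c r ∧
      t < (∫⁻ y in ball c r, g y ∂ν) / ν (ball c r)} ⊆ ⋃ a ∈ u, ball a.1 (5 * a.2) := by
      rintro x ⟨c, r, hr, hx, hlt⟩
      have hr0 : 0 < r := Metric.pos_of_mem_ball hx
      obtain ⟨b, hb, hbs⟩ := hcov (c, r) ⟨hr, hr0, hlt⟩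
      simp only [Set.mem_iUnion]
      refine ⟨b, hb, ?_⟩
      have h1 := hbs (Metric.ball_subset_closedBall hx)
      have := (huT hb).2.1
      rw [Metric.mem_closedBall] at h1
      rw [Metric.mem_ball]; linarith
    have : Countable u := hcount.to_subtype
    calc t * ν _ ≤ t * ∑' a : u, ν (ball a.1.1 (5 * a.1.2)) := by
          gcongr
          refine (measure_mono hsub).trans ?_
          exact measure_biUnion_le _ hcount _
      _ ≤ t * ∑' a : u, D * ν (ball a.1.1 a.1.2) := by
          gcongr with a
          exact hν.dbl _ _ (huT a.2).2.1
      _ = D * ∑' a : u, t * ν (ball a.1.1 a.1.2) := by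
          rw [ENNReal.tsum_mul_left, ENNReal.tsum_mul_left]; ring
      _ ≤ D * ∑' a : u, ∫⁻ y in ball a.1.1 a.1.2, g y ∂ν := by
          gcongr with a
          have h := (huT a.2).2.2.le
          rwa [ENNReal.le_div_iff_mul_le (Or.inl (hν.pos _ _ (huT a.2).2.1).ne')
            (Or.inl (hν.fin _ _).ne)] at h
      _ = D * ∫⁻ y in ⋃ a : u, ball a.1.1 a.1.2, g y ∂ν := by
          rw [lintegral_iUnion (fun a => measurableSet_ball)]
          intro a b hab
          exact hdisj' a.2 b.2 (fun h => hab (Subtype.ext h))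
      _ ≤ D * ∫⁻ y, g y ∂ν := by
          gcongr
          exact Measure.restrict_le_self
  have hU : {x | t < MM ν g x} = ⋃ n : ℕ, {x | ∃ c r, r ≤ (n : ℝ) ∧ x ∈ ball c r ∧
      t < (∫⁻ y in ball c r, g y ∂ν) / ν (ball c r)} := by
    ext x
    simp only [Set.mem_ofPred_eq, lt_MM_iff, Set.mem_iUnion]
    constructor
    · rintro ⟨c, r, h1, h2⟩
      obtain ⟨n, hn⟩ := exists_nat_ge r
      exact ⟨n, c, r, hn, h1, h2⟩
    · rintro ⟨n, c, r, _, h1, h2⟩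
      exact ⟨c, r, h1, h2⟩
  rw [hU, Monotone.measure_iUnion, ENNReal.mul_iSup]
  · exact iSup_le key
  · intro m n hmn x ⟨c, r, h0, h1, h2⟩
    exact ⟨c, r, h0.trans (by exact_mod_cast hmn), h1, h2⟩

lemma layer_le (ν : Measure E3) (F : E3 → ℝ≥0∞) (hF : Measurable F) {q : ℝ} (hq : 0 < q) :
    ∫⁻ x, F x ^ q ∂ν ≤ ENNReal.ofReal q *
      ∫⁻ t in Set.Ioi (0:ℝ), ν {x | ENNReal.ofReal t < F x} * ENNReal.ofReal (t ^ (q - 1)) := by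
  have h1 : ∀ n : ℕ, ∫⁻ x, (min (F x) n) ^ q ∂ν ≤ ENNReal.ofReal q *
      ∫⁻ t in Set.Ioi (0:ℝ), ν {x | ENNReal.ofReal t < F x} * ENNReal.ofReal (t ^ (q - 1)) := by
    intro n
    have hfin : ∀ x, min (F x) n ≠ ∞ := fun x => ((min_le_right _ _).trans_lt (by simp)).ne
    have := lintegral_rpow_eq_lintegral_meas_lt_mul ν (f := fun x => (min (F x) n).toReal)
      (Eventually.of_forall fun x => ENNReal.toReal_nonneg)
      (by fun_prop) hq
    have e : ∀ x, ENNReal.ofReal ((min (F x) n).toReal ^ q) = (min (F x) n) ^ q := by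
      intro x
      rw [← ENNReal.ofReal_rpow_of_nonneg ENNReal.toReal_nonneg hq.le, ENNReal.ofReal_toReal (hfin x)]
    simp only [e] at this
    rw [this]
    gcongr ENNReal.ofReal q * ?_
    apply setLIntegral_mono' measurableSet_Ioi
    intro t ht
    gcongr ?_ * _
    apply measure_mono
    intro x h
    exact ((ENNReal.ofReal_lt_iff_lt_toReal (le_of_lt ht) (hfin x)).2 h).trans_le (min_le_left _ _)
  have h2 : ∀ x, F x ^ q = ⨆ n : ℕ, (min (F x) n) ^ q := by
    intro x
    apply le_antisymm
    · by_cases hx : F x = ∞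
      · rw [hx, ENNReal.top_rpow_of_pos hq]
        simp only [min_eq_right le_top]
        rw [top_le_iff]; apply ENNReal.eq_top_of_forall_nnreal_le
        intro r
        obtain ⟨n, hn⟩ := exists_nat_ge ((r : ℝ≥0∞) ^ (1 / q)).toReal
        refine le_iSup_of_le n ?_
        have h1 : (r : ℝ≥0∞) ^ (1 / q) ≤ n := by
          rw [← ENNReal.ofReal_toReal (a := (r : ℝ≥0∞) ^ (1 / q)) (by simp [hq.le])]
          rw [← ENNReal.ofReal_natCast]
          exact ENNReal.ofReal_le_ofReal hn
        calc (r : ℝ≥0∞) = ((r : ℝ≥0∞) ^ (1 / q)) ^ q := by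
              rw [← ENNReal.rpow_mul, one_div, inv_mul_cancel₀ hq.ne', ENNReal.rpow_one]
          _ ≤ _ := by gcongr
      · obtain ⟨n, hn⟩ := ENNReal.exists_nat_gt hx
        exact le_iSup_of_le n (by rw [min_eq_left hn.le])
    · exact iSup_le fun n => by gcongr; exact min_le_left _ _
  simp_rw [h2]
  rw [lintegral_iSup]
  · exact iSup_le h1
  · intro n; fun_prop
  · intro m n hmn x
    simp only
    gcongr

lemma layer_ge (ν : Measure E3) (F : E3 → ℝ≥0∞) (hF : Measurable F) {q : ℝ} (hq : 0 < q)
    (hfin : ∀ᵐ x ∂ν, F x ≠ ∞) :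
    ENNReal.ofReal q *
      ∫⁻ t in Set.Ioi (0:ℝ), ν {x | ENNReal.ofReal t < F x} * ENNReal.ofReal (t ^ (q - 1))
      ≤ ∫⁻ x, F x ^ q ∂ν := by
  have := lintegral_rpow_eq_lintegral_meas_lt_mul ν (f := fun x => (F x).toReal)
      (Eventually.of_forall fun x => ENNReal.toReal_nonneg)
      (by fun_prop) hq
  have e : ∫⁻ x, F x ^ q ∂ν = ∫⁻ x, ENNReal.ofReal ((F x).toReal ^ q) ∂ν := by
    apply lintegral_congr_ae
    filter_upwards [hfin] with x hx
    rw [← ENNReal.ofReal_rpow_of_nonneg ENNReal.toReal_nonneg hq.le, ENNReal.ofReal_toReal hx]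
  rw [e, this]
  gcongr ENNReal.ofReal q * ?_
  apply setLIntegral_mono' measurableSet_Ioi
  intro t ht
  gcongr ?_ * _
  apply measure_mono_ae
  filter_upwards [hfin] with x hx h
  exact (ENNReal.ofReal_lt_iff_lt_toReal (le_of_lt ht) hx).1 h

lemma MM_weak' {ν : Measure E3} {D : ℝ≥0∞} (hν : Dbl ν D) (g : E3 → ℝ≥0∞) (hg : Measurable g)
    (t : ℝ≥0∞) :
    t * ν {x | t < MM ν g x} ≤ 2 * D * ∫⁻ y in {y | t < 2 * g y}, g y ∂ν := by
  have hm : MeasurableSet {y | t < 2 * g y} := measurableSet_lt (by fun_prop) (by fun_prop)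
  have hle : ∀ x, MM ν g x ≤ MM ν ({y | t < 2 * g y}.indicator g) x + t / 2 := by
    intro x
    refine iSup_le fun c => iSup_le fun r => iSup_le fun h => ?_
    refine le_trans ?_ (add_le_add_left (le_MM ν _ h) _)
    have hr : 0 < r := Metric.pos_of_mem_ball h
    rw [ENNReal.div_le_iff (hν.pos _ _ hr).ne' (hν.fin _ _).ne, add_mul,
      ENNReal.div_mul_cancel (hν.pos _ _ hr).ne' (hν.fin _ _).ne]
    calc ∫⁻ y in ball c r, g y ∂ν ≤ ∫⁻ y in ball c r, ({y | t < 2 * g y}.indicator g y + t / 2) ∂ν := by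
          gcongr with y
          by_cases hy : t < 2 * g y
          · rw [Set.indicator_of_mem (by exact hy)]; exact le_self_add
          · rw [Set.indicator_of_notMem (by exact hy), zero_add, ENNReal.le_div_iff_mul_le (by simp) (by simp), mul_comm]
            exact not_lt.1 hy
      _ = _ := by
          rw [lintegral_add_right _ measurable_const, setLIntegral_const]
  have hsub : {x | t < MM ν g x} ⊆ {x | t / 2 < MM ν ({y | t < 2 * g y}.indicator g) x} := by
    intro x hx
    have := lt_of_lt_of_le hx (hle x)
    simp only [Set.mem_ofPred_eq]
    by_contra hcon
    push Not at hcon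
    have : t < t / 2 + t / 2 := this.trans_le (by gcongr)
    rw [ENNReal.add_halves] at this
    exact lt_irrefl _ this
  calc t * ν {x | t < MM ν g x} ≤ t * ν {x | t / 2 < MM ν ({y | t < 2 * g y}.indicator g) x} := by
        gcongr
    _ = 2 * ((t / 2) * ν {x | t / 2 < MM ν ({y | t < 2 * g y}.indicator g) x}) := by
        rw [← mul_assoc, ENNReal.mul_div_cancel (by simp) (by simp)]
    _ ≤ 2 * (D * ∫⁻ y, {y | t < 2 * g y}.indicator g y ∂ν) := by
        gcongr 2 * ?_
        exact MM_weak hν _ _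
    _ = _ := by rw [lintegral_indicator hm]; ring

lemma MM_strong {ν : Measure E3} {D : ℝ≥0∞} (hν : Dbl ν D) {q : ℝ} (hq : 1 < q) :
    ∃ C : ℝ≥0∞, C ≠ ∞ ∧ ∀ g : E3 → ℝ≥0∞, Measurable g →
      ∫⁻ x, MM ν g x ^ q ∂ν ≤ C * ∫⁻ x, g x ^ q ∂ν := by
  refine ⟨ENNReal.ofReal q * (2 * D) * (ENNReal.ofReal (q - 1))⁻¹ * 2 ^ (q - 1) + 1, ?_, ?_⟩
  · have : ENNReal.ofReal (q - 1) ≠ 0 := by simp; linarith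
    have h2 : (2 : ℝ≥0∞) ^ (q - 1) ≠ ∞ := ENNReal.rpow_ne_top_of_nonneg (by linarith) (by simp)
    have := hν.top
    finiteness
  intro g hg
  by_cases hfin : ∀ᵐ x ∂ν, g x ≠ ∞
  swap
  · have : ∫⁻ x, g x ^ q ∂ν = ∞ := by
      by_contra hne
      have h := ae_lt_top (by fun_prop) hne
      apply hfin
      filter_upwards [h] with x hx hxt
      rw [hxt, ENNReal.top_rpow_of_pos (by linarith)] at hx
      exact lt_irrefl _ hx
    rw [this, ENNReal.mul_top (by simp)]
    exact le_top
  have hρ : ∀ᵐ x ∂(ν.withDensity g), 2 * g x ≠ ∞ := by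
    apply (withDensity_absolutelyContinuous ν g).ae_le
    filter_upwards [hfin] with x hx
    exact ENNReal.mul_ne_top (by simp) hx
  have h1 := layer_le ν (MM ν g) (MM_measurable ν g) (q := q) (by linarith)
  have h2 := layer_ge (ν.withDensity g) (fun x => 2 * g x) (by fun_prop) (q := q - 1) (by linarith) hρ
  have h3 : ∫⁻ t in Set.Ioi (0:ℝ), ν {x | ENNReal.ofReal t < MM ν g x} * ENNReal.ofReal (t ^ (q - 1))
      ≤ 2 * D * ∫⁻ t in Set.Ioi (0:ℝ), (ν.withDensity g) {x | ENNReal.ofReal t < 2 * g x} *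
        ENNReal.ofReal (t ^ (q - 1 - 1)) := by
    rw [← lintegral_const_mul' _ _ (ENNReal.mul_ne_top (by simp) hν.top)]
    apply setLIntegral_mono' measurableSet_Ioi
    intro t ht
    have ht' : 0 < t := ht
    have := MM_weak' hν g hg (ENNReal.ofReal t)
    rw [withDensity_apply _ (measurableSet_lt (by fun_prop) (by fun_prop))]
    have e : ENNReal.ofReal (t ^ (q - 1)) = ENNReal.ofReal t * ENNReal.ofReal (t ^ (q - 1 - 1)) := by
      rw [← ENNReal.ofReal_mul ht'.le, Real.rpow_sub_one ht'.ne' (q - 1)]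
      congr 1; field_simp
    rw [e]
    calc _ = (ENNReal.ofReal t * ν {x | ENNReal.ofReal t < MM ν g x}) * ENNReal.ofReal (t ^ (q - 1 - 1)) := by ring
      _ ≤ _ := by rw [← mul_assoc]; gcongr
  have h4 : ∫⁻ x, (2 * g x) ^ (q - 1) ∂(ν.withDensity g) = 2 ^ (q - 1) * ∫⁻ x, g x ^ q ∂ν := by
    rw [lintegral_withDensity_eq_lintegral_mul _ hg (by fun_prop), ← lintegral_const_mul _ (by fun_prop)]
    apply lintegral_congr_ae
    filter_upwards [hfin] with x hx
    simp only [Pi.mul_apply]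
    rw [ENNReal.mul_rpow_of_nonneg _ _ (by linarith), mul_left_comm]
    congr 1
    nth_rewrite 1 [← ENNReal.rpow_one (g x)]
    rw [← ENNReal.rpow_add_of_nonneg _ _ (by linarith) (by linarith)]; congr 1; ring
  rw [h4] at h2
  have hq0 : ENNReal.ofReal (q - 1) ≠ 0 := by simp; linarith
  rw [mul_comm, ← ENNReal.le_div_iff_mul_le (Or.inl hq0) (Or.inl (by simp)), ENNReal.div_eq_inv_mul] at h2
  calc _ ≤ _ := h1
    _ ≤ ENNReal.ofReal q * (2 * D * ((ENNReal.ofReal (q - 1))⁻¹ * (2 ^ (q - 1) * ∫⁻ x, g x ^ q ∂ν))) := by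
        gcongr
        exact h3.trans (by gcongr)
    _ = (ENNReal.ofReal q * (2 * D) * (ENNReal.ofReal (q - 1))⁻¹ * 2 ^ (q - 1)) * ∫⁻ x, g x ^ q ∂ν := by ring
    _ ≤ _ := by gcongr; exact le_self_add


lemma vol_ball (c : E3) {r : ℝ} (hr : 0 < r) :
    volume (ball c r) = ENNReal.ofReal (r ^ 3) * volume (ball (0 : E3) 1) := by
  rw [Measure.addHaar_ball_of_pos _ _ hr]; simp

lemma v0_pos : volume (ball (0 : E3) 1) ≠ 0 := (Metric.measure_ball_pos _ _ one_pos).ne'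
lemma v0_fin : volume (ball (0 : E3) 1) ≠ ∞ := measure_ball_lt_top.ne

lemma vol_ball_mul (c c' : E3) {r : ℝ} (hr : 0 < r) (k : ℕ) (hk : 0 < k) :
    volume (ball c (k * r)) = (k ^ 3 : ℕ) * volume (ball c' r) := by
  rw [vol_ball c (by positivity), vol_ball c' hr, mul_pow, ENNReal.ofReal_mul (by positivity), mul_assoc]
  congr 1
  rw [← ENNReal.ofReal_natCast]; push_cast; rfl

/-- `A_p` weight, in `ℝ≥0∞` form over balls. -/
structure Wt (ω : E3 → ℝ≥0∞) (p : ℝ) (A : ℝ≥0∞) : Prop where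
  hp : 1 < p
  meas : Measurable ω
  ne0 : ∀ x, ω x ≠ 0
  net : ∀ x, ω x ≠ ∞
  At : A ≠ ∞
  fin : ∀ c r, ∫⁻ x in ball c r, ω x < ∞
  ap : ∀ c r, 0 < r → (∫⁻ x in ball c r, ω x) * (∫⁻ x in ball c r, ω x ^ (-1 / (p - 1))) ^ (p - 1)
    ≤ A * volume (ball c r) ^ p

namespace Wt
variable {ω : E3 → ℝ≥0∞} {p : ℝ} {A : ℝ≥0∞}

lemma sig_meas (h : Wt ω p A) : Measurable (fun x => ω x ^ (-1 / (p - 1))) := by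
  have := h.meas
  fun_prop

lemma sig_ne0 (h : Wt ω p A) (x : E3) : ω x ^ (-1 / (p - 1)) ≠ 0 := by
  have h1 := h.ne0 x; have h2 := h.net x
  simp [ENNReal.rpow_eq_zero_iff, h1, h2]

lemma sig_net (h : Wt ω p A) (x : E3) : ω x ^ (-1 / (p - 1)) ≠ ∞ := by
  have h1 := h.ne0 x; have h2 := h.net x
  simp [ENNReal.rpow_eq_top_iff, h1, h2]

lemma lint_pos {f : E3 → ℝ≥0∞} (hf : Measurable f) (h0 : ∀ x, f x ≠ 0) (c : E3) {r : ℝ} (hr : 0 < r) :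
    0 < ∫⁻ x in ball c r, f x := by
  rw [setLIntegral_pos_iff hf]
  have : Function.support f = Set.univ := by ext x; simp [h0 x]
  rw [this, Set.univ_inter]
  exact Metric.measure_ball_pos _ _ hr

lemma sig_fin (h : Wt ω p A) (c : E3) (r : ℝ) : ∫⁻ x in ball c r, ω x ^ (-1 / (p - 1)) < ∞ := by
  rcases le_or_gt r 0 with hr | hr
  · rw [Metric.ball_eq_empty.2 hr]; simp
  rw [lt_top_iff_ne_top]
  intro hcon
  have := h.ap c r hr
  rw [hcon, ENNReal.top_rpow_of_pos (by linarith [h.hp]),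
    ENNReal.mul_top (lint_pos h.meas h.ne0 c hr).ne', top_le_iff] at this
  have h2 : volume (ball c r) ^ p ≠ ∞ :=
    ENNReal.rpow_ne_top_of_nonneg (by linarith [h.hp]) measure_ball_lt_top.ne
  exact ENNReal.mul_ne_top h.At h2 this

lemma holder (h : Wt ω p A) {E : Set E3} :
    volume E ^ p ≤ (∫⁻ x in E, ω x) * (∫⁻ x in E, ω x ^ (-1 / (p - 1))) ^ (p - 1) := by
  have hp := h.hp
  have hp1 : p - 1 ≠ 0 := by linarith
  have hp0 : p ≠ 0 := by linarith
  have hpq := Real.HolderConjugate.conjExponent hp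
  have hm := h.meas
  have key := ENNReal.lintegral_mul_le_Lp_mul_Lq (volume.restrict E) hpq
    (f := fun x => ω x ^ (1 / p)) (g := fun x => ω x ^ (-1 / p)) (by fun_prop) (by fun_prop)
  have e1 : ∀ x, ω x ^ (1 / p) * ω x ^ (-1 / p) = 1 := by
    intro x
    rw [← ENNReal.rpow_add _ _ (h.ne0 x) (h.net x)]
    ring_nf; simp
  simp only [Pi.mul_apply, e1, ← ENNReal.rpow_mul] at key
  have e2 : 1 / p * p = 1 := by field_simp
  have e3 : -1 / p * p.conjExponent = -1 / (p - 1) := by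
    rw [Real.conjExponent]; field_simp
  have e4 : 1 / p.conjExponent = (p - 1) / p := by
    rw [Real.conjExponent]; field_simp
  rw [e3, e4] at key
  simp only [e2, ENNReal.rpow_one, lintegral_const, one_mul, Measure.restrict_apply_univ] at key
  calc volume E ^ p ≤ ((∫⁻ x in E, ω x) ^ (1 / p) * (∫⁻ x in E, ω x ^ (-1 / (p - 1))) ^ ((p - 1) / p)) ^ p := by
        gcongr; 
    _ = _ := by
        rw [ENNReal.mul_rpow_of_nonneg _ _ (by linarith), ← ENNReal.rpow_mul, ← ENNReal.rpow_mul, e2, ENNReal.rpow_one]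
        congr 2; field_simp

lemma compW (h : Wt ω p A) {E : Set E3} {c : E3} {r : ℝ} (hr : 0 < r) (hE : E ⊆ ball c r)
    {κ : ℝ≥0∞} (hκ : volume (ball c r) ≤ κ * volume E) :
    ∫⁻ x in ball c r, ω x ≤ A * κ ^ p * ∫⁻ x in E, ω x := by
  have hp := h.hp
  have hE0 : volume E ≠ 0 := by
    intro h0; rw [h0, mul_zero] at hκ
    exact (Metric.measure_ball_pos volume c hr).not_ge hκ
  have hEt : volume E ≠ ∞ := ((measure_mono hE).trans_lt measure_ball_lt_top).ne
  have hP0 : volume E ^ p ≠ 0 := by simp [ENNReal.rpow_eq_zero_iff, hE0, hEt]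
  have hPt : volume E ^ p ≠ ∞ := ENNReal.rpow_ne_top_of_nonneg (by linarith) hEt
  rw [← ENNReal.mul_le_mul_iff_right hP0 hPt]
  calc volume E ^ p * ∫⁻ x in ball c r, ω x
      ≤ ((∫⁻ x in E, ω x) * (∫⁻ x in ball c r, ω x ^ (-1 / (p - 1))) ^ (p - 1)) * ∫⁻ x in ball c r, ω x := by
        gcongr
        refine h.holder.trans ?_
        gcongr
    _ = (∫⁻ x in E, ω x) * ((∫⁻ x in ball c r, ω x) * (∫⁻ x in ball c r, ω x ^ (-1 / (p - 1))) ^ (p - 1)) := by ring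
    _ ≤ (∫⁻ x in E, ω x) * (A * (κ * volume E) ^ p) := by
        gcongr _ * ?_; exact (h.ap c r hr).trans (by gcongr)
    _ = _ := by rw [ENNReal.mul_rpow_of_nonneg _ _ (by linarith)]; ring

lemma compS (h : Wt ω p A) {E : Set E3} {c : E3} {r : ℝ} (hr : 0 < r) (hE : E ⊆ ball c r)
    {κ : ℝ≥0∞} (hκ : volume (ball c r) ≤ κ * volume E) :
    ∫⁻ x in ball c r, ω x ^ (-1 / (p - 1)) ≤ (A * κ ^ p) ^ (1 / (p - 1)) * ∫⁻ x in E, ω x ^ (-1 / (p - 1)) := by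
  have hp := h.hp
  have hE0 : volume E ≠ 0 := by
    intro h0; rw [h0, mul_zero] at hκ
    exact (Metric.measure_ball_pos volume c hr).not_ge hκ
  have hEt : volume E ≠ ∞ := ((measure_mono hE).trans_lt measure_ball_lt_top).ne
  have hP0 : volume E ^ p ≠ 0 := by simp [ENNReal.rpow_eq_zero_iff, hE0, hEt]
  have hPt : volume E ^ p ≠ ∞ := ENNReal.rpow_ne_top_of_nonneg (by linarith) hEt
  rw [← ENNReal.rpow_le_rpow_iff (z := p - 1) (by linarith), ENNReal.mul_rpow_of_nonneg _ _ (by linarith),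
    ← ENNReal.rpow_mul, one_div_mul_cancel (by linarith), ENNReal.rpow_one,
    ← ENNReal.mul_le_mul_iff_right hP0 hPt]
  calc volume E ^ p * (∫⁻ x in ball c r, ω x ^ (-1 / (p - 1))) ^ (p - 1)
      ≤ ((∫⁻ x in ball c r, ω x) * (∫⁻ x in E, ω x ^ (-1 / (p - 1))) ^ (p - 1)) * (∫⁻ x in ball c r, ω x ^ (-1 / (p - 1))) ^ (p - 1) := by
        gcongr
        refine h.holder.trans ?_
        gcongr
    _ = (∫⁻ x in E, ω x ^ (-1 / (p - 1))) ^ (p - 1) * ((∫⁻ x in ball c r, ω x) * (∫⁻ x in ball c r, ω x ^ (-1 / (p - 1))) ^ (p - 1)) := by ring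
    _ ≤ (∫⁻ x in E, ω x ^ (-1 / (p - 1))) ^ (p - 1) * (A * (κ * volume E) ^ p) := by
        gcongr _ * ?_; exact (h.ap c r hr).trans (by gcongr)
    _ = _ := by rw [ENNReal.mul_rpow_of_nonneg _ _ (by linarith)]; ring

lemma dblW (h : Wt ω p A) : Dbl (volume.withDensity ω) (A * (125 : ℝ≥0∞) ^ p) where
  top := ENNReal.mul_ne_top h.At (ENNReal.rpow_ne_top_of_nonneg (by linarith [h.hp]) (by simp))
  pos c r hr := by
    rw [withDensity_apply _ measurableSet_ball]; exact lint_pos h.meas h.ne0 c hr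
  fin c r := by rw [withDensity_apply _ measurableSet_ball]; exact h.fin c r
  dbl c r hr := by
    rw [withDensity_apply _ measurableSet_ball, withDensity_apply _ measurableSet_ball]
    apply h.compW (by positivity) (Metric.ball_subset_ball (by linarith))
    have := vol_ball_mul c c hr 5 (by norm_num)
    rw [Nat.cast_ofNat] at this
    rw [this]; norm_num

lemma dblS (h : Wt ω p A) : Dbl (volume.withDensity (fun x => ω x ^ (-1 / (p - 1)))) ((A * (125 : ℝ≥0∞) ^ p) ^ (1 / (p - 1))) where
  top := ENNReal.rpow_ne_top_of_nonneg (by have := h.hp; apply div_nonneg <;> linarith)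
    (ENNReal.mul_ne_top h.At (ENNReal.rpow_ne_top_of_nonneg (by linarith [h.hp]) (by simp)))
  pos c r hr := by
    rw [withDensity_apply _ measurableSet_ball]; exact lint_pos h.sig_meas h.sig_ne0 c hr
  fin c r := by rw [withDensity_apply _ measurableSet_ball]; exact h.sig_fin c r
  dbl c r hr := by
    rw [withDensity_apply _ measurableSet_ball, withDensity_apply _ measurableSet_ball]
    apply h.compS (by positivity) (Metric.ball_subset_ball (by linarith))
    have := vol_ball_mul c c hr 5 (by norm_num)
    rw [Nat.cast_ofNat] at this
    rw [this]; norm_num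

/-- pointwise bound of Lerner -/
lemma lerner (h : Wt ω p A) (f : E3 → ℝ≥0∞) (hf : Measurable f) (x : E3) :
    MM volume f x ^ (p - 1) ≤ A * MM (volume.withDensity ω)
      (fun y => MM (volume.withDensity (fun x => ω x ^ (-1 / (p - 1))))
        (fun z => f z / ω z ^ (-1 / (p - 1))) y ^ (p - 1) / ω y) x := by
  have hp := h.hp
  have hp1 : 0 < p - 1 := by linarith
  set σ : E3 → ℝ≥0∞ := fun x => ω x ^ (-1 / (p - 1)) with hσ
  have hσm : Measurable σ := h.sig_meas
  set Mσ : E3 → ℝ≥0∞ := MM (volume.withDensity σ) (fun z => f z / σ z) with hMσ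
  have hMm : Measurable Mσ := MM_measurable _ _
  have hωm := h.meas
  set G : E3 → ℝ≥0∞ := fun y => Mσ y ^ (p - 1) / ω y with hG
  rw [← ENNReal.le_rpow_inv_iff hp1]
  refine iSup_le fun c => iSup_le fun r => iSup_le fun hx => ?_
  rw [ENNReal.le_rpow_inv_iff hp1]
  have hr : 0 < r := Metric.pos_of_mem_ball hx
  have hV0 : volume (ball c r) ≠ 0 := (Metric.measure_ball_pos volume c hr).ne'
  have hVt : volume (ball c r) ≠ ∞ := measure_ball_lt_top.ne
  set V := volume (ball c r) with hV
  have hS0 := (lint_pos h.sig_meas h.sig_ne0 c hr).ne'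
  have hSt := (h.sig_fin c r).ne
  have hW0 := (lint_pos h.meas h.ne0 c hr).ne'
  have hWt := (h.fin c r).ne
  have hap := h.ap c r hr
  have e1 : ∫⁻ y in ball c r, f y / σ y ∂(volume.withDensity σ) = ∫⁻ y in ball c r, f y := by
    rw [setLIntegral_withDensity_eq_setLIntegral_mul _ hσm (by fun_prop) measurableSet_ball]
    congr 1; ext y
    simp only [Pi.mul_apply]
    exact ENNReal.mul_div_cancel (h.sig_ne0 y) (h.sig_net y)
  have h1 : ∀ y ∈ ball c r, (∫⁻ y in ball c r, f y) / (∫⁻ x in ball c r, σ x) ≤ Mσ y := by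
    intro y hy
    have := le_MM (volume.withDensity σ) (fun z => f z / σ z) hy
    rwa [withDensity_apply _ measurableSet_ball, e1] at this
  have e2 : ∫⁻ y in ball c r, G y ∂(volume.withDensity ω) = ∫⁻ y in ball c r, Mσ y ^ (p - 1) := by
    rw [setLIntegral_withDensity_eq_setLIntegral_mul _ hωm (by fun_prop) measurableSet_ball]
    congr 1; ext y
    simp only [Pi.mul_apply]
    exact ENNReal.mul_div_cancel (h.ne0 y) (h.net y)
  have h2 : ((∫⁻ y in ball c r, f y) / (∫⁻ x in ball c r, σ x)) ^ (p - 1) * V ≤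
      MM (volume.withDensity ω) G x * ∫⁻ x in ball c r, ω x := by
    have h3 := le_MM (volume.withDensity ω) G hx
    rw [withDensity_apply _ measurableSet_ball, e2, ENNReal.div_le_iff hW0 hWt] at h3
    refine le_trans ?_ h3
    rw [← setLIntegral_const]
    apply setLIntegral_mono' measurableSet_ball
    intro y hy
    gcongr
    exact h1 y hy
  have hVp0 : V ^ p ≠ 0 := by simp [ENNReal.rpow_eq_zero_iff, hV0, hVt]
  have hVpt : V ^ p ≠ ∞ := ENNReal.rpow_ne_top_of_nonneg (by linarith) hVt
  have hVp : V ^ p = V ^ (p - 1) * V := by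
    nth_rewrite 3 [← ENNReal.rpow_one V]
    rw [← ENNReal.rpow_add _ _ hV0 hVt]; congr 1; ring
  rw [← ENNReal.mul_le_mul_iff_left hVp0 hVpt]
  set If := ∫⁻ y in ball c r, f y
  set S := ∫⁻ x in ball c r, σ x
  calc (If / V) ^ (p - 1) * V ^ p = (If / V * V) ^ (p - 1) * V := by
        rw [hVp, ENNReal.mul_rpow_of_nonneg _ _ hp1.le, mul_assoc]
    _ = (If / S * S) ^ (p - 1) * V := by
        rw [ENNReal.div_mul_cancel hV0 hVt, ENNReal.div_mul_cancel hS0 hSt]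
    _ = ((If / S) ^ (p - 1) * V) * S ^ (p - 1) := by
        rw [ENNReal.mul_rpow_of_nonneg _ _ hp1.le]; ring
    _ ≤ (MM (volume.withDensity ω) G x * ∫⁻ x in ball c r, ω x) * S ^ (p - 1) := by gcongr
    _ = MM (volume.withDensity ω) G x * ((∫⁻ x in ball c r, ω x) * S ^ (p - 1)) := by ring
    _ ≤ MM (volume.withDensity ω) G x * (A * V ^ p) := by gcongr _ * ?_
    _ = _ := by ring

/-- Muckenhoupt's theorem -/
lemma muck (h : Wt ω p A) : ∃ C : ℝ≥0∞, C ≠ ∞ ∧ ∀ f : E3 → ℝ≥0∞, Measurable f →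
    ∫⁻ x, MM volume f x ^ p ∂(volume.withDensity ω) ≤ C * ∫⁻ x, f x ^ p ∂(volume.withDensity ω) := by
  have hp := h.hp
  have hp1 : 0 < p - 1 := by linarith
  have hq : 1 < p / (p - 1) := by rw [lt_div_iff₀ hp1]; linarith
  obtain ⟨C1, hC1, H1⟩ := MM_strong h.dblW hq
  obtain ⟨C2, hC2, H2⟩ := MM_strong h.dblS hp
  have hωm := h.meas
  have hσm := h.sig_meas
  refine ⟨A ^ (p / (p - 1)) * C1 * C2, ?_, ?_⟩
  · have : A ^ (p / (p - 1)) ≠ ∞ := ENNReal.rpow_ne_top_of_nonneg (by linarith) h.At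
    finiteness
  intro f hf
  set σ : E3 → ℝ≥0∞ := fun x => ω x ^ (-1 / (p - 1)) with hσ
  set Mσ : E3 → ℝ≥0∞ := MM (volume.withDensity σ) (fun z => f z / σ z) with hMσ
  have hMm : Measurable Mσ := MM_measurable _ _
  set G : E3 → ℝ≥0∞ := fun y => Mσ y ^ (p - 1) / ω y with hG
  have hGm : Measurable G := by fun_prop
  calc ∫⁻ x, MM volume f x ^ p ∂(volume.withDensity ω)
      ≤ ∫⁻ x, (A * MM (volume.withDensity ω) G x) ^ (p / (p - 1)) ∂(volume.withDensity ω) := by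
        gcongr with x
        have := h.lerner f hf x
        calc MM volume f x ^ p = (MM volume f x ^ (p - 1)) ^ (p / (p - 1)) := by
              rw [← ENNReal.rpow_mul, mul_div_cancel₀ _ hp1.ne']
          _ ≤ _ := by gcongr
    _ = A ^ (p / (p - 1)) * ∫⁻ x, (MM (volume.withDensity ω) G x) ^ (p / (p - 1)) ∂(volume.withDensity ω) := by
        have := MM_measurable (volume.withDensity ω) G
        rw [← lintegral_const_mul _ (by fun_prop)]
        congr 1; ext x
        rw [ENNReal.mul_rpow_of_nonneg _ _ (by linarith)]
    _ ≤ A ^ (p / (p - 1)) * (C1 * ∫⁻ x, G x ^ (p / (p - 1)) ∂(volume.withDensity ω)) := by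
        gcongr; exact H1 G hGm
    _ = A ^ (p / (p - 1)) * (C1 * ∫⁻ x, Mσ x ^ p ∂(volume.withDensity σ)) := by
        congr 2
        rw [lintegral_withDensity_eq_lintegral_mul _ hωm (by fun_prop),
          lintegral_withDensity_eq_lintegral_mul _ hσm (by fun_prop)]
        congr 1; ext y
        simp only [Pi.mul_apply, hG]
        rw [ENNReal.div_rpow_of_nonneg _ _ (by linarith), ← ENNReal.rpow_mul, mul_div_cancel₀ _ hp1.ne',
          div_eq_mul_inv, mul_left_comm, mul_comm (σ y)]
        congr 1
        rw [← ENNReal.rpow_neg]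
        nth_rewrite 1 [← ENNReal.rpow_one (ω y)]
        rw [← ENNReal.rpow_add _ _ (h.ne0 y) (h.net y), hσ]
        congr 1; field_simp; ring
    _ ≤ A ^ (p / (p - 1)) * (C1 * (C2 * ∫⁻ x, (f x / σ x) ^ p ∂(volume.withDensity σ))) := by
        gcongr; exact H2 _ (by fun_prop)
    _ = A ^ (p / (p - 1)) * (C1 * (C2 * ∫⁻ x, f x ^ p ∂(volume.withDensity ω))) := by
        congr 3
        rw [lintegral_withDensity_eq_lintegral_mul _ hωm (by fun_prop),
          lintegral_withDensity_eq_lintegral_mul _ hσm (by fun_prop)]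
        congr 1; ext y
        simp only [Pi.mul_apply]
        rw [ENNReal.div_rpow_of_nonneg _ _ (by linarith), div_eq_mul_inv, mul_left_comm, mul_comm (ω y)]
        congr 1
        simp only [hσ]
        rw [← ENNReal.rpow_mul, ← ENNReal.rpow_neg, ← ENNReal.rpow_add _ _ (h.ne0 y) (h.net y)]
        nth_rewrite 2 [← ENNReal.rpow_one (ω y)]
        congr 1; field_simp; ring
    _ = _ := by ring

end Wt


/-- dyadic index -/
def idx (L : ℝ) (k : ℕ) (x : E3) : Fin 3 → ℤ := fun i => ⌊(2:ℝ) ^ k * (x i / L + 1 / 2)⌋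
/-- dyadic cell -/
def cell (L : ℝ) (k : ℕ) (m : Fin 3 → ℤ) : Set E3 := {x | idx L k x = m}
/-- dyadic center -/
def ctr (L : ℝ) (k : ℕ) (m : Fin 3 → ℤ) : E3 :=
  WithLp.toLp 2 (fun i => L * (((m i : ℝ) + 1 / 2) / 2 ^ k - 1 / 2))
/-- dyadic side -/
def sd (L : ℝ) (k : ℕ) : ℝ := L / 2 ^ k

lemma sd_pos {L : ℝ} (hL : 0 < L) (k : ℕ) : 0 < sd L k := by unfold sd; positivity

lemma mem_cell_iff {L : ℝ} {k : ℕ} {m : Fin 3 → ℤ} {x : E3} :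
    x ∈ cell L k m ↔ ∀ i, (m i : ℝ) ≤ (2:ℝ) ^ k * (x i / L + 1 / 2) ∧ (2:ℝ) ^ k * (x i / L + 1 / 2) < m i + 1 := by
  simp only [cell, Set.mem_ofPred_eq, funext_iff, idx, Int.floor_eq_iff]

lemma mem_cell_idx (L : ℝ) (k : ℕ) (x : E3) : x ∈ cell L k (idx L k x) := rfl

lemma idx_of_mem {L : ℝ} {k : ℕ} {m : Fin 3 → ℤ} {x : E3} (h : x ∈ cell L k m) : idx L k x = m := h

lemma cell_aux {L : ℝ} (hL : 0 < L) (k : ℕ) (m : Fin 3 → ℤ) (x : E3) (i : Fin 3) :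
    (2:ℝ) ^ k * (x i / L + 1 / 2) - (m i + 1 / 2) = (x i - ctr L k m i) / sd L k := by
  simp only [ctr, sd]
  field_simp
  ring

lemma mem_cell_iff' {L : ℝ} (hL : 0 < L) {k : ℕ} {m : Fin 3 → ℤ} {x : E3} :
    x ∈ cell L k m ↔ ∀ i, -(sd L k / 2) ≤ x i - ctr L k m i ∧ x i - ctr L k m i < sd L k / 2 := by
  rw [mem_cell_iff]
  have hs := sd_pos hL k
  refine forall_congr' fun i => ?_
  have := cell_aux hL k m x i
  have h1 : x i - ctr L k m i = sd L k * ((2:ℝ) ^ k * (x i / L + 1 / 2) - (m i + 1 / 2)) := by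
    rw [this]; field_simp
  rw [h1]
  constructor
  · rintro ⟨h2, h3⟩
    constructor <;> nlinarith
  · rintro ⟨h2, h3⟩
    constructor <;> nlinarith

lemma cell_sub_ball {L : ℝ} (hL : 0 < L) (k : ℕ) (m : Fin 3 → ℤ) :
    cell L k m ⊆ ball (ctr L k m) (sd L k) := by
  intro x hx
  rw [mem_cell_iff' hL] at hx
  have hs := sd_pos hL k
  rw [Metric.mem_ball, EuclideanSpace.dist_eq, Real.sqrt_lt' hs, Fin.sum_univ_three]
  simp only [Real.dist_eq, sq_abs]
  have : ∀ i, (x i - ctr L k m i) ^ 2 ≤ (sd L k / 2) ^ 2 := by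
    intro i
    apply sq_le_sq' (hx i).1 (hx i).2.le
  nlinarith [this 0, this 1, this 2]

lemma ball_sub_cell {L : ℝ} (hL : 0 < L) (k : ℕ) (m : Fin 3 → ℤ) :
    ball (ctr L k m) (sd L k / 2) ⊆ cell L k m := by
  intro x hx
  rw [mem_cell_iff' hL]
  intro i
  have h1 : |x i - ctr L k m i| ≤ ‖x - ctr L k m‖ := by
    have := PiLp.norm_apply_le (x - ctr L k m) i
    simpa using this
  rw [mem_ball_iff_norm] at hx
  have := abs_lt.1 (h1.trans_lt hx)
  exact ⟨this.1.le, this.2⟩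

lemma ctr_mem {L : ℝ} (hL : 0 < L) (k : ℕ) (m : Fin 3 → ℤ) : ctr L k m ∈ cell L k m :=
  ball_sub_cell hL k m (Metric.mem_ball_self (by have := sd_pos hL k; positivity))

lemma idx_measurable (L : ℝ) (k : ℕ) : Measurable (idx L k) := by
  unfold idx
  refine measurable_pi_lambda _ fun i => ?_
  refine Int.measurable_floor.comp ?_
  fun_prop

lemma cell_meas (L : ℝ) (k : ℕ) (m : Fin 3 → ℤ) : MeasurableSet (cell L k m) :=
  idx_measurable L k (measurableSet_singleton m)

/-- parent index -/
def par (m : Fin 3 → ℤ) : Fin 3 → ℤ := fun i => m i / 2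

lemma idx_succ (L : ℝ) (k : ℕ) (x : E3) : idx L k x = par (idx L (k+1) x) := by
  ext i
  simp only [idx, par]
  rw [Int.floor_eq_iff]
  have h1 := Int.floor_le ((2:ℝ) ^ (k+1) * (x i / L + 1 / 2))
  have h2 := Int.lt_floor_add_one ((2:ℝ) ^ (k+1) * (x i / L + 1 / 2))
  set n := ⌊(2:ℝ) ^ (k+1) * (x i / L + 1 / 2)⌋
  have e : (2:ℝ) ^ (k+1) * (x i / L + 1 / 2) = 2 * ((2:ℝ) ^ k * (x i / L + 1 / 2)) := by ring
  rw [e] at h1 h2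
  have h3 : 2 * (n / 2) ≤ n := by omega
  have h4 : n + 1 ≤ 2 * (n / 2) + 2 := by omega
  have h3' : (2:ℝ) * ((n / 2 : ℤ) : ℝ) ≤ n := by exact_mod_cast h3
  have h4' : (n:ℝ) + 1 ≤ 2 * ((n / 2 : ℤ) : ℝ) + 2 := by exact_mod_cast h4
  constructor <;> linarith

lemma idx_eq_of_le (L : ℝ) {j k : ℕ} (hjk : j ≤ k) {x y : E3} (h : idx L k x = idx L k y) :
    idx L j x = idx L j y := by
  induction k, hjk using Nat.le_induction with
  | base => exact h
  | succ k hk ih =>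
    apply ih
    rw [idx_succ, idx_succ L k y, h]

lemma cell_sub_cell (L : ℝ) {j k : ℕ} (hjk : j ≤ k) (x : E3) :
    cell L k (idx L k x) ⊆ cell L j (idx L j x) := fun _ hy => idx_eq_of_le L hjk hy

lemma cell_sub_par {L : ℝ} (k : ℕ) (m : Fin 3 → ℤ) : cell L (k+1) m ⊆ cell L k (par m) := by
  intro x hx
  show idx L k x = par m
  rw [idx_succ, idx_of_mem hx]

lemma cell_vol_pos {L : ℝ} (hL : 0 < L) (k : ℕ) (m : Fin 3 → ℤ) : volume (cell L k m) ≠ 0 := by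
  have := sd_pos hL k
  exact ((Metric.measure_ball_pos volume (ctr L k m) (by positivity : 0 < sd L k / 2)).trans_le
    (measure_mono (ball_sub_cell hL k m))).ne'

lemma cell_vol_fin {L : ℝ} (hL : 0 < L) (k : ℕ) (m : Fin 3 → ℤ) : volume (cell L k m) ≠ ∞ :=
  ((measure_mono (cell_sub_ball hL k m)).trans_lt measure_ball_lt_top).ne

lemma ball_le_cell {L : ℝ} (hL : 0 < L) (k : ℕ) (m : Fin 3 → ℤ) (c : E3) (n : ℕ) (hn : 0 < n) :
    volume (ball c (n * (sd L k / 2))) ≤ (n ^ 3 : ℕ) * volume (cell L k m) := by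
  have := sd_pos hL k
  rw [vol_ball_mul c (ctr L k m) (by positivity) n hn]
  gcongr
  exact ball_sub_cell hL k m

lemma par_le {L : ℝ} (hL : 0 < L) (k : ℕ) (m : Fin 3 → ℤ) :
    volume (cell L k (par m)) ≤ 64 * volume (cell L (k+1) m) := by
  have h := ball_le_cell hL (k+1) m (ctr L k (par m)) 4 (by norm_num)
  have e : ((4:ℕ) : ℝ) * (sd L (k+1) / 2) = sd L k := by
    unfold sd; rw [pow_succ]; field_simp; norm_num
  rw [e] at h
  refine (measure_mono (cell_sub_ball hL k _)).trans (h.trans (le_of_eq ?_))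
  congr 1

/-- stopping cells -/
def stp (L : ℝ) (P : ℕ → (Fin 3 → ℤ) → Prop) : Set (ℕ × (Fin 3 → ℤ)) :=
  {a | P a.1 a.2 ∧ ∀ j < a.1, ∀ x ∈ cell L a.1 a.2, ¬ P j (idx L j x)}

lemma stp_eq {L : ℝ} {P : ℕ → (Fin 3 → ℤ) → Prop} {a b : ℕ × (Fin 3 → ℤ)} (ha : a ∈ stp L P)
    (hb : b ∈ stp L P) {x : E3} (hxa : x ∈ cell L a.1 a.2) (hxb : x ∈ cell L b.1 b.2) : a = b := by
  have h1 : ¬ a.1 < b.1 := fun h => hb.2 _ h x hxb (by rw [idx_of_mem hxa]; exact ha.1)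
  have h2 : ¬ b.1 < a.1 := fun h => ha.2 _ h x hxa (by rw [idx_of_mem hxb]; exact hb.1)
  have h3 : a.1 = b.1 := by omega
  refine Prod.ext h3 ?_
  rw [← idx_of_mem hxa, ← idx_of_mem hxb, h3]

lemma stp_disj (L : ℝ) (P : ℕ → (Fin 3 → ℤ) → Prop) :
    Pairwise (Function.onFun Disjoint fun a : stp L P => cell L a.1.1 a.1.2) := by
  intro a b hab
  rw [Function.onFun, Set.disjoint_left]
  intro x hxa hxb
  exact hab (Subtype.ext (stp_eq a.2 b.2 hxa hxb))

lemma stp_cover (L : ℝ) (P : ℕ → (Fin 3 → ℤ) → Prop) {x : E3} (h : ∃ k, P k (idx L k x)) :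
    ∃ a : stp L P, x ∈ cell L a.1.1 a.1.2 := by
  classical
  refine ⟨⟨(Nat.find h, idx L (Nat.find h) x), Nat.find_spec h, ?_⟩, rfl⟩
  intro j hj y hy
  have : idx L j y = idx L j x := idx_eq_of_le L hj.le hy
  rw [this]
  exact Nat.find_min h hj

lemma stp_par {L : ℝ} (hL : 0 < L) {P : ℕ → (Fin 3 → ℤ) → Prop} {k : ℕ} {m : Fin 3 → ℤ}
    (h : (k + 1, m) ∈ stp L P) : ¬ P k (par m) := by
  have := h.2 k (Nat.lt_succ_self k) _ (ctr_mem hL _ _)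
  rwa [idx_succ, idx_of_mem (ctr_mem hL _ _)] at this

lemma small_cell {L : ℝ} (x : E3) {ε : ℝ} (hε : 0 < ε) (hL : 0 < L) :
    ∃ k0, ∀ k ≥ k0, cell L k (idx L k x) ⊆ ball x ε := by
  have ht : Tendsto (fun k : ℕ => L / (2:ℝ) ^ k) atTop (𝓝 0) :=
    tendsto_const_nhds.div_atTop (tendsto_pow_atTop_atTop_of_one_lt (by norm_num))
  have := (ht.eventually (gt_mem_nhds (by positivity : 0 < ε / 2)))
  obtain ⟨k0, hk0⟩ := eventually_atTop.1 this
  refine ⟨k0, fun k hk y hy => ?_⟩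
  have h1 := cell_sub_ball hL k _ hy
  have h2 := cell_sub_ball hL k _ (mem_cell_idx L k x)
  have h3 := hk0 k hk
  rw [Metric.mem_ball] at *
  have := dist_triangle_right y x (ctr L k (idx L k x))
  unfold sd at *
  linarith

lemma ball_sub_top {L : ℝ} (hL : 0 < L) : ball 0 (L / 2) ⊆ cell L 0 0 := by
  have := ball_sub_cell hL 0 0
  have e : ctr L 0 0 = 0 := by ext i; simp [ctr]
  rw [e] at this
  simpa [sd] using this


lemma kids {L : ℝ} (hL : 0 < L) {F : E3 → ℝ} (hF : Continuous F) (c a : ℝ) (k : ℕ) (m : Fin 3 → ℤ)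
    (hosc : 512 * volume (cell L k m ∩ {x | a < |F x - c|}) ≤ volume (cell L k m)) :
    ∃ S : Set (ℕ × (Fin 3 → ℤ)),
      Pairwise (Function.onFun Disjoint fun b : S => cell L b.1.1 b.1.2) ∧
      (∀ b : S, cell L b.1.1 b.1.2 ⊆ cell L k m) ∧
      (∀ b : S, 4 * volume (cell L b.1.1 b.1.2 ∩ {x | a < |F x - c|}) ≤ volume (cell L b.1.1 b.1.2)) ∧
      2 * volume (⋃ b : S, cell L b.1.1 b.1.2) ≤ volume (cell L k m) ∧
      ∀ x ∈ cell L k m, x ∉ (⋃ b : S, cell L b.1.1 b.1.2) → |F x - c| ≤ a := by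
  set Bad := {x | a < |F x - c|} with hBad
  have hBo : IsOpen Bad := isOpen_lt continuous_const (by fun_prop)
  let P : ℕ → (Fin 3 → ℤ) → Prop := fun k' m' => k < k' ∧ cell L k' m' ⊆ cell L k m ∧
    volume (cell L k' m') < 256 * volume (cell L k' m' ∩ Bad)
  have hsub : ∀ b : stp L P, cell L b.1.1 b.1.2 ⊆ cell L k m := fun b => b.2.1.2.1
  refine ⟨stp L P, stp_disj L P, hsub, ?_, ?_, ?_⟩
  · rintro ⟨⟨k', m'⟩, hb⟩
    dsimp only
    obtain ⟨k1, rfl⟩ : ∃ k1, k' = k1 + 1 := ⟨k' - 1, by have : k < k' := hb.1.1; omega⟩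
    have hk : k < k1 + 1 := hb.1.1
    have hnp := stp_par hL hb
    have hpk : cell L k1 (par m') ⊆ cell L k m := by
      intro y hy
      have hx := ctr_mem hL (k1+1) m'
      have hx1 := cell_sub_par _ _ hx
      have : idx L k1 y = idx L k1 (ctr L (k1+1) m') := by rw [idx_of_mem hy, idx_of_mem hx1]
      have h2 := idx_eq_of_le L (Nat.lt_succ_iff.1 hk) this
      have h3 := hb.1.2.1 hx
      show idx L k y = m
      rw [h2]; exact h3
    have hp := par_le hL k1 m'
    have hs := cell_sub_par (L := L) k1 m'
    have key : 256 * volume (cell L (k1+1) m' ∩ Bad) ≤ volume (cell L k1 (par m')) := by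
      rcases (Nat.lt_succ_iff.1 hk).lt_or_eq with h | h
      · have : ¬ (volume (cell L k1 (par m')) < 256 * volume (cell L k1 (par m') ∩ Bad)) :=
          fun h' => hnp ⟨h, hpk, h'⟩
        refine le_trans ?_ (not_lt.1 this)
        gcongr
      · subst h
        have : par m' = m := by
          have h1 := hpk (ctr_mem hL k (par m'))
          rw [← idx_of_mem h1, idx_of_mem (ctr_mem hL k (par m'))]
        rw [this] at hs ⊢
        refine le_trans ?_ hosc
        gcongr
        norm_num
    have h4 := key.trans hp
    have e : (256 : ℝ≥0∞) = 64 * 4 := by norm_num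
    rw [e, mul_assoc] at h4
    exact (ENNReal.mul_le_mul_iff_right (by norm_num) (by norm_num)).1 h4
  · rw [measure_iUnion (stp_disj L P) (fun b => cell_meas _ _ _)]
    have h1 : ∑' b : stp L P, volume (cell L b.1.1 b.1.2) ≤ 256 * volume (cell L k m ∩ Bad) := by
      calc ∑' b : stp L P, volume (cell L b.1.1 b.1.2)
          ≤ ∑' b : stp L P, 256 * volume (cell L b.1.1 b.1.2 ∩ Bad) :=
            ENNReal.tsum_le_tsum fun b => b.2.1.2.2.le
        _ = 256 * volume (⋃ b : stp L P, (cell L b.1.1 b.1.2 ∩ Bad)) := by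
            rw [ENNReal.tsum_mul_left, measure_iUnion]
            · intro b b' h
              exact (stp_disj L P h).mono Set.inter_subset_left Set.inter_subset_left
            · exact fun b => (cell_meas _ _ _).inter hBo.measurableSet
        _ ≤ _ := by
            gcongr
            exact Set.iUnion_subset fun b => Set.inter_subset_inter_left _ (hsub b)
    calc _ ≤ 2 * (256 * volume (cell L k m ∩ Bad)) := by gcongr
      _ = 512 * volume (cell L k m ∩ Bad) := by rw [← mul_assoc]; norm_num
      _ ≤ _ := hosc
  · intro x hx hxn
    by_contra hlt
    push Not at hlt
    have hxB : x ∈ Bad := hlt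
    obtain ⟨ε, hε, hεB⟩ := Metric.isOpen_iff.1 hBo x hxB
    obtain ⟨k0, hk0⟩ := small_cell (L := L) x hε hL
    have := hk0 (max k0 (k+1)) (le_max_left _ _)
    apply hxn
    rw [Set.mem_iUnion]
    apply stp_cover L P
    refine ⟨max k0 (k+1), ?_, ?_, ?_⟩
    · exact lt_of_lt_of_le (Nat.lt_succ_self k) (le_max_right _ _)
    · have := cell_sub_cell L (show k ≤ max k0 (k+1) by omega) x
      rwa [idx_of_mem hx] at this
    · rw [Set.inter_eq_left.2 (this.trans hεB)]
      have h0 := cell_vol_pos hL (max k0 (k+1)) (idx L (max k0 (k+1)) x)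
      have h1 := cell_vol_fin hL (max k0 (k+1)) (idx L (max k0 (k+1)) x)
      conv_lhs => rw [← one_mul (volume _)]
      exact ENNReal.mul_lt_mul_left h0 h1 (by norm_num)

/-- closeness of constants -/
lemma const_close {L : ℝ} (hL : 0 < L) {F : E3 → ℝ} {c a c' a' : ℝ} {k : ℕ} {m : Fin 3 → ℤ}
    (h1 : 4 * volume (cell L k m ∩ {x | a < |F x - c|}) ≤ volume (cell L k m))
    (h2 : 4 * volume (cell L k m ∩ {x | a' < |F x - c'|}) ≤ volume (cell L k m)) :
    |c - c'| ≤ a + a' := by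
  by_contra hlt
  push Not at hlt
  have hsub : cell L k m ⊆ (cell L k m ∩ {x | a < |F x - c|}) ∪ (cell L k m ∩ {x | a' < |F x - c'|}) := by
    intro x hx
    by_cases h : a < |F x - c|
    · exact Or.inl ⟨hx, h⟩
    · refine Or.inr ⟨hx, ?_⟩
      show a' < |F x - c'|
      have := abs_sub_le c (F x) c'
      rw [abs_sub_comm c (F x)] at this
      linarith
  have h3 := (measure_mono hsub).trans (measure_union_le (μ := volume) _ _)
  have h4 : 4 * volume (cell L k m) ≤ 2 * volume (cell L k m) := by
    calc _ ≤ 4 * (volume (cell L k m ∩ {x | a < |F x - c|}) + volume (cell L k m ∩ {x | a' < |F x - c'|})) := by gcongr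
      _ ≤ _ := by rw [mul_add, two_mul]; gcongr
  rw [ENNReal.mul_le_mul_iff_left (cell_vol_pos hL k m) (cell_vol_fin hL k m)] at h4
  norm_num at h4

theorem fefferman_stein {L : ℝ} (hL : 0 < L) {μ : Measure E3} {B : ℝ≥0∞} (hBt : B ≠ ∞)
    (hfin : ∀ c r, μ (ball c r) < ∞)
    (hpos : ∀ c r, 0 < r → 0 < μ (ball c r))
    (hB : ∀ k m E, E ⊆ cell L k m → MeasurableSet E → volume (cell L k m) ≤ 2 * volume E →
      μ (ball (ctr L k m) (sd L k)) ≤ B * μ E)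
    {F : E3 → ℝ} (hF : Continuous F) {cc aa : ℕ → (Fin 3 → ℤ) → ℝ} {M : ℝ}
    (hFM : ∀ x, |F x| ≤ M) (haM : ∀ k m, aa k m ≤ M) (ha0 : ∀ k m, 0 ≤ aa k m)
    (hosc : ∀ k m, 512 * volume (cell L k m ∩ {x | aa k m < |F x - cc k m|}) ≤ volume (cell L k m))
    {g H : E3 → ℝ≥0∞} (hg : Measurable g) (hH : Measurable H) {G : ℝ≥0∞} (hG : G ≠ ∞) (hgG : ∀ x, g x ≤ G)
    (haH : ∀ k m, ∀ x ∈ cell L k m, ENNReal.ofReal (aa k m) ≤ H x) (k : ℕ) (m : Fin 3 → ℤ) :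
    ∫⁻ x in cell L k m, ENNReal.ofReal |F x - cc k m| * g x ∂μ
      + ENNReal.ofReal (aa k m) * ∫⁻ x in cell L k m, g x ∂μ
      ≤ 2 * B * ∫⁻ x in cell L k m, H x * MM μ g x ∂μ := by
  have hMm := MM_measurable μ g
  set Y : ℕ → (Fin 3 → ℤ) → ℝ≥0∞ := fun k m => ∫⁻ x in cell L k m, ENNReal.ofReal |F x - cc k m| * g x ∂μ
      + ENNReal.ofReal (aa k m) * ∫⁻ x in cell L k m, g x ∂μ with hY
  have hosc4 : ∀ k m, 4 * volume (cell L k m ∩ {x | aa k m < |F x - cc k m|}) ≤ volume (cell L k m) := by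
    intro k m
    refine le_trans ?_ (hosc k m)
    gcongr
    norm_num
  have hμc : ∀ k m, μ (cell L k m) ≠ ∞ := fun k m =>
    ((measure_mono (cell_sub_ball hL k m)).trans_lt (hfin _ _)).ne
  have hM0 : 0 ≤ M := (ha0 0 0).trans (haM 0 0)
  -- constants bounded
  have hccM : ∀ k m x, |F x - cc k m| ≤ 3 * M := by
    intro k m x
    have hne : ∃ y, |F y - cc k m| ≤ aa k m := by
      by_contra hn
      push Not at hn
      have : cell L k m ∩ {x | aa k m < |F x - cc k m|} = cell L k m :=
        Set.inter_eq_left.2 fun x _ => hn x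
      have h := hosc4 k m
      rw [this] at h
      have h0 := cell_vol_pos hL k m
      have h1 := cell_vol_fin hL k m
      have : (4:ℝ≥0∞) * volume (cell L k m) ≤ 1 * volume (cell L k m) := by rwa [one_mul]
      rw [ENNReal.mul_le_mul_iff_left h0 h1] at this
      norm_num at this
    obtain ⟨y, hy⟩ := hne
    have h1 := hFM x
    have h2 := hFM y
    have h3 := haM k m
    rw [abs_le] at *
    constructor <;> linarith
  set K : ℝ≥0∞ := ENNReal.ofReal (4 * M) * G with hK
  have hKt : K ≠ ∞ := by finiteness
  have base : ∀ k m, Y k m ≤ K * μ (cell L k m) := by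
    intro k m
    have h1 : ∫⁻ x in cell L k m, ENNReal.ofReal |F x - cc k m| * g x ∂μ ≤ ENNReal.ofReal (3 * M) * G * μ (cell L k m) := by
      rw [← setLIntegral_const]
      gcongr with x
      · exact hccM k m x
      · exact hgG x
    have h2 : ENNReal.ofReal (aa k m) * ∫⁻ x in cell L k m, g x ∂μ ≤ ENNReal.ofReal M * (G * μ (cell L k m)) := by
      rw [← setLIntegral_const]
      gcongr with x
      · exact haM k m
      · exact hgG x
    refine (add_le_add h1 h2).trans (le_of_eq ?_)
    rw [hK, show 4 * M = 3 * M + M by ring, ENNReal.ofReal_add (by positivity) hM0]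
    ring
  set θ : ℝ≥0∞ := 1 - B⁻¹ with hθ
  have step : ∀ n : ℕ, ∀ k m, Y k m ≤ 2 * B * ∫⁻ x in cell L k m, H x * MM μ g x ∂μ + K * θ ^ n * μ (cell L k m) := by
    intro n
    induction n with
    | zero => intro k m; rw [pow_zero, mul_one]; exact (base k m).trans le_add_self
    | succ n ih =>
      intro k m
      obtain ⟨S, hSd, hSs, hS4, hS2, hSo⟩ := kids hL hF (cc k m) (aa k m) k m (hosc k m)
      set U := ⋃ b : S, cell L b.1.1 b.1.2 with hU
      have hUm : MeasurableSet U := MeasurableSet.iUnion fun b => cell_meas _ _ _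
      have hUs : U ⊆ cell L k m := Set.iUnion_subset hSs
      set E := cell L k m \ U with hE
      have hEm : MeasurableSet E := (cell_meas _ _ _).diff hUm
      have hEs : E ⊆ cell L k m := Set.sdiff_subset
      have hUfin : volume U ≠ ∞ := ((measure_mono hUs).trans_lt (cell_vol_fin hL k m).lt_top).ne
      have hEv : volume (cell L k m) ≤ 2 * volume E := by
        have h1 : volume (cell L k m) = volume U + volume E := by
          rw [hE, measure_add_sdiff hUm.nullMeasurableSet, Set.union_eq_right.2 hUs]
        have h2 : 2 * volume U ≤ volume U + volume E := h1 ▸ hS2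
        rw [two_mul] at h2
        have h3 := (ENNReal.add_le_add_iff_left hUfin).1 h2
        rw [h1, two_mul]; gcongr
      have hBE := hB k m E hEs hEm hEv
      have hs := sd_pos hL k
      have hμE0 : μ E ≠ 0 := by
        intro h0
        rw [h0, mul_zero] at hBE
        exact (hpos _ _ hs).not_ge hBE
      have hμEt : μ E ≠ ∞ := ((measure_mono hEs).trans_lt (hμc k m).lt_top).ne
      -- main term
      have hmain : ENNReal.ofReal (aa k m) * ∫⁻ x in cell L k m, g x ∂μ ≤ B * ∫⁻ x in E, H x * MM μ g x ∂μ := by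
        have h1 : (ENNReal.ofReal (aa k m) * ∫⁻ x in cell L k m, g x ∂μ) * μ E
            ≤ μ (ball (ctr L k m) (sd L k)) * ∫⁻ x in E, H x * MM μ g x ∂μ := by
          rw [← setLIntegral_const, ← lintegral_const_mul (μ := μ.restrict E) (μ (ball (ctr L k m) (sd L k))) (by fun_prop : Measurable fun x => H x * MM μ g x)]
          apply setLIntegral_mono (by fun_prop)
          intro x hx
          have hx' := cell_sub_ball hL k m (hEs hx)
          have h2 := le_MM μ g hx'
          rw [ENNReal.div_le_iff (hpos _ _ hs).ne' (hfin _ _).ne] at h2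
          calc _ ≤ H x * (MM μ g x * μ (ball (ctr L k m) (sd L k))) := by
                gcongr
                · exact haH k m x (hEs hx)
                · exact (lintegral_mono_set (cell_sub_ball hL k m)).trans h2
            _ = _ := by ring
        have h3 : (ENNReal.ofReal (aa k m) * ∫⁻ x in cell L k m, g x ∂μ) * μ E
            ≤ (B * ∫⁻ x in E, H x * MM μ g x ∂μ) * μ E := by
          refine h1.trans ((mul_le_mul_left hBE _).trans (le_of_eq (by ring)))
        exact (ENNReal.mul_le_mul_iff_left hμE0 hμEt).1 h3
      -- contraction
      have hμU : μ U ≤ θ * μ (cell L k m) := by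
        have hEU : U = cell L k m \ E := by rw [hE, Set.sdiff_sdiff_cancel_left hUs]
        rw [hEU, measure_sdiff hEs hEm.nullMeasurableSet hμEt, hθ, ENNReal.sub_mul (fun _ _ => hμc k m), one_mul]
        gcongr
        rw [mul_comm, ← div_eq_mul_inv]
        apply ENNReal.div_le_of_le_mul'
        exact (measure_mono (cell_sub_ball hL k m)).trans hBE
      have hsplit : ∀ f : E3 → ℝ≥0∞, ∫⁻ x in cell L k m, f x ∂μ = ∫⁻ x in E, f x ∂μ + ∑' b : S, ∫⁻ x in cell L b.1.1 b.1.2, f x ∂μ := by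
        intro f
        rw [← lintegral_iUnion (fun b => cell_meas _ _ _) hSd, ← lintegral_union hUm]
        · rw [hE, Set.sdiff_union_of_subset hUs]
        · exact Set.disjoint_sdiff_left
      have hYle : Y k m ≤ 2 * (ENNReal.ofReal (aa k m) * ∫⁻ x in cell L k m, g x ∂μ) + ∑' b : S, Y b.1.1 b.1.2 := by
        have h1 : ∫⁻ x in cell L k m, ENNReal.ofReal |F x - cc k m| * g x ∂μ ≤
            ENNReal.ofReal (aa k m) * ∫⁻ x in E, g x ∂μ + ∑' b : S, (Y b.1.1 b.1.2 + ENNReal.ofReal (aa k m) * ∫⁻ x in cell L b.1.1 b.1.2, g x ∂μ) := by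
          rw [hsplit]
          apply add_le_add
          · rw [← lintegral_const_mul _ hg]
            apply setLIntegral_mono (by fun_prop)
            intro x hx
            gcongr
            exact hSo x hx.1 hx.2
          · apply ENNReal.tsum_le_tsum
            intro b
            have hcl := const_close hL (hosc4 b.1.1 b.1.2) (hS4 b)
            simp only [hY]
            rw [add_assoc, ← add_mul, ← ENNReal.ofReal_add (ha0 _ _) (ha0 _ _), ← lintegral_const_mul _ hg, ← lintegral_add_left (by fun_prop)]
            apply lintegral_mono
            intro x
            dsimp only
            rw [← add_mul, ← ENNReal.ofReal_add (abs_nonneg _) (add_nonneg (ha0 _ _) (ha0 _ _))]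
            gcongr
            have := abs_sub_le (F x) (cc b.1.1 b.1.2) (cc k m)
            linarith
        calc Y k m ≤ (ENNReal.ofReal (aa k m) * ∫⁻ x in E, g x ∂μ + ∑' b : S, (Y b.1.1 b.1.2 + ENNReal.ofReal (aa k m) * ∫⁻ x in cell L b.1.1 b.1.2, g x ∂μ)) + ENNReal.ofReal (aa k m) * ∫⁻ x in cell L k m, g x ∂μ := by
              simp only [hY]; gcongr
          _ = _ := by
              rw [ENNReal.tsum_add, ENNReal.tsum_mul_left, hsplit g]
              ring
      calc Y k m ≤ 2 * (B * ∫⁻ x in E, H x * MM μ g x ∂μ) + ∑' b : S, (2 * B * ∫⁻ x in cell L b.1.1 b.1.2, H x * MM μ g x ∂μ + K * θ ^ n * μ (cell L b.1.1 b.1.2)) := by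
            refine hYle.trans ?_
            gcongr with b
            exact ih _ _
        _ = 2 * B * ∫⁻ x in cell L k m, H x * MM μ g x ∂μ + K * θ ^ n * μ U := by
            rw [ENNReal.tsum_add, ENNReal.tsum_mul_left, ENNReal.tsum_mul_left, hU, measure_iUnion hSd (fun b => cell_meas _ _ _), hsplit (fun x => H x * MM μ g x)]
            ring
        _ ≤ 2 * B * ∫⁻ x in cell L k m, H x * MM μ g x ∂μ + K * θ ^ n * (θ * μ (cell L k m)) := by gcongr
        _ = _ := by ring
  have hθ1 : θ < 1 := ENNReal.sub_lt_self (by simp) (by simp) (by simpa using hBt)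
  have hlim : Tendsto (fun n : ℕ => 2 * B * ∫⁻ x in cell L k m, H x * MM μ g x ∂μ + K * θ ^ n * μ (cell L k m)) atTop
      (𝓝 (2 * B * ∫⁻ x in cell L k m, H x * MM μ g x ∂μ + K * 0 * μ (cell L k m))) := by
    refine Tendsto.add tendsto_const_nhds ?_
    refine ENNReal.Tendsto.mul_const ?_ (Or.inr (hμc k m))
    exact ENNReal.Tendsto.const_mul (ENNReal.tendsto_pow_atTop_nhds_zero_of_lt_one hθ1) (Or.inr hKt)
  rw [mul_zero, zero_mul, add_zero] at hlim
  exact ge_of_tendsto' hlim fun n => step n k m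


/-- regularised inverse distance -/
def qq (ε : ℝ) (x : E3) : ℝ := (√(‖x‖ ^ 2 + ε ^ 2))⁻¹
/-- Kronecker delta -/
def kd (i j : Fin 3) : ℝ := if i = j then 1 else 0
/-- first derivatives of `qq` -/
def NN (ε : ℝ) (j : Fin 3) (x : E3) : ℝ := -(x j) * qq ε x ^ 3
/-- second derivatives of `qq` -/
def KK (ε : ℝ) (i j : Fin 3) (x : E3) : ℝ := 3 * x i * x j * qq ε x ^ 5 - kd i j * qq ε x ^ 3
/-- third derivatives of `qq` -/
def TT (ε : ℝ) (i j k : Fin 3) (x : E3) : ℝ :=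
  -15 * x i * x j * x k * qq ε x ^ 7 + 3 * (kd i j * x k + kd i k * x j + kd j k * x i) * qq ε x ^ 5
/-- regularised delta -/
def ph (ε : ℝ) (x : E3) : ℝ := ε ^ 2 * qq ε x ^ 5

lemma qq_pos {ε : ℝ} (hε : 0 < ε) (x : E3) : 0 < qq ε x := by unfold qq; positivity

lemma qq_sq {ε : ℝ} (hε : 0 < ε) (x : E3) : qq ε x ^ 2 * (‖x‖ ^ 2 + ε ^ 2) = 1 := by
  unfold qq
  rw [inv_pow, Real.sq_sqrt (by positivity)]
  field_simp

lemma norm_qq {ε : ℝ} (hε : 0 < ε) (x : E3) : ‖x‖ * qq ε x ≤ 1 := by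
  have h := qq_sq hε x
  have := qq_pos hε x
  have : (‖x‖ * qq ε x) ^ 2 ≤ 1 ^ 2 := by nlinarith [sq_nonneg (qq ε x * ε)]
  exact le_of_sq_le_sq this (by norm_num) 

lemma eps_qq {ε : ℝ} (hε : 0 < ε) (x : E3) : ε * qq ε x ≤ 1 := by
  have h := qq_sq hε x
  have := qq_pos hε x
  have : (ε * qq ε x) ^ 2 ≤ 1 ^ 2 := by nlinarith [sq_nonneg (qq ε x * ‖x‖)]
  exact le_of_sq_le_sq this (by norm_num)

lemma coord_qq {ε : ℝ} (hε : 0 < ε) (x : E3) (i : Fin 3) : |x i| * qq ε x ≤ 1 := by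
  have h1 : |x i| ≤ ‖x‖ := by simpa using PiLp.norm_apply_le x i
  have := qq_pos hε x
  have := norm_qq hε x
  nlinarith

lemma qq_le {ε : ℝ} (hε : 0 < ε) (x : E3) : qq ε x ≤ ε⁻¹ := by
  have := eps_qq hε x
  rw [← one_div, le_div_iff₀ hε]; linarith

lemma qq_contDiff {ε : ℝ} (hε : 0 < ε) : ContDiff ℝ (⊤ : ℕ∞) (qq ε) := by
  unfold qq
  have h0 : ContDiff ℝ (⊤ : ℕ∞) (fun x : E3 => ‖x‖ ^ 2 + ε ^ 2) := (contDiff_norm_sq ℝ).add contDiff_const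
  refine ContDiff.inv (h0.sqrt ?_) ?_
  · intro x; positivity
  · intro x; positivity

lemma qq_hasFDerivAt {ε : ℝ} (hε : 0 < ε) (x : E3) : HasFDerivAt (qq ε) (-(qq ε x ^ 3) • innerSL ℝ x) x := by
  have h0 : HasFDerivAt (fun x : E3 => ‖x‖ ^ 2 + ε ^ 2) (2 • innerSL ℝ x) x :=
    (hasStrictFDerivAt_norm_sq x).hasFDerivAt.add_const _
  have h1 := h0.sqrt (by positivity)
  have h2 := (hasDerivAt_inv (x := √(‖x‖ ^ 2 + ε ^ 2)) (by positivity)).comp_hasFDerivAt x h1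
  refine h2.congr_fderiv ?_
  ext v
  have hs : 0 < √(‖x‖ ^ 2 + ε ^ 2) := by positivity
  simp only [qq, _root_.smul_apply, smul_eq_mul, nsmul_eq_mul]
  field_simp
  push_cast
  ring

lemma coord_hasFDerivAt (x : E3) (i : Fin 3) : HasFDerivAt (fun x : E3 => x i) (EuclideanSpace.proj i : E3 →L[ℝ] ℝ) x :=
  (EuclideanSpace.proj i : E3 →L[ℝ] ℝ).hasFDerivAt

lemma coord_contDiff (i : Fin 3) : ContDiff ℝ (⊤ : ℕ∞) (fun x : E3 => x i) :=
  (EuclideanSpace.proj i : E3 →L[ℝ] ℝ).contDiff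

lemma NN_contDiff {ε : ℝ} (hε : 0 < ε) (j : Fin 3) : ContDiff ℝ (⊤ : ℕ∞) (NN ε j) := by
  unfold NN
  exact (coord_contDiff j).neg.mul ((qq_contDiff hε).pow 3)

lemma KK_contDiff {ε : ℝ} (hε : 0 < ε) (i j : Fin 3) : ContDiff ℝ (⊤ : ℕ∞) (KK ε i j) := by
  unfold KK
  exact (((contDiff_const.mul (coord_contDiff i)).mul (coord_contDiff j)).mul ((qq_contDiff hε).pow 5)).sub
    (contDiff_const.mul ((qq_contDiff hε).pow 3))

lemma NN_fderiv {ε : ℝ} (hε : 0 < ε) (j : Fin 3) (x v : E3) :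
    fderiv ℝ (NN ε j) x v = -(v j) * qq ε x ^ 3 + 3 * x j * qq ε x ^ 5 * inner ℝ x v := by
  have h := (coord_hasFDerivAt x j).neg.mul ((qq_hasFDerivAt hε x).pow 3)
  have h' : HasFDerivAt (NN ε j) _ x := h
  rw [h'.fderiv]
  simp
  ring

lemma KK_fderiv {ε : ℝ} (hε : 0 < ε) (i j : Fin 3) (x v : E3) :
    fderiv ℝ (KK ε i j) x v = 3 * v i * x j * qq ε x ^ 5 + 3 * x i * v j * qq ε x ^ 5
      - 15 * x i * x j * qq ε x ^ 7 * inner ℝ x v + 3 * kd i j * qq ε x ^ 5 * inner ℝ x v := by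
  have h := ((((coord_hasFDerivAt x i).const_mul 3).mul (coord_hasFDerivAt x j)).mul
    ((qq_hasFDerivAt hε x).pow 5)).sub (((qq_hasFDerivAt hε x).pow 3).const_mul (kd i j))
  have h' : HasFDerivAt (KK ε i j) _ x := h
  rw [h'.fderiv]
  simp
  ring

lemma NN_ee {ε : ℝ} (hε : 0 < ε) (i j : Fin 3) (x : E3) : fderiv ℝ (NN ε j) x (ee i) = KK ε i j x := by
  rw [NN_fderiv hε, KK]
  have : (ee i) j = kd i j := by simp [ee, kd, eq_comm]
  rw [this]
  simp [ee, EuclideanSpace.inner_single_right]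
  ring

lemma KK_ee {ε : ℝ} (hε : 0 < ε) (i j k : Fin 3) (x : E3) : fderiv ℝ (KK ε i j) x (ee k) = TT ε i j k x := by
  rw [KK_fderiv hε, TT]
  have h1 : (ee k) i = kd i k := by simp [ee, kd]
  have h2 : (ee k) j = kd j k := by simp [ee, kd]
  rw [h1, h2]
  simp [ee, EuclideanSpace.inner_single_right]
  ring

lemma NN_bd {ε : ℝ} (hε : 0 < ε) (j : Fin 3) (x : E3) : |NN ε j x| ≤ qq ε x ^ 2 := by
  have h1 := coord_qq hε x j
  have h2 := qq_pos hε x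
  unfold NN
  rw [abs_mul, abs_neg, abs_of_pos (by positivity : 0 < qq ε x ^ 3)]
  calc |x j| * qq ε x ^ 3 = (|x j| * qq ε x) * qq ε x ^ 2 := by ring
    _ ≤ 1 * qq ε x ^ 2 := by gcongr
    _ = _ := one_mul _

lemma kd_abs (i j : Fin 3) : |kd i j| ≤ 1 := by unfold kd; split_ifs <;> simp

lemma KK_bd {ε : ℝ} (hε : 0 < ε) (i j : Fin 3) (x : E3) : |KK ε i j x| ≤ 4 * qq ε x ^ 3 := by
  have h1 := coord_qq hε x i
  have h1' := coord_qq hε x j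
  have h2 := qq_pos hε x
  unfold KK
  refine (abs_sub _ _).trans ?_
  rw [abs_mul, abs_mul, abs_mul, abs_mul, abs_of_pos (by positivity : 0 < qq ε x ^ 3), abs_of_pos (by positivity : 0 < qq ε x ^ 5)]
  have h3 := kd_abs i j
  have e : |(3:ℝ)| = 3 := by norm_num
  rw [e]
  calc 3 * |x i| * |x j| * qq ε x ^ 5 + |kd i j| * qq ε x ^ 3 = 3 * (|x i| * qq ε x) * (|x j| * qq ε x) * qq ε x ^ 3 + |kd i j| * qq ε x ^ 3 := by ring
    _ ≤ 3 * 1 * 1 * qq ε x ^ 3 + 1 * qq ε x ^ 3 := by gcongr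
    _ = _ := by ring

lemma NN_dbd {ε : ℝ} (hε : 0 < ε) (j : Fin 3) (x : E3) : ‖fderiv ℝ (NN ε j) x‖ ≤ 4 * qq ε x ^ 3 := by
  have h2 := qq_pos hε x
  refine ContinuousLinearMap.opNorm_le_bound _ (by positivity) fun v => ?_
  rw [NN_fderiv hε, Real.norm_eq_abs]
  have hv : |v j| ≤ ‖v‖ := by simpa using PiLp.norm_apply_le v j
  have hi : |inner ℝ x v| ≤ ‖x‖ * ‖v‖ := abs_real_inner_le_norm x v
  have h1 := coord_qq hε x j
  have h3 := norm_qq hε x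
  refine (abs_add_le _ _).trans ?_
  simp only [abs_mul, abs_neg, abs_pow, abs_of_pos h2, Nat.abs_ofNat]
  calc |v j| * qq ε x ^ 3 + 3 * |x j| * qq ε x ^ 5 * |inner ℝ x v|
      ≤ ‖v‖ * qq ε x ^ 3 + 3 * |x j| * qq ε x ^ 5 * (‖x‖ * ‖v‖) := by gcongr
    _ = ‖v‖ * qq ε x ^ 3 + 3 * (|x j| * qq ε x) * qq ε x ^ 3 * ((‖x‖ * qq ε x) * ‖v‖) := by ring
    _ ≤ ‖v‖ * qq ε x ^ 3 + 3 * 1 * qq ε x ^ 3 * (1 * ‖v‖) := by gcongr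
    _ = _ := by ring

lemma KK_dbd {ε : ℝ} (hε : 0 < ε) (i j : Fin 3) (x : E3) : ‖fderiv ℝ (KK ε i j) x‖ ≤ 24 * qq ε x ^ 4 := by
  have h2 := qq_pos hε x
  refine ContinuousLinearMap.opNorm_le_bound _ (by positivity) fun v => ?_
  rw [KK_fderiv hε, Real.norm_eq_abs]
  have hv : ∀ j, |v j| ≤ ‖v‖ := fun j => by simpa using PiLp.norm_apply_le v j
  have hi : |inner ℝ x v| ≤ ‖x‖ * ‖v‖ := abs_real_inner_le_norm x v
  have h1 := coord_qq hε x
  have h3 := norm_qq hε x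
  have h4 := kd_abs i j
  refine (abs_add_le _ _).trans ((add_le_add_left ((abs_sub _ _).trans (add_le_add_left (abs_add_le _ _) _)) _).trans ?_)
  simp only [abs_mul, abs_pow, abs_of_pos h2, Nat.abs_ofNat]
  calc 3 * |v i| * |x j| * qq ε x ^ 5 + 3 * |x i| * |v j| * qq ε x ^ 5 + 15 * |x i| * |x j| * qq ε x ^ 7 * |inner ℝ x v| + 3 * |kd i j| * qq ε x ^ 5 * |inner ℝ x v|
      ≤ 3 * ‖v‖ * |x j| * qq ε x ^ 5 + 3 * |x i| * ‖v‖ * qq ε x ^ 5 + 15 * |x i| * |x j| * qq ε x ^ 7 * (‖x‖ * ‖v‖) + 3 * 1 * qq ε x ^ 5 * (‖x‖ * ‖v‖) := by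
        gcongr <;> exact hv _
    _ = 3 * ‖v‖ * (|x j| * qq ε x) * qq ε x ^ 4 + 3 * (|x i| * qq ε x) * ‖v‖ * qq ε x ^ 4 + 15 * (|x i| * qq ε x) * (|x j| * qq ε x) * qq ε x ^ 4 * ((‖x‖ * qq ε x) * ‖v‖) + 3 * 1 * qq ε x ^ 4 * ((‖x‖ * qq ε x) * ‖v‖) := by ring
    _ ≤ 3 * ‖v‖ * 1 * qq ε x ^ 4 + 3 * 1 * ‖v‖ * qq ε x ^ 4 + 15 * 1 * 1 * qq ε x ^ 4 * (1 * ‖v‖) + 3 * 1 * qq ε x ^ 4 * (1 * ‖v‖) := by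
        gcongr <;> exact h1 _
    _ = _ := by ring

lemma KK_trace {ε : ℝ} (hε : 0 < ε) (x : E3) : ∑ i, KK ε i i x = -3 * ph ε x := by
  have h := qq_sq hε x
  have hn : ‖x‖ ^ 2 = ∑ i, x i ^ 2 := by rw [EuclideanSpace.norm_sq_eq]; simp
  rw [hn, Fin.sum_univ_three] at h
  simp only [KK, ph, kd, Fin.sum_univ_three, if_true]
  linear_combination (-3 * qq ε x ^ 3) * (-h)

/-- smoothness estimate for the kernel -/
lemma KK_smooth {ε : ℝ} (hε : 0 < ε) (i j : Fin 3) {x y c : E3} (h : 2 * ‖y - c‖ ≤ ‖x - c‖) (h0 : 0 < ‖x - c‖) :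
    |KK ε i j (x - y) - KK ε i j (x - c)| ≤ 384 * ‖y - c‖ / ‖x - c‖ ^ 4 := by
  have hseg : ∀ z ∈ segment ℝ (x - c) (x - y), ‖x - c‖ / 2 ≤ ‖z‖ := by
    intro z hz
    have h1 : ‖z - (x - c)‖ ≤ ‖(x - y) - (x - c)‖ := by
      have := norm_sub_le_of_mem_segment hz
      simpa [norm_sub_rev] using this
    rw [show (x - y) - (x - c) = c - y by abel, norm_sub_rev c y] at h1
    have h2 := norm_sub_norm_le (x - c) z
    rw [norm_sub_rev (x - c) z] at h2
    linarith
  have hb : ∀ z ∈ segment ℝ (x - c) (x - y), ‖fderiv ℝ (KK ε i j) z‖ ≤ 384 / ‖x - c‖ ^ 4 := by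
    intro z hz
    refine (KK_dbd hε i j z).trans ?_
    have h1 := hseg z hz
    have h2 := norm_qq hε z
    have h3 := qq_pos hε z
    have h4 : ‖x - c‖ * qq ε z ≤ 2 := by nlinarith
    have h5 : (‖x - c‖ * qq ε z) ^ 4 ≤ 2 ^ 4 := by gcongr
    rw [le_div_iff₀ (by positivity)]
    nlinarith
  have := Convex.norm_image_sub_le_of_norm_fderiv_le (𝕜 := ℝ) (f := KK ε i j)
    (fun z _ => ((KK_contDiff hε i j).differentiable (by simp)).differentiableAt) hb (convex_segment _ _) (left_mem_segment ℝ _ _) (right_mem_segment ℝ _ _)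
  rw [show (x - y) - (x - c) = c - y by abel, norm_sub_rev c y, Real.norm_eq_abs] at this
  refine this.trans (le_of_eq ?_)
  ring


/-- convolution -/
def cv (k g : E3 → ℝ) (x : E3) : ℝ := ∫ y, k (x - y) * g y

lemma int_dec {f : E3 → ℝ} (hf : AEStronglyMeasurable f volume) {C : ℝ} {n : ℕ} (hn : 4 ≤ n)
    (h : ∀ x, |f x| ≤ C * ((1 + ‖x‖) ^ n)⁻¹) : Integrable f := by
  have h1 : Integrable (fun x : E3 => (1 + ‖x‖) ^ (-(n:ℝ))) volume := by
    apply integrable_one_add_norm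
    simp
    exact_mod_cast (by omega : 3 < n)
  refine (h1.const_mul C).mono' hf (ae_of_all _ fun x => ?_)
  rw [Real.rpow_neg (by positivity), Real.rpow_natCast]
  exact h x

lemma one_add_qq {ε : ℝ} (hε : 0 < ε) {R : ℝ} {x y : E3} (hy : ‖y‖ ≤ R) :
    qq ε (x - y) ≤ ((1 + R) / ε + 1) * (1 + ‖x‖)⁻¹ := by
  have h1 := eps_qq hε (x - y)
  have h2 := norm_qq hε (x - y)
  have h3 := qq_pos hε (x - y)
  have h4 : ‖x‖ ≤ ‖x - y‖ + ‖y‖ := by simpa using norm_add_le (x - y) y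
  have hR : 0 ≤ R := (norm_nonneg _).trans hy
  rw [← div_eq_mul_inv, le_div_iff₀ (by positivity)]
  have h5 : (1 + R) * qq ε (x - y) ≤ (1 + R) / ε := by
    rw [le_div_iff₀ hε]; nlinarith
  nlinarith

/-- bounded measurable functions with bounded support -/
structure Gd (g : E3 → ℝ) (G R : ℝ) : Prop where
  meas : Measurable g
  bd : ∀ x, |g x| ≤ G
  sup : ∀ x, R < ‖x‖ → g x = 0

lemma Gd.int {g : E3 → ℝ} {G R : ℝ} (h : Gd g G R) : Integrable g := by
  have h1 : IntegrableOn g (closedBall 0 R) :=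
    Measure.integrableOn_of_bounded (M := G) measure_closedBall_lt_top.ne h.meas.aestronglyMeasurable
      (ae_of_all _ h.bd)
  refine (integrableOn_iff_integrable_of_support_subset ?_).1 h1
  intro x hx
  by_contra hn
  apply hx
  apply h.sup
  simpa using hn

lemma cv_int {k : E3 → ℝ} (hk : Continuous k) {A : ℝ} (hA : ∀ x, |k x| ≤ A) {g : E3 → ℝ} (hg : Integrable g) (x : E3) :
    Integrable (fun y => k (x - y) * g y) := by
  refine hg.bdd_mul (c := A) ?_ (ae_of_all _ fun y => hA _)
  exact (hk.comp (by fun_prop)).aestronglyMeasurable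

lemma cv_dec {ε : ℝ} (hε : 0 < ε) {g : E3 → ℝ} {G R : ℝ} (hg : Gd g G R) (hR : 0 ≤ R) {k : E3 → ℝ} {A : ℝ} {n : ℕ}
    (hA : ∀ x, |k x| ≤ A * qq ε x ^ n) (x : E3) :
    |cv k g x| ≤ A * ((1 + R) / ε + 1) ^ n * (∫ y, |g y|) * ((1 + ‖x‖) ^ n)⁻¹ := by
  have hA0 : 0 ≤ A := by
    have h1 := (abs_nonneg _).trans (hA 0)
    have := qq_pos hε 0
    exact nonneg_of_mul_nonneg_left h1 (by positivity)
  have h : ∀ y, ‖k (x - y) * g y‖ ≤ A * (((1 + R) / ε + 1) * (1 + ‖x‖)⁻¹) ^ n * |g y| := by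
    intro y
    rw [norm_mul, Real.norm_eq_abs, Real.norm_eq_abs]
    by_cases hy : ‖y‖ ≤ R
    · have h1 := one_add_qq hε (x := x) hy
      have h2 := qq_pos hε (x - y)
      gcongr
      refine (hA _).trans ?_
      gcongr
    · rw [hg.sup y (not_le.1 hy)]; simp
  calc |cv k g x| ≤ ∫ y, A * (((1 + R) / ε + 1) * (1 + ‖x‖)⁻¹) ^ n * |g y| :=
        norm_integral_le_of_norm_le (hg.int.abs.const_mul _) (ae_of_all _ h)
    _ = _ := by rw [integral_const_mul, mul_pow, inv_pow]; ring

lemma cv_hasFDerivAt {k : E3 → ℝ} (hk : ContDiff ℝ (⊤ : ℕ∞) k) {A B : ℝ} (hA : ∀ x, |k x| ≤ A)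
    (hB : ∀ x, ‖fderiv ℝ k x‖ ≤ B) {g : E3 → ℝ} (hg : Integrable g) (x : E3) :
    HasFDerivAt (cv k g) (∫ y, g y • fderiv ℝ k (x - y)) x := by
  have hd : Continuous (fderiv ℝ k) := hk.continuous_fderiv (by simp)
  have hkc := hk.continuous
  refine hasFDerivAt_integral_of_dominated_of_fderiv_le (F := fun x y => k (x - y) * g y)
    (F' := fun x y => g y • fderiv ℝ k (x - y)) (bound := fun y => B * |g y|) (s := Set.univ) Filter.univ_mem ?_ ?_ ?_ ?_ ?_ ?_
  · exact Eventually.of_forall fun x => (cv_int hkc hA hg x).aestronglyMeasurable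
  · exact cv_int hkc hA hg x
  · exact hg.aestronglyMeasurable.smul (hd.comp (by fun_prop)).aestronglyMeasurable
  · refine ae_of_all _ fun y x _ => ?_
    rw [norm_smul, mul_comm, Real.norm_eq_abs]
    gcongr
    exact hB _
  · exact hg.abs.const_mul B
  · refine ae_of_all _ fun y x _ => ?_
    have h1 : HasFDerivAt (fun x => k (x - y)) (fderiv ℝ k (x - y)) x := by
      have := ((hk.differentiable (by simp)) (x - y)).hasFDerivAt.comp x ((hasFDerivAt_id x).sub_const y)
      rw [ContinuousLinearMap.comp_id] at this
      exact this
    exact h1.mul_const (g y)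

lemma cv_fderiv {k : E3 → ℝ} (hk : ContDiff ℝ (⊤ : ℕ∞) k) {A B : ℝ} (hA : ∀ x, |k x| ≤ A)
    (hB : ∀ x, ‖fderiv ℝ k x‖ ≤ B) {g : E3 → ℝ} (hg : Integrable g) (x v : E3) :
    fderiv ℝ (cv k g) x v = cv (fun z => fderiv ℝ k z v) g x := by
  rw [(cv_hasFDerivAt hk hA hB hg x).fderiv]
  have hd : Continuous (fderiv ℝ k) := hk.continuous_fderiv (by simp)
  rw [ContinuousLinearMap.integral_apply]
  · unfold cv
    congr 1; ext y
    simp [mul_comm]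
  · refine (hg.abs.const_mul B).mono' (hg.aestronglyMeasurable.smul (hd.comp (by fun_prop)).aestronglyMeasurable) (ae_of_all _ fun y => ?_)
    rw [norm_smul, mul_comm, Real.norm_eq_abs]
    gcongr
    exact hB _

lemma qpow_le {ε : ℝ} (hε : 0 < ε) (n : ℕ) (x : E3) : qq ε x ^ n ≤ ε⁻¹ ^ n := by
  have := qq_pos hε x
  gcongr
  exact qq_le hε x

lemma ee_norm (k : Fin 3) : ‖ee k‖ = 1 := by simp [ee]

lemma TT_bd {ε : ℝ} (hε : 0 < ε) (i j k : Fin 3) (x : E3) : |TT ε i j k x| ≤ 24 * qq ε x ^ 4 := by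
  rw [← KK_ee hε]
  have := (fderiv ℝ (KK ε i j) x).le_opNorm (ee k)
  rw [ee_norm, mul_one] at this
  exact this.trans (KK_dbd hε i j x)

lemma kd_comm (i j : Fin 3) : kd i j = kd j i := by unfold kd; simp [eq_comm]

lemma TT_perm1 (ε : ℝ) (i j k : Fin 3) (x : E3) : TT ε i j k x = TT ε i k j x := by
  unfold TT; rw [kd_comm j k]; ring

lemma TT_perm2 (ε : ℝ) (i j k : Fin 3) (x : E3) : TT ε i j k x = TT ε j i k x := by
  unfold TT; rw [kd_comm i j]; ring


lemma NN_cvd {ε : ℝ} (hε : 0 < ε) {g : E3 → ℝ} (hg : Integrable g) (i j : Fin 3) (x : E3) :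
    fderiv ℝ (cv (NN ε j) g) x (ee i) = cv (KK ε i j) g x := by
  rw [cv_fderiv (A := ε⁻¹ ^ 2) (B := 4 * ε⁻¹ ^ 3) (NN_contDiff hε j) _ _ hg]
  · congr 1; ext z; exact NN_ee hε i j z
  · exact fun x => (NN_bd hε j x).trans (qpow_le hε 2 x)
  · exact fun x => (NN_dbd hε j x).trans (mul_le_mul_of_nonneg_left (qpow_le hε 3 x) (by norm_num))

lemma KK_bdd {ε : ℝ} (hε : 0 < ε) (i j : Fin 3) (x : E3) : |KK ε i j x| ≤ 4 * ε⁻¹ ^ 3 :=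
  (KK_bd hε i j x).trans (mul_le_mul_of_nonneg_left (qpow_le hε 3 x) (by norm_num))

lemma KK_dbdd {ε : ℝ} (hε : 0 < ε) (i j : Fin 3) (x : E3) : ‖fderiv ℝ (KK ε i j) x‖ ≤ 24 * ε⁻¹ ^ 4 :=
  (KK_dbd hε i j x).trans (mul_le_mul_of_nonneg_left (qpow_le hε 4 x) (by norm_num))

lemma KK_cvd {ε : ℝ} (hε : 0 < ε) {g : E3 → ℝ} (hg : Integrable g) (i j k : Fin 3) (x : E3) :
    fderiv ℝ (cv (KK ε i j) g) x (ee k) = cv (TT ε i j k) g x := by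
  rw [cv_fderiv (KK_contDiff hε i j) (KK_bdd hε i j) (KK_dbdd hε i j) hg]
  congr 1; ext z; exact KK_ee hε i j k z

lemma NN_cvdiff {ε : ℝ} (hε : 0 < ε) {g : E3 → ℝ} (hg : Integrable g) (j : Fin 3) :
    Differentiable ℝ (cv (NN ε j) g) := fun x =>
  (cv_hasFDerivAt (A := ε⁻¹ ^ 2) (B := 4 * ε⁻¹ ^ 3) (NN_contDiff hε j)
    (fun x => (NN_bd hε j x).trans (qpow_le hε 2 x))
    (fun x => (NN_dbd hε j x).trans (mul_le_mul_of_nonneg_left (qpow_le hε 3 x) (by norm_num))) hg x).differentiableAt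

lemma KK_cvdiff {ε : ℝ} (hε : 0 < ε) {g : E3 → ℝ} (hg : Integrable g) (i j : Fin 3) :
    Differentiable ℝ (cv (KK ε i j) g) := fun x =>
  (cv_hasFDerivAt (KK_contDiff hε i j) (KK_bdd hε i j) (KK_dbdd hε i j) hg x).differentiableAt

lemma dec_mul {f1 f2 : E3 → ℝ} (h1 : AEStronglyMeasurable f1 volume) (h2 : AEStronglyMeasurable f2 volume)
    {C1 C2 : ℝ} {n1 n2 : ℕ} (hn : 4 ≤ n1 + n2) (hb1 : ∀ x, |f1 x| ≤ C1 * ((1 + ‖x‖) ^ n1)⁻¹)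
    (hb2 : ∀ x, |f2 x| ≤ C2 * ((1 + ‖x‖) ^ n2)⁻¹) : Integrable (fun x => f1 x * f2 x) := by
  refine int_dec (C := C1 * C2) (h1.mul h2) hn fun x => ?_
  rw [abs_mul]
  calc |f1 x| * |f2 x| ≤ (C1 * ((1 + ‖x‖) ^ n1)⁻¹) * (C2 * ((1 + ‖x‖) ^ n2)⁻¹) :=
        mul_le_mul (hb1 x) (hb2 x) (abs_nonneg _) ((abs_nonneg _).trans (hb1 x))
    _ = _ := by rw [pow_add, mul_inv]; ring

lemma KK_swap {ε : ℝ} (hε : 0 < ε) {g : E3 → ℝ} {G R : ℝ} (hg : Gd g G R) (hR : 0 ≤ R) (i j a b : Fin 3) :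
    ∫ x, cv (KK ε i j) g x * cv (KK ε a b) g x = - ∫ x, cv (TT ε i j a) g x * cv (NN ε b) g x := by
  have hT : AEStronglyMeasurable (cv (TT ε i j a) g) volume := by
    have : cv (TT ε i j a) g = fun x => fderiv ℝ (cv (KK ε i j) g) x (ee a) := by
      ext x; rw [KK_cvd hε hg.int]
    rw [this]
    exact (measurable_fderiv_apply_const ℝ _ _).aestronglyMeasurable
  have hN := (NN_cvdiff hε hg.int b).continuous.aestronglyMeasurable (μ := volume)
  have hK : ∀ i j, AEStronglyMeasurable (cv (KK ε i j) g) volume := fun i j =>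
    (KK_cvdiff hε hg.int i j).continuous.aestronglyMeasurable
  have dN := cv_dec hε hg hR (A := 1) (n := 2) (k := NN ε b) (by simpa using NN_bd hε b)
  have dK := fun i j => cv_dec hε hg hR (KK_bd hε i j)
  have dT := cv_dec hε hg hR (TT_bd hε i j a)
  have := integral_mul_fderiv_eq_neg_fderiv_mul_of_integrable (μ := volume) (𝕜 := ℝ)
    (f := cv (KK ε i j) g) (g := cv (NN ε b) g) (v := ee a) ?_ ?_ ?_ (fun x _ => KK_cvdiff hε hg.int i j x) (fun x _ => NN_cvdiff hε hg.int b x)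
  · simp only [KK_cvd hε hg.int, NN_cvd hε hg.int] at this
    exact this
  · simp only [KK_cvd hε hg.int]
    exact dec_mul hT hN (by norm_num) dT dN
  · simp only [NN_cvd hε hg.int]
    exact dec_mul (hK _ _) (hK _ _) (by norm_num) (dK _ _) (dK _ _)
  · exact dec_mul (hK _ _) hN (by norm_num) (dK _ _) dN

lemma KK_sq {ε : ℝ} (hε : 0 < ε) {g : E3 → ℝ} {G R : ℝ} (hg : Gd g G R) (hR : 0 ≤ R) (i j : Fin 3) :
    ∫ x, cv (KK ε i j) g x * cv (KK ε i j) g x = ∫ x, cv (KK ε i i) g x * cv (KK ε j j) g x := by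
  rw [KK_swap hε hg hR, KK_swap hε hg hR]
  congr 3; ext x
  have : TT ε i j i = TT ε i i j := by ext z; exact TT_perm1 ε i j i z
  rw [this]

lemma KK_mulint {ε : ℝ} (hε : 0 < ε) {g : E3 → ℝ} {G R : ℝ} (hg : Gd g G R) (hR : 0 ≤ R) (i j a b : Fin 3) :
    Integrable (fun x => cv (KK ε i j) g x * cv (KK ε a b) g x) :=
  dec_mul ((KK_cvdiff hε hg.int i j).continuous.aestronglyMeasurable) ((KK_cvdiff hε hg.int a b).continuous.aestronglyMeasurable)
    (by norm_num) (cv_dec hε hg hR (KK_bd hε i j)) (cv_dec hε hg hR (KK_bd hε a b))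

lemma ph_cont {ε : ℝ} (hε : 0 < ε) : Continuous (ph ε) := by
  unfold ph
  have := (qq_contDiff hε).continuous
  fun_prop

lemma ph_nonneg (ε : ℝ) (x : E3) : 0 ≤ ph ε x := by
  unfold ph qq; positivity

lemma trace_cv {ε : ℝ} (hε : 0 < ε) {g : E3 → ℝ} (hg : Integrable g) (x : E3) :
    ∑ i, cv (KK ε i i) g x = -3 * cv (ph ε) g x := by
  unfold cv
  rw [← integral_finsetSum _ (fun i _ => cv_int (KK_contDiff hε i i).continuous (KK_bdd hε i i) hg x), ← integral_const_mul]
  congr 1; ext y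
  rw [← Finset.sum_mul, KK_trace hε]; ring

lemma KK_sum {ε : ℝ} (hε : 0 < ε) {g : E3 → ℝ} {G R : ℝ} (hg : Gd g G R) (hR : 0 ≤ R) (i j : Fin 3) :
    ∫ x, cv (KK ε i j) g x ^ 2 ≤ ∫ x, 9 * cv (ph ε) g x ^ 2 := by
  have h1 : ∫ x, 9 * cv (ph ε) g x ^ 2 = ∑ i, ∑ j, ∫ x, cv (KK ε i j) g x * cv (KK ε i j) g x := by
    simp only [KK_sq hε hg hR]
    simp only [← integral_finsetSum _ (fun j _ => KK_mulint hε hg hR _ _ j j)]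
    rw [← integral_finsetSum _ (fun i _ => integrable_finsetSum _ (fun j _ => KK_mulint hε hg hR _ _ j j))]
    congr 1; ext x
    simp only [← Finset.mul_sum, ← Finset.sum_mul, trace_cv hε hg.int]
    ring
  have hn : ∀ i j, 0 ≤ ∫ x, cv (KK ε i j) g x * cv (KK ε i j) g x := fun i j =>
    integral_nonneg fun x => mul_self_nonneg _
  rw [h1]
  simp only [pow_two]
  exact (Finset.single_le_sum (f := fun j => ∫ x, cv (KK ε i j) g x * cv (KK ε i j) g x) (fun j _ => hn i j) (Finset.mem_univ j)).trans
    (Finset.single_le_sum (f := fun i => ∑ j, ∫ x, cv (KK ε i j) g x * cv (KK ε i j) g x) (fun i _ => Finset.sum_nonneg fun j _ => hn i j) (Finset.mem_univ i))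


/-- mass of `ph` -/
def II : ℝ := ∫ x, ph 1 x
/-- first moment of `ph` -/
def JJ : ℝ := ∫ x, ‖x‖ * ph 1 x

lemma ph_dec (x : E3) : |ph 1 x| ≤ 32 * ((1 + ‖x‖) ^ 5)⁻¹ := by
  have h1 := one_add_qq one_pos (x := x) (y := 0) (R := 0) (by simp)
  have := qq_pos one_pos x
  rw [abs_of_nonneg (ph_nonneg 1 x), ph, one_pow, one_mul]
  rw [sub_zero] at h1
  calc qq 1 x ^ 5 ≤ (((1 + 0) / 1 + 1) * (1 + ‖x‖)⁻¹) ^ 5 := by gcongr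
    _ = _ := by rw [mul_pow, inv_pow]; norm_num

lemma ph1_int : Integrable (ph 1) :=
  int_dec (ph_cont one_pos).aestronglyMeasurable (by norm_num) ph_dec

lemma ph1_mint : Integrable (fun x => ‖x‖ * ph 1 x) := by
  have := ph_cont one_pos
  refine int_dec (C := 32) (n := 4) (by fun_prop) (by norm_num) fun x => ?_
  rw [abs_mul, abs_norm]
  calc ‖x‖ * |ph 1 x| ≤ (1 + ‖x‖) * (32 * ((1 + ‖x‖) ^ 5)⁻¹) := by
        gcongr
        · linarith
        · exact ph_dec x
    _ = _ := by field_simp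

lemma ph_scale {ε : ℝ} (hε : 0 < ε) (x : E3) : ph ε x = (ε ^ 3)⁻¹ * ph 1 (ε⁻¹ • x) := by
  have h : qq ε x = ε⁻¹ * qq 1 (ε⁻¹ • x) := by
    unfold qq
    rw [← mul_inv]
    congr 1
    rw [norm_smul, mul_pow, Real.norm_eq_abs, abs_of_pos (inv_pos.2 hε)]
    have : ‖x‖ ^ 2 + ε ^ 2 = ε ^ 2 * (ε⁻¹ ^ 2 * ‖x‖ ^ 2 + 1 ^ 2) := by field_simp
    rw [this, Real.sqrt_mul (by positivity), Real.sqrt_sq hε.le]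
  unfold ph
  rw [h]
  field_simp

lemma ph_int {ε : ℝ} (hε : 0 < ε) : Integrable (ph ε) := by
  have : ph ε = fun x => (ε ^ 3)⁻¹ * ph 1 (ε⁻¹ • x) := by ext x; exact ph_scale hε x
  rw [this]
  exact (ph1_int.comp_smul (inv_ne_zero hε.ne')).const_mul _

lemma ph_mint {ε : ℝ} (hε : 0 < ε) : Integrable (fun x => ‖x‖ * ph ε x) := by
  have : (fun x => ‖x‖ * ph ε x) = fun x => (ε ^ 3)⁻¹ * ε * (‖ε⁻¹ • x‖ * ph 1 (ε⁻¹ • x)) := by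
    ext x; rw [ph_scale hε, norm_smul, Real.norm_eq_abs, abs_of_pos (inv_pos.2 hε)]; field_simp
  rw [this]
  exact (ph1_mint.comp_smul (inv_ne_zero hε.ne')).const_mul _

lemma ph_integral {ε : ℝ} (hε : 0 < ε) : ∫ x, ph ε x = II := by
  have : ph ε = fun x => (ε ^ 3)⁻¹ * ph 1 (ε⁻¹ • x) := by ext x; exact ph_scale hε x
  rw [this, integral_const_mul, Measure.integral_comp_inv_smul]
  simp only [finrank_euclideanSpace, Fintype.card_fin, smul_eq_mul, abs_of_pos (by positivity : 0 < ε ^ 3)]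
  rw [II]; field_simp

lemma ph_mintegral {ε : ℝ} (hε : 0 < ε) : ∫ x, ‖x‖ * ph ε x = ε * JJ := by
  have : (fun x => ‖x‖ * ph ε x) = fun x => (ε ^ 3)⁻¹ * ε * (‖ε⁻¹ • x‖ * ph 1 (ε⁻¹ • x)) := by
    ext x; rw [ph_scale hε, norm_smul, Real.norm_eq_abs, abs_of_pos (inv_pos.2 hε)]; field_simp
  rw [this, integral_const_mul, Measure.integral_comp_inv_smul volume (fun x => ‖x‖ * ph 1 x)]
  simp only [finrank_euclideanSpace, Fintype.card_fin, smul_eq_mul, abs_of_pos (by positivity : 0 < ε ^ 3)]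
  rw [JJ]; field_simp

lemma II_pos : 0 < II := by
  unfold II
  refine (integral_pos_iff_support_of_nonneg (ph_nonneg 1) ph1_int).2 ?_
  have : Function.support (ph 1) = Set.univ := by
    ext x; simp [ph, (qq_pos one_pos x).ne']
  rw [this]; simp

lemma JJ_nonneg : 0 ≤ JJ := integral_nonneg fun x => mul_nonneg (norm_nonneg _) (ph_nonneg 1 x)

lemma ph_lint {ε : ℝ} (hε : 0 < ε) : ∫⁻ x, ENNReal.ofReal (ph ε x) = ENNReal.ofReal II := by
  rw [← ph_integral hε, ofReal_integral_eq_lintegral_ofReal (ph_int hε) (ae_of_all _ (ph_nonneg ε))]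

lemma cv_ph_bd {ε : ℝ} (hε : 0 < ε) {g : E3 → ℝ} {G R : ℝ} (hg : Gd g G R) (x : E3) : |cv (ph ε) g x| ≤ II * G := by
  have h : Integrable (fun y => ph ε (x - y)) := (ph_int hε).comp_sub_left x
  calc |cv (ph ε) g x| ≤ ∫ y, ph ε (x - y) * G := by
        refine norm_integral_le_of_norm_le (f := fun y => ph ε (x - y) * g y) (h.mul_const _) (ae_of_all _ fun y => ?_)
        rw [norm_mul, Real.norm_eq_abs, Real.norm_eq_abs, abs_of_nonneg (ph_nonneg _ _)]
        have := ph_nonneg ε (x - y)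
        gcongr
        exact hg.bd y
    _ = II * G := by rw [integral_mul_const, integral_sub_left_eq_self (ph ε), ph_integral hε]

lemma cv_ph_L1 {ε : ℝ} (hε : 0 < ε) {g : E3 → ℝ} {G R : ℝ} (hg : Gd g G R) :
    ∫⁻ x, ENNReal.ofReal |cv (ph ε) g x| ≤ ENNReal.ofReal II * ∫⁻ y, ENNReal.ofReal |g y| := by
  have hgm := hg.meas
  have hpm := (ph_cont hε).measurable
  calc ∫⁻ x, ENNReal.ofReal |cv (ph ε) g x| ≤ ∫⁻ x, ∫⁻ y, ENNReal.ofReal (ph ε (x - y)) * ENNReal.ofReal |g y| := by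
        apply lintegral_mono
        intro x
        dsimp only
        rw [← Real.norm_eq_abs, ofReal_norm]
        refine (enorm_integral_le_lintegral_enorm (fun y => ph ε (x - y) * g y)).trans (le_of_eq ?_)
        congr 1; ext y
        rw [enorm_mul, Real.enorm_of_nonneg (ph_nonneg _ _), ← ofReal_norm (g y), Real.norm_eq_abs]
    _ = ∫⁻ y, ∫⁻ x, ENNReal.ofReal (ph ε (x - y)) * ENNReal.ofReal |g y| := by
        apply lintegral_lintegral_swap
        fun_prop
    _ = ∫⁻ y, ENNReal.ofReal II * ENNReal.ofReal |g y| := by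
        congr 1; ext y
        rw [lintegral_mul_const _ (by fun_prop), lintegral_sub_right_eq_self (fun x => ENNReal.ofReal (ph ε x)), ph_lint hε]
    _ = _ := by rw [lintegral_const_mul _ (by fun_prop)]

/-- the L2 estimate -/
lemma KK_L2 {ε : ℝ} (hε : 0 < ε) {g : E3 → ℝ} {G R : ℝ} (hg : Gd g G R) (hR : 0 ≤ R) (i j : Fin 3) :
    ∫⁻ x, ENNReal.ofReal (cv (KK ε i j) g x ^ 2) ≤
      ENNReal.ofReal (9 * II ^ 2 * G) * ∫⁻ y, ENNReal.ofReal |g y| := by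
  have hII := II_pos
  have hG : 0 ≤ G := (abs_nonneg _).trans (hg.bd 0)
  have h1 := KK_sum hε hg hR i j
  have hi1 : Integrable (fun x => cv (KK ε i j) g x ^ 2) := by
    simpa [pow_two] using KK_mulint hε hg hR i j i j
  rw [← ofReal_integral_eq_lintegral_ofReal hi1 (ae_of_all _ fun x => sq_nonneg _)]
  have hi2 : Integrable (fun x => 9 * cv (ph ε) g x ^ 2) := by
    have e : (fun x => 9 * cv (ph ε) g x ^ 2) = fun x => (∑ i, cv (KK ε i i) g x) * ∑ i, cv (KK ε i i) g x := by
      ext x; rw [trace_cv hε hg.int]; ring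
    rw [e]
    simp only [Finset.sum_mul, Finset.mul_sum]
    exact integrable_finsetSum _ fun i _ => integrable_finsetSum _ fun j _ => KK_mulint hε hg hR _ _ _ _
  refine (ENNReal.ofReal_le_ofReal h1).trans ?_
  rw [ofReal_integral_eq_lintegral_ofReal hi2 (ae_of_all _ fun x => by positivity)]
  calc ∫⁻ x, ENNReal.ofReal (9 * cv (ph ε) g x ^ 2)
      ≤ ∫⁻ x, ENNReal.ofReal (9 * II * G) * ENNReal.ofReal |cv (ph ε) g x| := by
        apply lintegral_mono
        intro x
        dsimp only
        rw [← ENNReal.ofReal_mul (by positivity)]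
        apply ENNReal.ofReal_le_ofReal
        have := cv_ph_bd hε hg x
        rw [← sq_abs]
        nlinarith [abs_nonneg (cv (ph ε) g x)]
    _ = ENNReal.ofReal (9 * II * G) * ∫⁻ x, ENNReal.ofReal |cv (ph ε) g x| := by
        rw [lintegral_const_mul' _ _ (by simp)]
    _ ≤ ENNReal.ofReal (9 * II * G) * (ENNReal.ofReal II * ∫⁻ y, ENNReal.ofReal |g y|) := by
        gcongr
        exact cv_ph_L1 hε hg
    _ = _ := by
        rw [← mul_assoc, ← ENNReal.ofReal_mul (by positivity)]
        congr 2; ring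


/-- tail constant -/
def CF : ℝ≥0∞ := 16 * volume (ball (0 : E3) 1)

lemma CF_fin : CF ≠ ∞ := ENNReal.mul_ne_top (by simp) v0_fin

lemma far {c z : E3} {R : ℝ} (hz : z ∈ ball c R) (f : E3 → ℝ≥0∞) :
    ∫⁻ y in (ball c R)ᶜ, ENNReal.ofReal (R / ‖y - c‖ ^ 4) * f y ≤ CF * MM volume f z := by
  have hR : 0 < R := Metric.pos_of_mem_ball hz
  let A : ℕ → Set E3 := fun n => ball c (2 ^ (n+1) * R) \ ball c (2 ^ n * R)
  have hcov : (ball c R)ᶜ ⊆ ⋃ n, A n := by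
    intro y hy
    rw [Set.mem_compl_iff, Metric.mem_ball, not_lt] at hy
    have hex : ∃ n : ℕ, dist y c < 2 ^ n * R := by
      obtain ⟨n, hn⟩ := pow_unbounded_of_one_lt (dist y c / R) (by norm_num : (1:ℝ) < 2)
      exact ⟨n, by rwa [div_lt_iff₀ hR] at hn⟩
    classical
    have h1 := Nat.find_spec hex
    have h0 : Nat.find hex ≠ 0 := by
      intro h; rw [h] at h1; simp at h1; linarith
    obtain ⟨n, hn⟩ := Nat.exists_eq_succ_of_ne_zero h0
    have h2 := Nat.find_min hex (m := n) (by omega)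
    rw [hn] at h1
    exact Set.mem_iUnion.2 ⟨n, h1, h2⟩
  have hterm : ∀ n : ℕ, ∫⁻ y in A n, ENNReal.ofReal (R / ‖y - c‖ ^ 4) * f y ≤
      8 * volume (ball (0 : E3) 1) * MM volume f z * (2⁻¹ : ℝ≥0∞) ^ n := by
    intro n
    have hr : 0 < 2 ^ (n+1) * R := by positivity
    have hzn : z ∈ ball c (2 ^ (n+1) * R) := by
      refine Metric.ball_subset_ball ?_ hz
      have : (1:ℝ) ≤ 2 ^ (n+1) := one_le_pow₀ (by norm_num)
      nlinarith
    have h2 := le_MM volume f hzn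
    rw [ENNReal.div_le_iff (Metric.measure_ball_pos _ _ hr).ne' measure_ball_lt_top.ne, vol_ball c hr] at h2
    calc ∫⁻ y in A n, ENNReal.ofReal (R / ‖y - c‖ ^ 4) * f y
        ≤ ∫⁻ y in A n, ENNReal.ofReal (R / (2 ^ n * R) ^ 4) * f y := by
          apply setLIntegral_mono' (measurableSet_ball.diff measurableSet_ball)
          intro y hy
          gcongr
          have := hy.2
          rw [Metric.mem_ball, not_lt, dist_eq_norm] at this
          exact this
      _ = ENNReal.ofReal (R / (2 ^ n * R) ^ 4) * ∫⁻ y in A n, f y := lintegral_const_mul' _ _ (by simp)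
      _ ≤ ENNReal.ofReal (R / (2 ^ n * R) ^ 4) * (MM volume f z * (ENNReal.ofReal ((2 ^ (n+1) * R) ^ 3) * volume (ball (0 : E3) 1))) := by
          gcongr
          exact (lintegral_mono_set Set.sdiff_subset).trans h2
      _ = (ENNReal.ofReal (R / (2 ^ n * R) ^ 4) * ENNReal.ofReal ((2 ^ (n+1) * R) ^ 3)) * (volume (ball (0 : E3) 1) * MM volume f z) := by ring
      _ = (8 * 2⁻¹ ^ n) * (volume (ball (0 : E3) 1) * MM volume f z) := by
          congr 1
          rw [← ENNReal.ofReal_mul (by positivity)]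
          have : R / (2 ^ n * R) ^ 4 * (2 ^ (n + 1) * R) ^ 3 = 8 * (2⁻¹) ^ n := by
            rw [inv_pow]; field_simp; ring
          rw [this, ENNReal.ofReal_mul (by norm_num), ENNReal.ofReal_pow (by norm_num), ENNReal.ofReal_inv_of_pos (by norm_num)]
          norm_num
      _ = _ := by ring
  calc _ ≤ ∫⁻ y in ⋃ n, A n, ENNReal.ofReal (R / ‖y - c‖ ^ 4) * f y := lintegral_mono_set hcov
    _ ≤ ∑' n, ∫⁻ y in A n, ENNReal.ofReal (R / ‖y - c‖ ^ 4) * f y := lintegral_iUnion_le _ _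
    _ ≤ ∑' n, 8 * volume (ball (0 : E3) 1) * MM volume f z * (2⁻¹ : ℝ≥0∞) ^ n := ENNReal.tsum_le_tsum hterm
    _ = CF * MM volume f z := by
        rw [ENNReal.tsum_mul_left, ENNReal.tsum_geometric, ENNReal.one_sub_inv_two, inv_inv, CF]
        ring

lemma MM_one (z : E3) : MM volume (fun _ => 1) z ≤ 1 := by
  refine iSup_le fun c => iSup_le fun r => iSup_le fun h => ?_
  rw [setLIntegral_const, one_mul]
  exact ENNReal.div_self_le_one

lemma far_one (c : E3) {R : ℝ} (hR : 0 < R) :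
    ∫⁻ y in (ball c R)ᶜ, ENNReal.ofReal (R / ‖y - c‖ ^ 4) ≤ CF := by
  have := far (Metric.mem_ball_self hR : c ∈ ball c R) (fun _ => 1)
  simp only [mul_one] at this
  refine this.trans ?_
  calc _ ≤ CF * 1 := by gcongr; exact MM_one c
    _ = _ := mul_one _

lemma cz {f : E3 → ℝ} (hf : Continuous f) {R : ℝ} (hR : 0 ≤ R) (hsup : ∀ x, R < ‖x‖ → f x = 0)
    (hfi : Integrable f) {α : ℝ} (hα : 0 < α) :
    ∃ (L : ℝ) (S : Set (ℕ × (Fin 3 → ℤ))) (g : E3 → ℝ) (R' : ℝ), 0 < L ∧ 0 ≤ R' ∧ R ≤ R' ∧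
      Pairwise (Function.onFun Disjoint fun b : S => cell L b.1.1 b.1.2) ∧
      Gd g (64 * α) R' ∧
      (∀ x, x ∉ (⋃ b : S, cell L b.1.1 b.1.2) → g x = f x) ∧
      (∀ b : S, ∫ x in cell L b.1.1 b.1.2, (f x - g x) = 0) ∧
      (∀ b : S, ENNReal.ofReal α * volume (cell L b.1.1 b.1.2) ≤ ∫⁻ x in cell L b.1.1 b.1.2, ENNReal.ofReal |f x|) ∧
      (∀ b : S, ∫⁻ x in cell L b.1.1 b.1.2, ENNReal.ofReal |g x| ≤ ∫⁻ x in cell L b.1.1 b.1.2, ENNReal.ofReal |f x|) := by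
  classical
  set v := (volume (ball (0 : E3) 1)).toReal with hv
  have hv0 : 0 < v := ENNReal.toReal_pos v0_pos v0_fin
  set I := ∫ x, |f x| with hI
  have hI0 : 0 ≤ I := integral_nonneg fun x => abs_nonneg _
  have hIl : ∫⁻ x, ENNReal.ofReal |f x| = ENNReal.ofReal I := by
    rw [hI, ofReal_integral_eq_lintegral_ofReal hfi.abs (ae_of_all _ fun x => abs_nonneg _)]
  set L := 2 * (1 + I / (v * α)) with hLdef
  have hL : 0 < L := by positivity
  have htop : ∀ m, ∫⁻ x in cell L 0 m, ENNReal.ofReal |f x| ≤ ENNReal.ofReal α * volume (cell L 0 m) := by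
    intro m
    refine (setLIntegral_le_lintegral _ _).trans ?_
    have h1 := measure_mono (μ := volume) (ball_sub_cell hL 0 m)
    have hs : sd L 0 / 2 = 1 + I / (v * α) := by simp [sd, hLdef]
    have hpos : 0 < 1 + I / (v * α) := by positivity
    rw [hs, vol_ball _ hpos] at h1
    calc ∫⁻ x, ENNReal.ofReal |f x| = ENNReal.ofReal I := hIl
      _ ≤ ENNReal.ofReal α * (ENNReal.ofReal ((1 + I / (v * α)) ^ 3) * volume (ball (0 : E3) 1)) := by
          rw [← ENNReal.ofReal_toReal v0_fin, ← hv, ← ENNReal.ofReal_mul (by positivity), ← ENNReal.ofReal_mul hα.le]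
          apply ENNReal.ofReal_le_ofReal
          have h3 : I / (v * α) ≤ (1 + I / (v * α)) ^ 3 := by
            have h0 : 0 ≤ I / (v * α) := by positivity
            nlinarith [pow_pos hpos 2, mul_nonneg h0 h0, mul_nonneg (mul_nonneg h0 h0) h0]
          rw [div_le_iff₀ (by positivity)] at h3
          linarith
      _ ≤ _ := by gcongr
  let P : ℕ → (Fin 3 → ℤ) → Prop := fun k m => ENNReal.ofReal α * volume (cell L k m) < ∫⁻ x in cell L k m, ENNReal.ofReal |f x|
  set S := stp L P with hS
  have hPS : ∀ b : S, ENNReal.ofReal α * volume (cell L b.1.1 b.1.2) ≤ ∫⁻ x in cell L b.1.1 b.1.2, ENNReal.ofReal |f x| := fun b => b.2.1.le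
  have hup : ∀ b : S, ∫⁻ x in cell L b.1.1 b.1.2, ENNReal.ofReal |f x| ≤ ENNReal.ofReal (64 * α) * volume (cell L b.1.1 b.1.2) := by
    rintro ⟨⟨k, m⟩, hb⟩
    dsimp only
    cases k with
    | zero => exact absurd hb.1 (not_lt.2 (htop m))
    | succ k =>
      have h1 : ¬ P k (par m) := stp_par hL hb
      have h2 := not_lt.1 h1
      calc _ ≤ _ := lintegral_mono_set (cell_sub_par k m)
        _ ≤ _ := h2
        _ ≤ ENNReal.ofReal α * (64 * volume (cell L (k+1) m)) := by gcongr; exact par_le hL k m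
        _ = _ := by rw [ENNReal.ofReal_mul (by norm_num)]; norm_num; ring
  let av : S → ℝ := fun b => (volume.real (cell L b.1.1 b.1.2))⁻¹ * ∫ x in cell L b.1.1 b.1.2, f x
  have hvr : ∀ b : S, 0 < volume.real (cell L b.1.1 b.1.2) := fun b =>
    ENNReal.toReal_pos (cell_vol_pos hL _ _) (cell_vol_fin hL _ _)
  have hav : ∀ b : S, ENNReal.ofReal |av b| * volume (cell L b.1.1 b.1.2) ≤ ∫⁻ x in cell L b.1.1 b.1.2, ENNReal.ofReal |f x| := by
    intro b
    have h1 : |av b| * volume.real (cell L b.1.1 b.1.2) = |∫ x in cell L b.1.1 b.1.2, f x| := by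
      simp only [av]
      rw [abs_mul, abs_of_pos (inv_pos.2 (hvr b))]
      have := (hvr b).ne'
      field_simp
    rw [← ENNReal.ofReal_toReal (cell_vol_fin hL b.1.1 b.1.2), ← ENNReal.ofReal_mul (abs_nonneg _)]
    change ENNReal.ofReal (|av b| * volume.real (cell L b.1.1 b.1.2)) ≤ _
    rw [h1, ← Real.norm_eq_abs, ofReal_norm]
    refine (enorm_integral_le_lintegral_enorm _).trans (le_of_eq ?_)
    congr 1; ext x; rw [← ofReal_norm, Real.norm_eq_abs]
  have hav2 : ∀ b : S, |av b| ≤ 64 * α := by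
    intro b
    have h1 := (hav b).trans (hup b)
    rw [ENNReal.mul_le_mul_iff_left (cell_vol_pos hL _ _) (cell_vol_fin hL _ _)] at h1
    exact (ENNReal.ofReal_le_ofReal_iff (by positivity)).1 h1
  let g : E3 → ℝ := fun x => if h : ∃ b : S, x ∈ cell L b.1.1 b.1.2 then av h.choose else f x
  have hgS : ∀ (b : S) x, x ∈ cell L b.1.1 b.1.2 → g x = av b := by
    intro b x hx
    have h : ∃ b : S, x ∈ cell L b.1.1 b.1.2 := ⟨b, hx⟩
    simp only [g, dif_pos h]
    congr 1
    exact Subtype.ext (stp_eq h.choose.2 b.2 h.choose_spec hx)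
  have hgU : ∀ x, x ∉ (⋃ b : S, cell L b.1.1 b.1.2) → g x = f x := by
    intro x hx
    have h : ¬ ∃ b : S, x ∈ cell L b.1.1 b.1.2 := by rwa [Set.mem_iUnion] at hx
    simp only [g, dif_neg h]
  have hUm : MeasurableSet (⋃ b : S, cell L b.1.1 b.1.2) := MeasurableSet.iUnion fun b => cell_meas _ _ _
  have hgm : Measurable g := by
    intro s hs
    have : g ⁻¹' s = ((⋃ b : S, cell L b.1.1 b.1.2)ᶜ ∩ f ⁻¹' s) ∪ ⋃ b : S, (cell L b.1.1 b.1.2 ∩ {_x | av b ∈ s}) := by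
      ext x
      by_cases hx : x ∈ (⋃ b : S, cell L b.1.1 b.1.2)
      · obtain ⟨b, hb⟩ := Set.mem_iUnion.1 hx
        simp only [Set.mem_preimage, hgS b x hb, Set.mem_union, Set.mem_inter_iff, Set.mem_compl_iff, hx, not_true, false_and, false_or, Set.mem_iUnion, Set.mem_ofPred_eq]
        constructor
        · exact fun h => ⟨b, hb, h⟩
        · rintro ⟨b', hb', h⟩
          rwa [Subtype.ext (stp_eq b.2 b'.2 hb hb')]
      · simp only [Set.mem_preimage, hgU x hx, Set.mem_union, Set.mem_inter_iff, Set.mem_compl_iff, hx, not_false_eq_true, true_and]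
        constructor
        · exact fun h => Or.inl h
        · rintro (h | h)
          · exact h
          · obtain ⟨b, hb⟩ := Set.mem_iUnion.1 h
            exact absurd (Set.mem_iUnion.2 ⟨b, hb.1⟩) hx
    rw [this]
    refine (hUm.compl.inter (hf.measurable hs)).union (MeasurableSet.iUnion fun b => (cell_meas _ _ _).inter (MeasurableSet.const _))
  refine ⟨L, S, g, R + 2 * L, hL, by positivity, by linarith, stp_disj L P, ⟨hgm, ?_, ?_⟩, hgU, ?_, hPS, ?_⟩
  · intro x
    by_cases hx : x ∈ (⋃ b : S, cell L b.1.1 b.1.2)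
    · obtain ⟨b, hb⟩ := Set.mem_iUnion.1 hx
      rw [hgS b x hb]; exact hav2 b
    · rw [hgU x hx]
      by_contra hlt
      push Not at hlt
      have hlt' : α < |f x| := by linarith
      have ho : IsOpen {y | α < |f y|} := isOpen_lt continuous_const (by fun_prop)
      obtain ⟨δ, hδ, hδs⟩ := Metric.isOpen_iff.1 ho x hlt'
      obtain ⟨k0, hk0⟩ := small_cell (L := L) x hδ hL
      apply hx
      rw [Set.mem_iUnion]
      apply stp_cover L P
      refine ⟨k0, ?_⟩
      show ENNReal.ofReal α * volume (cell L k0 _) < _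
      have hc := hk0 k0 le_rfl
      rw [← setLIntegral_const]
      refine setLIntegral_strict_mono (cell_meas _ _ _) (cell_vol_pos hL _ _) (by fun_prop) ?_ ?_
      · rw [setLIntegral_const]
        exact ENNReal.mul_ne_top (by simp) (cell_vol_fin hL _ _)
      · exact ae_of_all _ fun y hy => (ENNReal.ofReal_lt_ofReal_iff_of_nonneg hα.le).2 (hδs (hc hy))
  · intro x hx
    by_cases hxU : x ∈ (⋃ b : S, cell L b.1.1 b.1.2)
    · exfalso
      obtain ⟨b, hb⟩ := Set.mem_iUnion.1 hxU
      have hz : ∀ y ∈ cell L b.1.1 b.1.2, f y = 0 := by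
        intro y hy
        apply hsup
        have h1 := cell_sub_ball hL _ _ hy
        have h2 := cell_sub_ball hL _ _ hb
        have h3 := Metric.mem_ball.1 h1
        have h4 := Metric.mem_ball.1 h2
        have hsL : sd L b.1.1 ≤ L := by
          unfold sd; exact div_le_self hL.le (one_le_pow₀ (by norm_num))
        have h5 := dist_triangle_right x y (ctr L b.1.1 b.1.2)
        have h6 : ‖x‖ ≤ ‖y‖ + dist x y := by
          rw [dist_eq_norm]; simpa using norm_add_le y (x - y)
        linarith
      have h1 := b.2.1
      have h2 : ∫⁻ x in cell L b.1.1 b.1.2, ENNReal.ofReal |f x| = 0 := by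
        rw [setLIntegral_congr_fun (g := fun _ => 0) (cell_meas _ _ _) (fun y hy => by simp [hz y hy])]
        simp
      have h3 : ENNReal.ofReal α * volume (cell L b.1.1 b.1.2) < ∫⁻ x in cell L b.1.1 b.1.2, ENNReal.ofReal |f x| := h1
      rw [h2] at h3
      exact not_lt_bot h3
    · rw [hgU x hxU]; exact hsup x (by linarith)
  · intro b
    have h1 : ∫ x in cell L b.1.1 b.1.2, (f x - g x) = ∫ x in cell L b.1.1 b.1.2, (f x - av b) :=
      setIntegral_congr_fun (cell_meas _ _ _) fun x hx => by simp only [hgS b x hx]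
    rw [h1, integral_sub hfi.integrableOn (integrableOn_const (cell_vol_fin hL _ _)), setIntegral_const]
    have := (hvr b).ne'
    simp only [av, smul_eq_mul]
    field_simp
    ring
  · intro b
    have h1 : ∫⁻ x in cell L b.1.1 b.1.2, ENNReal.ofReal |g x| = ∫⁻ x in cell L b.1.1 b.1.2, ENNReal.ofReal |av b| :=
      setLIntegral_congr_fun (cell_meas _ _ _) fun x hx => by simp only [hgS b x hx]
    rw [h1, setLIntegral_const]
    exact hav b


lemma KK_cont {ε : ℝ} (hε : 0 < ε) (i j : Fin 3) : Continuous (KK ε i j) := (KK_contDiff hε i j).continuous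

lemma bad_cell {ε : ℝ} (hε : 0 < ε) (i j : Fin 3) {Q : Set E3} {c : E3} {s : ℝ} (hs : 0 < s)
    (hQm : MeasurableSet Q) (hQ : Q ⊆ ball c s) {b : E3 → ℝ} (hb : Integrable b) (h0 : ∫ y in Q, b y = 0)
    {x : E3} (hx : x ∈ (ball c (2 * s))ᶜ) :
    ENNReal.ofReal |∫ y in Q, KK ε i j (x - y) * b y| ≤
      192 * ENNReal.ofReal (2 * s / ‖x - c‖ ^ 4) * ∫⁻ y in Q, ENNReal.ofReal |b y| := by
  have hxc : 2 * s ≤ ‖x - c‖ := by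
    rw [Set.mem_compl_iff, Metric.mem_ball, not_lt, dist_eq_norm] at hx
    exact hx
  have hi := (cv_int (KK_cont hε i j) (KK_bdd hε i j) hb x).integrableOn (s := Q)
  have hi2 : IntegrableOn (fun y => KK ε i j (x - c) * b y) Q := (hb.const_mul _).integrableOn
  have e1 : ∫ y in Q, KK ε i j (x - y) * b y = ∫ y in Q, (KK ε i j (x - y) - KK ε i j (x - c)) * b y := by
    have : ∫ y in Q, KK ε i j (x - c) * b y = 0 := by rw [integral_const_mul, h0, mul_zero]
    rw [← sub_zero (∫ y in Q, KK ε i j (x - y) * b y), ← this, ← integral_sub hi hi2]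
    congr 1; ext y; ring
  rw [e1, ← lintegral_const_mul' _ _ (by finiteness), ← Real.norm_eq_abs, ofReal_norm]
  refine (enorm_integral_le_lintegral_enorm (μ := volume.restrict Q) (f := fun y => (KK ε i j (x - y) - KK ε i j (x - c)) * b y)).trans ?_
  refine setLIntegral_mono' hQm fun y hy => ?_
  have hy1 := hQ hy
  rw [Metric.mem_ball, dist_eq_norm] at hy1
  have h2 := KK_smooth hε i j (x := x) (y := y) (c := c) (by linarith) (by linarith)
  have h3 : (192 : ℝ≥0∞) = ENNReal.ofReal 192 := by simp
  rw [h3, ← ENNReal.ofReal_mul (by norm_num), ← ENNReal.ofReal_mul (by positivity), ← ofReal_norm, Real.norm_eq_abs, abs_mul]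
  apply ENNReal.ofReal_le_ofReal
  refine mul_le_mul_of_nonneg_right (h2.trans ?_) (abs_nonneg _)
  have : 192 * (2 * s / ‖x - c‖ ^ 4) = 384 * s / ‖x - c‖ ^ 4 := by ring
  rw [this]
  gcongr

/-- weak type constant -/
def Cw : ℝ≥0∞ := 64 + ENNReal.ofReal (2304 * II ^ 2) + 768 * CF

lemma Cw_fin : Cw ≠ ∞ := by
  unfold Cw
  have := CF_fin
  finiteness

lemma weak11 {ε : ℝ} (hε : 0 < ε) (i j : Fin 3) {f : E3 → ℝ} (hf : Continuous f) {R : ℝ} (hR : 0 ≤ R)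
    (hsup : ∀ x, R < ‖x‖ → f x = 0) (hfi : Integrable f) {α : ℝ} (hα : 0 < α) :
    ENNReal.ofReal α * volume {x | α < |cv (KK ε i j) f x|} ≤ Cw * ∫⁻ x, ENNReal.ofReal |f x| := by
  obtain ⟨L, S, g, R', hL, hR', hRR, hdis, hg, hoff, hcan, hbig, hgf⟩ := cz hf hR hsup hfi hα
  set Q : S → Set E3 := fun b => cell L b.1.1 b.1.2 with hQ
  have hQm : ∀ b, MeasurableSet (Q b) := fun b => cell_meas _ _ _
  set I := ∫⁻ x, ENNReal.ofReal |f x| with hI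
  set U : Set E3 := ⋃ b : S, Q b with hU
  set V : Set E3 := ⋃ b : S, ball (ctr L b.1.1 b.1.2) (2 * sd L b.1.1) with hV
  have hVm : MeasurableSet V := MeasurableSet.iUnion fun b => measurableSet_ball
  have hUm : MeasurableSet U := MeasurableSet.iUnion hQm
  have hsum : ∑' b : S, ∫⁻ x in Q b, ENNReal.ofReal |f x| ≤ I := by
    rw [← lintegral_iUnion hQm hdis]
    exact setLIntegral_le_lintegral _ _
  have hgi := hg.int
  set b := fun x => f x - g x with hb
  have hbi : Integrable b := hfi.sub hgi
  have hbz : ∀ x, x ∉ U → b x = 0 := by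
    intro x hx; simp only [hb, hoff x hx, sub_self]
  -- V
  have h1 : ENNReal.ofReal α * volume V ≤ 64 * I := by
    calc ENNReal.ofReal α * volume V ≤ ENNReal.ofReal α * ∑' b : S, 64 * volume (Q b) := by
          gcongr
          refine (measure_iUnion_le _).trans (ENNReal.tsum_le_tsum fun b => ?_)
          have := ball_le_cell hL b.1.1 b.1.2 (ctr L b.1.1 b.1.2) 4 (by norm_num)
          convert this using 2
          · push_cast; ring_nf
          · norm_num
      _ = 64 * ∑' b : S, ENNReal.ofReal α * volume (Q b) := by
          rw [ENNReal.tsum_mul_left, ENNReal.tsum_mul_left]; ring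
      _ ≤ 64 * I := by
          gcongr
          exact (ENNReal.tsum_le_tsum hbig).trans hsum
  -- good
  have hgI : ∫⁻ x, ENNReal.ofReal |g x| ≤ I := by
    rw [hI, ← lintegral_add_compl _ hUm, ← lintegral_add_compl (fun x => ENNReal.ofReal |f x|) hUm]
    apply add_le_add
    · rw [hU, lintegral_iUnion hQm hdis, lintegral_iUnion hQm hdis]
      exact ENNReal.tsum_le_tsum hgf
    · refine le_of_eq (setLIntegral_congr_fun hUm.compl fun x hx => ?_)
      simp only [hoff x hx]
  have hcvm : Continuous (cv (KK ε i j) g) := (KK_cvdiff hε hgi i j).continuous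
  have h2 : ENNReal.ofReal α * volume {x | α / 2 < |cv (KK ε i j) g x|} ≤ ENNReal.ofReal (2304 * II ^ 2) * I := by
    have h := mul_meas_ge_le_lintegral₀ (μ := volume) (f := fun x => ENNReal.ofReal (cv (KK ε i j) g x ^ 2))
      (by fun_prop) (ENNReal.ofReal ((α / 2) ^ 2))
    have h' := h.trans (KK_L2 hε hg hR' i j)
    calc ENNReal.ofReal α * volume {x | α / 2 < |cv (KK ε i j) g x|}
        ≤ ENNReal.ofReal (4 / α) * (ENNReal.ofReal ((α / 2) ^ 2) *
          volume {x | ENNReal.ofReal ((α / 2) ^ 2) ≤ ENNReal.ofReal (cv (KK ε i j) g x ^ 2)}) := by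
          rw [← mul_assoc, ← ENNReal.ofReal_mul (by positivity)]
          have : 4 / α * (α / 2) ^ 2 = α := by field_simp; ring
          rw [this]
          gcongr with x
          intro hx
          apply ENNReal.ofReal_le_ofReal
          rw [← sq_abs (cv _ _ _)]
          gcongr
      _ ≤ ENNReal.ofReal (4 / α) * (ENNReal.ofReal (9 * II ^ 2 * (64 * α)) * ∫⁻ y, ENNReal.ofReal |g y|) := by
          exact mul_le_mul_right h' _
      _ = ENNReal.ofReal (2304 * II ^ 2) * ∫⁻ y, ENNReal.ofReal |g y| := by
          rw [← mul_assoc, ← ENNReal.ofReal_mul (by positivity)]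
          congr 2; field_simp; ring
      _ ≤ _ := by gcongr
  -- bad
  have hbQ : ∀ q : S, ∫⁻ y in Q q, ENNReal.ofReal |b y| ≤ 2 * ∫⁻ y in Q q, ENNReal.ofReal |f y| := by
    intro q
    calc ∫⁻ y in Q q, ENNReal.ofReal |b y| ≤ ∫⁻ y in Q q, (ENNReal.ofReal |f y| + ENNReal.ofReal |g y|) := by
          apply lintegral_mono; intro y
          dsimp only
          rw [← ENNReal.ofReal_add (abs_nonneg _) (abs_nonneg _)]
          exact ENNReal.ofReal_le_ofReal (abs_sub _ _)
      _ = (∫⁻ y in Q q, ENNReal.ofReal |f y|) + ∫⁻ y in Q q, ENNReal.ofReal |g y| := by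
          rw [lintegral_add_left (by fun_prop)]
      _ ≤ _ := by rw [two_mul]; exact add_le_add le_rfl (hgf q)
  have hptw : ∀ x ∈ Vᶜ, ENNReal.ofReal |cv (KK ε i j) b x| ≤
      ∑' q : S, 192 * ENNReal.ofReal (2 * sd L q.1.1 / ‖x - ctr L q.1.1 q.1.2‖ ^ 4) * ∫⁻ y in Q q, ENNReal.ofReal |b y| := by
    intro x hx
    have hi := (cv_int (KK_cont hε i j) (KK_bdd hε i j) hbi x)
    have e1 : cv (KK ε i j) b x = ∑' q : S, ∫ y in Q q, KK ε i j (x - y) * b y := by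
      rw [← integral_iUnion hQm hdis hi.integrableOn]
      unfold cv
      rw [setIntegral_eq_integral_of_forall_compl_eq_zero]
      intro y hy; rw [hbz y hy, mul_zero]
    rw [e1, ← Real.norm_eq_abs, ofReal_norm]
    refine (enorm_tsum_le_tsum_enorm).trans (ENNReal.tsum_le_tsum fun q => ?_)
    rw [← ofReal_norm, Real.norm_eq_abs]
    refine bad_cell hε i j (sd_pos hL _) (hQm q) (cell_sub_ball hL _ _) hbi (hcan q) ?_
    intro h; exact hx (Set.mem_iUnion.2 ⟨q, h⟩)
  have hbad : ∫⁻ x in Vᶜ, ENNReal.ofReal |cv (KK ε i j) b x| ≤ 384 * CF * I := by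
    calc ∫⁻ x in Vᶜ, ENNReal.ofReal |cv (KK ε i j) b x|
        ≤ ∫⁻ x in Vᶜ, ∑' q : S, 192 * ENNReal.ofReal (2 * sd L q.1.1 / ‖x - ctr L q.1.1 q.1.2‖ ^ 4) * ∫⁻ y in Q q, ENNReal.ofReal |b y| :=
          setLIntegral_mono' hVm.compl hptw
      _ = ∑' q : S, ∫⁻ x in Vᶜ, 192 * ENNReal.ofReal (2 * sd L q.1.1 / ‖x - ctr L q.1.1 q.1.2‖ ^ 4) * ∫⁻ y in Q q, ENNReal.ofReal |b y| := by
          apply lintegral_tsum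
          intro q
          apply Measurable.aemeasurable
          fun_prop
      _ ≤ ∑' q : S, 192 * CF * (2 * ∫⁻ y in Q q, ENNReal.ofReal |f y|) := by
          apply ENNReal.tsum_le_tsum; intro q
          rw [lintegral_mul_const _ (by fun_prop), lintegral_const_mul _ (by fun_prop)]
          gcongr
          · refine (lintegral_mono_set ?_).trans (far_one (ctr L q.1.1 q.1.2) (by have := sd_pos hL q.1.1; positivity : 0 < 2 * sd L q.1.1))
            apply Set.compl_subset_compl.2
            exact Set.subset_iUnion (fun b : S => ball (ctr L b.1.1 b.1.2) (2 * sd L b.1.1)) q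
          · exact hbQ q
      _ ≤ 384 * CF * I := by
          rw [ENNReal.tsum_mul_left, ENNReal.tsum_mul_left]
          calc _ = 384 * CF * ∑' q : S, ∫⁻ y in Q q, ENNReal.ofReal |f y| := by
                have : (384 : ℝ≥0∞) = 192 * 2 := by norm_num
                rw [this]; ring
            _ ≤ _ := by gcongr
  have hcvb : Continuous (cv (KK ε i j) b) := (KK_cvdiff hε hbi i j).continuous
  have h3 : ENNReal.ofReal α * volume (Vᶜ ∩ {x | α / 2 < |cv (KK ε i j) b x|}) ≤ 768 * CF * I := by
    have h := mul_meas_ge_le_lintegral₀ (μ := volume.restrict Vᶜ) (f := fun x => ENNReal.ofReal |cv (KK ε i j) b x|)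
      (by fun_prop) (ENNReal.ofReal (α / 2))
    have h' := h.trans hbad
    have e : ENNReal.ofReal α = 2 * ENNReal.ofReal (α / 2) := by
      have : (2 : ℝ≥0∞) = ENNReal.ofReal 2 := by simp
      rw [this, ← ENNReal.ofReal_mul (by norm_num)]; congr 1; ring
    calc ENNReal.ofReal α * volume (Vᶜ ∩ {x | α / 2 < |cv (KK ε i j) b x|})
        ≤ 2 * (ENNReal.ofReal (α / 2) * volume.restrict Vᶜ {x | ENNReal.ofReal (α / 2) ≤ ENNReal.ofReal |cv (KK ε i j) b x|}) := by
          rw [e, mul_assoc]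
          rw [Measure.restrict_apply' hVm.compl]
          refine mul_le_mul_right (mul_le_mul_right (measure_mono ?_) _) _
          rintro x ⟨hx1, hx2⟩
          exact ⟨ENNReal.ofReal_le_ofReal (le_of_lt hx2), hx1⟩
      _ ≤ 2 * (384 * CF * I) := mul_le_mul_right h' _
      _ = _ := by
          have : (768 : ℝ≥0∞) = 2 * 384 := by norm_num
          rw [this]; ring
  have hsub : {x | α < |cv (KK ε i j) f x|} ⊆ V ∪ {x | α / 2 < |cv (KK ε i j) g x|} ∪ (Vᶜ ∩ {x | α / 2 < |cv (KK ε i j) b x|}) := by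
    intro x hx
    by_contra hn
    simp only [Set.mem_union, not_or, Set.mem_inter_iff, not_and, Set.mem_ofPred_eq, not_lt] at hn hx
    have ha := hn.2 hn.1.1
    have hb' := hn.1.2
    have e : cv (KK ε i j) f x = cv (KK ε i j) g x + cv (KK ε i j) b x := by
      unfold cv
      rw [← integral_add (cv_int (KK_cont hε i j) (KK_bdd hε i j) hgi x) (cv_int (KK_cont hε i j) (KK_bdd hε i j) hbi x)]
      congr 1; ext y; simp only [hb]; ring
    rw [e] at hx
    have := abs_add_le (cv (KK ε i j) g x) (cv (KK ε i j) b x)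
    linarith
  calc ENNReal.ofReal α * volume {x | α < |cv (KK ε i j) f x|}
      ≤ ENNReal.ofReal α * (volume V + volume {x | α / 2 < |cv (KK ε i j) g x|} + volume (Vᶜ ∩ {x | α / 2 < |cv (KK ε i j) b x|})) := by
        gcongr
        refine (measure_mono hsub).trans ((measure_union_le _ _).trans ?_)
        gcongr
        exact measure_union_le _ _
    _ ≤ 64 * I + ENNReal.ofReal (2304 * II ^ 2) * I + 768 * CF * I := by
        rw [mul_add, mul_add]; gcongr
    _ = Cw * I := by unfold Cw; ring


lemma KK_even (ε : ℝ) (i j : Fin 3) (x y : E3) : KK ε i j (x - y) = KK ε i j (y - x) := by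
  unfold KK qq
  rw [norm_sub_rev]
  simp only [PiLp.sub_apply]
  ring

/-- oscillation constant -/
def Co : ℝ := (192 * CF).toReal + (2048 * 512 * Cw.toReal + 1)

lemma Co_pos : 0 < Co := by unfold Co; positivity

lemma osc {ε : ℝ} (hε : 0 < ε) (i j : Fin 3) {f : E3 → ℝ} (hf : Continuous f) {R : ℝ} (hR : 0 ≤ R)
    (hsup : ∀ x, R < ‖x‖ → f x = 0) (hfi : Integrable f) {h : E3 → ℝ≥0∞} (hfh : ∀ x, ENNReal.ofReal |f x| ≤ h x)
    {c z : E3} {s : ℝ} (hz : z ∈ ball c s) {H : ℝ} (hH : 0 < H) (hzH : MM volume h z ≤ ENNReal.ofReal H) :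
    ∃ q : ℝ, 2048 * volume (ball c s ∩ {x | Co * H < |cv (KK ε i j) f x - q|}) ≤ volume (ball c (s / 2)) := by
  have hs : 0 < s := Metric.pos_of_mem_ball hz
  set η : E3 → ℝ := fun y => max 0 (min 1 (2 - ‖y - c‖ / (2 * s))) with hη
  have hηc : Continuous η := by
    simp only [hη]; fun_prop
  have hη0 : ∀ y, 0 ≤ η y := fun y => le_max_left _ _
  have hη1 : ∀ y, η y ≤ 1 := fun y => max_le zero_le_one (min_le_left _ _)
  have hηin : ∀ y ∈ ball c (2 * s), η y = 1 := by
    intro y hy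
    rw [Metric.mem_ball, dist_eq_norm] at hy
    have : ‖y - c‖ / (2 * s) ≤ 1 := by rw [div_le_one (by positivity)]; exact hy.le
    simp only [hη]
    rw [min_eq_left (by linarith), max_eq_right zero_le_one]
  have hηout : ∀ y, y ∉ ball c (4 * s) → η y = 0 := by
    intro y hy
    rw [Metric.mem_ball, dist_eq_norm, not_lt] at hy
    have : 2 ≤ ‖y - c‖ / (2 * s) := by rw [le_div_iff₀ (by positivity)]; linarith
    simp only [hη]
    rw [max_eq_left]
    exact (min_le_right _ _).trans (by linarith)
  set f1 := fun y => f y * η y with hf1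
  set f2 := fun y => f y * (1 - η y) with hf2
  have hb1 : ∀ y, |f1 y| ≤ |f y| := fun y => by
    simp only [hf1, abs_mul, abs_of_nonneg (hη0 y)]
    exact mul_le_of_le_one_right (abs_nonneg _) (hη1 y)
  have hb2 : ∀ y, |f2 y| ≤ |f y| := fun y => by
    simp only [hf2, abs_mul, abs_of_nonneg (sub_nonneg.2 (hη1 y))]
    exact mul_le_of_le_one_right (abs_nonneg _) (by linarith [hη0 y])
  have hc1 : Continuous f1 := by simp only [hf1]; fun_prop
  have hc2 : Continuous f2 := by simp only [hf2]; fun_prop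
  have hi1 : Integrable f1 := hfi.mono hc1.aestronglyMeasurable (ae_of_all _ hb1)
  have hi2 : Integrable f2 := hfi.mono hc2.aestronglyMeasurable (ae_of_all _ hb2)
  have hsplit : ∀ x, cv (KK ε i j) f x = cv (KK ε i j) f1 x + cv (KK ε i j) f2 x := by
    intro x
    unfold cv
    rw [← integral_add (cv_int (KK_cont hε i j) (KK_bdd hε i j) hi1 x) (cv_int (KK_cont hε i j) (KK_bdd hε i j) hi2 x)]
    congr 1; ext y; simp only [hf1, hf2]; ring
  -- far part
  have hfar : ∀ x ∈ ball c s, |cv (KK ε i j) f2 x - cv (KK ε i j) f2 c| ≤ (192 * CF).toReal * H := by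
    intro x hx
    rw [Metric.mem_ball, dist_eq_norm] at hx
    have key : ENNReal.ofReal |cv (KK ε i j) f2 x - cv (KK ε i j) f2 c| ≤ 192 * CF * ENNReal.ofReal H := by
      have e : cv (KK ε i j) f2 x - cv (KK ε i j) f2 c = ∫ y, (KK ε i j (x - y) - KK ε i j (c - y)) * f2 y := by
        unfold cv
        rw [← integral_sub (cv_int (KK_cont hε i j) (KK_bdd hε i j) hi2 x) (cv_int (KK_cont hε i j) (KK_bdd hε i j) hi2 c)]
        congr 1; ext y; ring
      rw [e, ← Real.norm_eq_abs, ofReal_norm]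
      refine (enorm_integral_le_lintegral_enorm (f := fun y => (KK ε i j (x - y) - KK ε i j (c - y)) * f2 y)).trans ?_
      have e2 : ∫⁻ y, ‖(KK ε i j (x - y) - KK ε i j (c - y)) * f2 y‖ₑ =
          ∫⁻ y in (ball c (2 * s))ᶜ, ‖(KK ε i j (x - y) - KK ε i j (c - y)) * f2 y‖ₑ := by
        symm
        apply setLIntegral_eq_of_support_subset
        intro y hy hy2
        apply hy
        simp only [hf2, hηin y hy2]; simp
      rw [e2]
      have hz2 : z ∈ ball c (2 * s) := Metric.ball_subset_ball (by linarith) hz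
      calc ∫⁻ y in (ball c (2 * s))ᶜ, ‖(KK ε i j (x - y) - KK ε i j (c - y)) * f2 y‖ₑ
          ≤ ∫⁻ y in (ball c (2 * s))ᶜ, 192 * (ENNReal.ofReal (2 * s / ‖y - c‖ ^ 4) * h y) := by
            refine setLIntegral_mono' measurableSet_ball.compl fun y hy => ?_
            rw [Set.mem_compl_iff, Metric.mem_ball, dist_eq_norm, not_lt] at hy
            rw [KK_even ε i j x, KK_even ε i j c, enorm_mul, ← mul_assoc]
            have h2 := KK_smooth hε i j (x := y) (y := x) (c := c) (by linarith) (by linarith)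
            have h3 : (192 : ℝ≥0∞) = ENNReal.ofReal 192 := by simp
            rw [h3, ← ENNReal.ofReal_mul (by norm_num), ← ofReal_norm, ← ofReal_norm, Real.norm_eq_abs, Real.norm_eq_abs]
            refine mul_le_mul' (ENNReal.ofReal_le_ofReal (h2.trans ?_)) ((ENNReal.ofReal_le_ofReal (hb2 y)).trans (hfh y))
            have : 192 * (2 * s / ‖y - c‖ ^ 4) = 384 * s / ‖y - c‖ ^ 4 := by ring
            rw [this]
            gcongr
        _ = 192 * ∫⁻ y in (ball c (2 * s))ᶜ, (ENNReal.ofReal (2 * s / ‖y - c‖ ^ 4) * h y) := by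
            rw [lintegral_const_mul' _ _ (by finiteness)]
        _ ≤ 192 * (CF * MM volume h z) := by gcongr; exact far hz2 h
        _ ≤ 192 * CF * ENNReal.ofReal H := by rw [mul_assoc]; gcongr
    have hfin : 192 * CF ≠ ∞ := ENNReal.mul_ne_top (by simp) CF_fin
    have e3 : 192 * CF * ENNReal.ofReal H = ENNReal.ofReal ((192 * CF).toReal * H) := by
      rw [ENNReal.ofReal_mul (by positivity), ENNReal.ofReal_toReal hfin]
    rw [e3] at key
    exact (ENNReal.ofReal_le_ofReal_iff (by positivity)).1 key
  set C1 : ℝ := 2048 * 512 * Cw.toReal + 1 with hC1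
  have hC1p : 0 < C1 := by positivity
  refine ⟨cv (KK ε i j) f2 c, ?_⟩
  have hw := weak11 hε i j hc1 hR (fun x hx => by simp only [hf1, hsup x hx, zero_mul]) hi1 (by positivity : 0 < C1 * H)
  have hsub : ball c s ∩ {x | Co * H < |cv (KK ε i j) f x - cv (KK ε i j) f2 c|} ⊆ {x | C1 * H < |cv (KK ε i j) f1 x|} := by
    rintro x ⟨hx1, hx2⟩
    rw [Set.mem_ofPred_eq] at hx2 ⊢
    have h1 := hfar x hx1
    rw [hsplit] at hx2
    have h2 : |cv (KK ε i j) f1 x + cv (KK ε i j) f2 x - cv (KK ε i j) f2 c| ≤ |cv (KK ε i j) f1 x| + |cv (KK ε i j) f2 x - cv (KK ε i j) f2 c| := by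
      rw [add_sub_assoc]; exact abs_add_le _ _
    have h3 : Co * H = (192 * CF).toReal * H + C1 * H := by unfold Co; ring
    linarith
  have hhint : ∫⁻ x, ENNReal.ofReal |f1 x| ≤ ENNReal.ofReal H * (512 * volume (ball c (s / 2))) := by
    have hz4 : z ∈ ball c (4 * s) := Metric.ball_subset_ball (by linarith) hz
    have hv : volume (ball c (4 * s)) = 512 * volume (ball c (s / 2)) := by
      have := vol_ball_mul c c (by positivity : 0 < s / 2) 8 (by norm_num)
      convert this using 2
      · push_cast; ring_nf
      · norm_num
    calc ∫⁻ x, ENNReal.ofReal |f1 x| = ∫⁻ x in ball c (4 * s), ENNReal.ofReal |f1 x| := by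
          symm
          apply setLIntegral_eq_of_support_subset
          intro y hy
          by_contra hy2
          apply hy
          simp only [hf1, hηout y hy2]; simp
      _ ≤ ∫⁻ x in ball c (4 * s), h x := lintegral_mono fun x => (ENNReal.ofReal_le_ofReal (hb1 x)).trans (hfh x)
      _ ≤ ENNReal.ofReal H * volume (ball c (4 * s)) := by
          have h4 := (le_MM volume h hz4).trans hzH
          rwa [ENNReal.div_le_iff (Metric.measure_ball_pos _ _ (by positivity)).ne' measure_ball_lt_top.ne] at h4
      _ = _ := by rw [hv]
  have hH0 : ENNReal.ofReal (C1 * H) ≠ 0 := by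
    rw [Ne, ENNReal.ofReal_eq_zero, not_le]; positivity
  have hfinal : ENNReal.ofReal (C1 * H) * (2048 * volume {x | C1 * H < |cv (KK ε i j) f1 x|}) ≤ ENNReal.ofReal (C1 * H) * volume (ball c (s / 2)) := by
    calc ENNReal.ofReal (C1 * H) * (2048 * volume {x | C1 * H < |cv (KK ε i j) f1 x|})
        = 2048 * (ENNReal.ofReal (C1 * H) * volume {x | C1 * H < |cv (KK ε i j) f1 x|}) := by ring
      _ ≤ 2048 * (Cw * (ENNReal.ofReal H * (512 * volume (ball c (s / 2))))) := by
          refine mul_le_mul_right (hw.trans ?_) _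
          gcongr
      _ = 2048 * 512 * Cw * ENNReal.ofReal H * volume (ball c (s / 2)) := by ring
      _ ≤ ENNReal.ofReal (C1 * H) * volume (ball c (s / 2)) := by
          refine mul_le_mul_left ?_ _
          rw [ENNReal.ofReal_mul hC1p.le]
          refine mul_le_mul_left ?_ _
          rw [hC1]
          calc 2048 * 512 * Cw = ENNReal.ofReal (2048 * 512 * Cw.toReal) := by
                rw [ENNReal.ofReal_mul (by positivity), ENNReal.ofReal_toReal Cw_fin]; simp
            _ ≤ _ := ENNReal.ofReal_le_ofReal (by linarith)
  calc 2048 * volume (ball c s ∩ {x | Co * H < |cv (KK ε i j) f x - cv (KK ε i j) f2 c|})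
      ≤ 2048 * volume {x | C1 * H < |cv (KK ε i j) f1 x|} := mul_le_mul_right (measure_mono hsub) _
    _ ≤ _ := (ENNReal.mul_le_mul_iff_right hH0 ENNReal.ofReal_ne_top).1 hfinal


lemma pd_smooth {u : E3 → E3} (hu : ContDiff ℝ (⊤ : ℕ∞) u) (i j : Fin 3) : ContDiff ℝ 1 (pd u i j) := by
  have h1 : ContDiff ℝ 1 (fderiv ℝ u) := hu.fderiv_right (by norm_cast)
  have h2 : ContDiff ℝ 1 (fun x => fderiv ℝ u x (ee i)) := h1.clm_apply contDiff_const
  exact (contDiff_piLp_apply (p := 2) (i := j)).comp h2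

lemma pd_cpt {u : E3 → E3} (hc : HasCompactSupport u) (i j : Fin 3) : HasCompactSupport (pd u i j) :=
  (hc.fderiv_apply ℝ (ee i)).comp_left (g := fun y : E3 => y j) rfl

lemma pd_zero {u : E3 → E3} {x : E3} (hx : x ∉ tsupport u) (i j : Fin 3) : pd u i j x = 0 := by
  unfold pd
  rw [fderiv_of_notMem_tsupport ℝ hx]; rfl

lemma pd_int {u : E3 → E3} (hu : ContDiff ℝ (⊤ : ℕ∞) u) (hc : HasCompactSupport u) (i j : Fin 3) : Integrable (pd u i j) :=
  (pd_smooth hu i j).continuous.integrable_of_hasCompactSupport (pd_cpt hc i j)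

lemma co_smooth {u : E3 → E3} (hu : ContDiff ℝ (⊤ : ℕ∞) u) (j : Fin 3) : ContDiff ℝ (⊤ : ℕ∞) (fun x => u x j) :=
  (contDiff_piLp_apply (p := 2) (i := j)).comp hu

lemma co_int {u : E3 → E3} (hu : ContDiff ℝ (⊤ : ℕ∞) u) (hc : HasCompactSupport u) (j : Fin 3) : Integrable (fun x => u x j) :=
  (co_smooth hu j).continuous.integrable_of_hasCompactSupport (hc.comp_left (g := fun y : E3 => y j) rfl)

lemma co_fderiv {u : E3 → E3} (hu : ContDiff ℝ (⊤ : ℕ∞) u) (k j : Fin 3) (x : E3) :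
    fderiv ℝ (fun x => u x j) x (ee k) = pd u k j x := by
  have h : HasFDerivAt u (fderiv ℝ u x) x := (hu.differentiable (by simp) x).hasFDerivAt
  have h2 := ((EuclideanSpace.proj (𝕜 := ℝ) j : E3 →L[ℝ] ℝ).hasFDerivAt (x := u x)).comp x h
  have h3 : HasFDerivAt (fun x => u x j) ((EuclideanSpace.proj (𝕜 := ℝ) j : E3 →L[ℝ] ℝ).comp (fderiv ℝ u x)) x := h2
  rw [h3.fderiv]; rfl

lemma TT_cont {ε : ℝ} (hε : 0 < ε) (i j k : Fin 3) : Continuous (TT ε i j k) := by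
  have := (qq_contDiff hε).continuous
  unfold TT
  fun_prop

lemma TT_bdd {ε : ℝ} (hε : 0 < ε) (i j k : Fin 3) (x : E3) : |TT ε i j k x| ≤ 24 * ε⁻¹ ^ 4 :=
  (TT_bd hε i j k x).trans (mul_le_mul_of_nonneg_left (qpow_le hε 4 x) (by norm_num))

lemma rep1 {ε : ℝ} (hε : 0 < ε) {u : E3 → E3} (hu : ContDiff ℝ (⊤ : ℕ∞) u) (hc : HasCompactSupport u)
    (i j k l : Fin 3) (x : E3) : cv (KK ε i j) (pd u k l) x = cv (TT ε i j k) (fun y => u y l) x := by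
  have hd : ∀ y, HasFDerivAt (fun y => KK ε i j (x - y)) (-(fderiv ℝ (KK ε i j) (x - y))) y := by
    intro y
    have h1 : HasFDerivAt (fun y : E3 => x - y) (-(ContinuousLinearMap.id ℝ E3)) y := (hasFDerivAt_id y).const_sub x
    have h2 := (((KK_contDiff hε i j).differentiable (by simp)) (x - y)).hasFDerivAt
    have h3 := h2.comp y h1
    have e : fderiv ℝ (KK ε i j) (x - y) ∘SL (-ContinuousLinearMap.id ℝ E3) = -(fderiv ℝ (KK ε i j) (x - y)) := by
      ext v; simp
    rw [e] at h3
    exact h3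
  have he : ∀ y, fderiv ℝ (fun y => KK ε i j (x - y)) y (ee k) = -TT ε i j k (x - y) := by
    intro y
    rw [(hd y).fderiv]
    simp [KK_ee hε]
  have hI1 := cv_int (TT_cont hε i j k) (TT_bdd hε i j k) (co_int hu hc l) x
  have h := integral_mul_fderiv_eq_neg_fderiv_mul_of_integrable (μ := (volume : Measure E3))
    (f := fun y => KK ε i j (x - y)) (g := fun y => u y l) (v := ee k)
    (by simp only [he, neg_mul]; exact hI1.neg)
    (by simpa only [co_fderiv hu] using cv_int (KK_cont hε i j) (KK_bdd hε i j) (pd_int hu hc k l) x)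
    (cv_int (KK_cont hε i j) (KK_bdd hε i j) (co_int hu hc l) x)
    (fun y _ => (hd y).differentiableAt) (fun y _ => (co_smooth hu l).differentiable (by simp) y)
  simp only [he, co_fderiv hu, neg_mul, integral_neg, neg_neg] at h
  exact h

lemma cv_add {k : E3 → ℝ} (hk : Continuous k) {A : ℝ} (hA : ∀ x, |k x| ≤ A) {f g : E3 → ℝ} (hf : Integrable f) (hg : Integrable g) (x : E3) :
    cv k (fun y => f y + g y) x = cv k f x + cv k g x := by
  unfold cv
  rw [← integral_add (cv_int hk hA hf x) (cv_int hk hA hg x)]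
  congr 1; ext y; ring

lemma cv_sub {k : E3 → ℝ} (hk : Continuous k) {A : ℝ} (hA : ∀ x, |k x| ≤ A) {f g : E3 → ℝ} (hf : Integrable f) (hg : Integrable g) (x : E3) :
    cv k (fun y => f y - g y) x = cv k f x - cv k g x := by
  unfold cv
  rw [← integral_sub (cv_int hk hA hf x) (cv_int hk hA hg x)]
  congr 1; ext y; ring

/-- antisymmetric part -/
def rot (u : E3 → E3) (i j : Fin 3) (x : E3) : ℝ := pd u i j x - pd u j i x

lemma rep2 {ε : ℝ} (hε : 0 < ε) {u : E3 → E3} (hu : ContDiff ℝ (⊤ : ℕ∞) u) (hc : HasCompactSupport u)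
    (k j : Fin 3) (x : E3) : -3 * cv (ph ε) (pd u k j) x =
      cv (KK ε k j) (vdiv u) x + ∑ i, cv (KK ε k i) (rot u i j) x := by
  rw [← trace_cv hε (pd_int hu hc k j)]
  have hr : ∀ i, cv (KK ε k i) (rot u i j) x = cv (TT ε k i i) (fun y => u y j) x - cv (TT ε k i j) (fun y => u y i) x := by
    intro i
    unfold rot
    rw [cv_sub (KK_cont hε k i) (KK_bdd hε k i) (pd_int hu hc i j) (pd_int hu hc j i), rep1 hε hu hc, rep1 hε hu hc]
  have hv : cv (KK ε k j) (vdiv u) x = ∑ i, cv (TT ε k j i) (fun y => u y i) x := by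
    have : vdiv u = fun y => (pd u 0 0 y + pd u 1 1 y) + pd u 2 2 y := by
      ext y; simp [vdiv, Fin.sum_univ_three]
    rw [this, cv_add (f := fun y => pd u 0 0 y + pd u 1 1 y) (KK_cont hε k j) (KK_bdd hε k j) ((pd_int hu hc 0 0).add (pd_int hu hc 1 1)) (pd_int hu hc 2 2),
      cv_add (KK_cont hε k j) (KK_bdd hε k j) (pd_int hu hc 0 0) (pd_int hu hc 1 1), Fin.sum_univ_three,
      rep1 hε hu hc, rep1 hε hu hc, rep1 hε hu hc]
  have hT1 : ∀ i, TT ε k i i = TT ε i i k := by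
    intro i; ext y; rw [TT_perm2, TT_perm1]
  have hT2 : ∀ i, TT ε k j i = TT ε k i j := by
    intro i; ext y; rw [TT_perm1]
  rw [hv, ← Finset.sum_add_distrib]
  apply Finset.sum_congr rfl
  intro i _
  rw [hr, rep1 hε hu hc, hT1, hT2]; ring

lemma ph_approx {ε : ℝ} (hε : 0 < ε) {g : E3 → ℝ} (hgi : Integrable g) {Λ : ℝ≥0} (hg : LipschitzWith Λ g) (x : E3) :
    |cv (ph ε) g x - II * g x| ≤ Λ * (ε * JJ) := by
  have hb : ∀ x, |ph ε x| ≤ ε ^ 2 * ε⁻¹ ^ 5 := fun x => by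
    rw [abs_of_nonneg (ph_nonneg ε x)]
    unfold ph
    exact mul_le_mul_of_nonneg_left (qpow_le hε 5 x) (by positivity)
  have hi1 := cv_int (ph_cont hε) hb hgi x
  have hi2 : Integrable (fun y => ph ε (x - y) * g x) := ((ph_int hε).comp_sub_left x).mul_const _
  have e : cv (ph ε) g x - II * g x = ∫ y, ph ε (x - y) * (g y - g x) := by
    have : II * g x = ∫ y, ph ε (x - y) * g x := by
      rw [integral_mul_const, integral_sub_left_eq_self (ph ε) volume x, ph_integral hε]
    rw [this]; unfold cv
    rw [← integral_sub hi1 hi2]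
    congr 1; ext y; ring
  rw [e, ← ph_mintegral hε, ← integral_sub_left_eq_self (fun y => ‖y‖ * ph ε y) volume x, ← integral_const_mul]
  refine norm_integral_le_of_norm_le (f := fun y => ph ε (x - y) * (g y - g x)) (((ph_mint hε).comp_sub_left x).const_mul _) (ae_of_all _ fun y => ?_)
  rw [norm_mul, Real.norm_eq_abs, Real.norm_eq_abs, abs_of_nonneg (ph_nonneg _ _)]
  have h1 := hg.dist_le_mul y x
  rw [Real.dist_eq, dist_eq_norm, norm_sub_rev] at h1
  have := mul_le_mul_of_nonneg_left h1 (ph_nonneg ε (x - y))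
  linarith

lemma rep3 {u : E3 → E3} (hu : ContDiff ℝ (⊤ : ℕ∞) u) (hc : HasCompactSupport u)
    (k j : Fin 3) {H : ℝ} (hH : 0 < H) : ∃ ε, 0 < ε ∧ ∀ x, |3 * II * pd u k j x +
      (cv (KK ε k j) (vdiv u) x + ∑ i, cv (KK ε k i) (rot u i j) x)| ≤ H := by
  obtain ⟨Λ, hΛ⟩ := ContDiff.lipschitzWith_of_hasCompactSupport (pd_cpt hc k j) (pd_smooth hu k j) one_ne_zero
  have hJ := JJ_nonneg
  refine ⟨H / (3 * Λ * JJ + 1), by positivity, fun x => ?_⟩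
  have hε : 0 < H / (3 * Λ * JJ + 1) := by positivity
  rw [← rep2 hε hu hc]
  have h := ph_approx hε (pd_int hu hc k j) hΛ x
  set ε := H / (3 * Λ * JJ + 1) with he
  have e : 3 * II * pd u k j x + -3 * cv (ph ε) (pd u k j) x = -3 * (cv (ph ε) (pd u k j) x - II * pd u k j x) := by ring
  rw [e, abs_mul, abs_neg, abs_of_pos (by norm_num : (0:ℝ) < 3)]
  have h2 : (3 * Λ * JJ + 1) * ε = H := by rw [he]; field_simp
  nlinarith

/-- data -/
def dat (u : E3 → E3) (x : E3) : ℝ := |vdiv u x| + ‖vcurl u x‖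

lemma rot_le (u : E3 → E3) (i j : Fin 3) (x : E3) : |rot u i j x| ≤ ‖vcurl u x‖ := by
  have h0 : |pd u 1 2 x - pd u 2 1 x| ≤ ‖vcurl u x‖ := PiLp.norm_apply_le (vcurl u x) 0
  have h1 : |pd u 2 0 x - pd u 0 2 x| ≤ ‖vcurl u x‖ := PiLp.norm_apply_le (vcurl u x) 1
  have h2 : |pd u 0 1 x - pd u 1 0 x| ≤ ‖vcurl u x‖ := PiLp.norm_apply_le (vcurl u x) 2
  have h0' := h0; have h1' := h1; have h2' := h2
  rw [abs_sub_comm] at h0' h1' h2'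
  unfold rot
  fin_cases i <;> fin_cases j <;> simp <;> assumption

lemma rot_cont {u : E3 → E3} (hu : ContDiff ℝ (⊤ : ℕ∞) u) (i j : Fin 3) : Continuous (rot u i j) :=
  (pd_smooth hu i j).continuous.sub (pd_smooth hu j i).continuous

lemma div_cont {u : E3 → E3} (hu : ContDiff ℝ (⊤ : ℕ∞) u) : Continuous (vdiv u) :=
  continuous_finsetSum _ fun i _ => (pd_smooth hu i i).continuous

lemma curl_cont {u : E3 → E3} (hu : ContDiff ℝ (⊤ : ℕ∞) u) : Continuous (vcurl u) := by
  have h := fun i j => (pd_smooth hu i j).continuous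
  refine (PiLp.continuous_toLp 2 _).comp (continuous_pi fun i => ?_)
  fin_cases i
  · exact (h 1 2).sub (h 2 1)
  · exact (h 2 0).sub (h 0 2)
  · exact (h 0 1).sub (h 1 0)

lemma dat_cont {u : E3 → E3} (hu : ContDiff ℝ (⊤ : ℕ∞) u) : Continuous (dat u) :=
  (div_cont hu).abs.add (curl_cont hu).norm

lemma div_zero' {u : E3 → E3} {x : E3} (hx : x ∉ tsupport u) : vdiv u x = 0 := by
  simp [vdiv, pd_zero hx]

lemma curl_zero {u : E3 → E3} {x : E3} (hx : x ∉ tsupport u) : vcurl u x = 0 := by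
  ext i
  simp only [vcurl, pd_zero hx, mk3]
  fin_cases i <;> simp

lemma dat_zero {u : E3 → E3} {x : E3} (hx : x ∉ tsupport u) : dat u x = 0 := by
  simp [dat, div_zero' hx, curl_zero hx]

lemma dat_nonneg (u : E3 → E3) (x : E3) : 0 ≤ dat u x := by unfold dat; positivity

lemma supp_R {u : E3 → E3} (hc : HasCompactSupport u) : ∃ R, 0 < R ∧ ∀ x, R < ‖x‖ → x ∉ tsupport u := by
  obtain ⟨R, hR⟩ := hc.isCompact.isBounded.subset_closedBall 0
  refine ⟨max R 1, by positivity, fun x hx h => ?_⟩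
  have := hR h
  rw [mem_closedBall_zero_iff] at this
  exact absurd ((le_max_left R 1).trans_lt hx) (by linarith)

/-- oscillation constant -/
def C2 : ℝ := (4 * Co + 1) / (3 * II)

lemma C2_pos : 0 < C2 := by unfold C2; have := Co_pos; have := II_pos; positivity

lemma osc2 {u : E3 → E3} (hu : ContDiff ℝ (⊤ : ℕ∞) u) (hc : HasCompactSupport u) (k j : Fin 3)
    {c z : E3} {s : ℝ} (hz : z ∈ ball c s) {H : ℝ} (hH : 0 < H)
    (hzH : MM volume (fun x => ENNReal.ofReal (dat u x)) z ≤ ENNReal.ofReal H) :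
    ∃ q : ℝ, 512 * volume (ball c s ∩ {x | C2 * H < |pd u k j x - q|}) ≤ volume (ball c (s / 2)) := by
  obtain ⟨ε, hε, hrep⟩ := rep3 hu hc k j hH
  obtain ⟨R, hR, hRs⟩ := supp_R hc
  have hdi : Integrable (vdiv u) := (div_cont hu).integrable_of_hasCompactSupport
    (HasCompactSupport.of_support_subset_isCompact hc.isCompact fun x hx => by
      by_contra h; exact hx (div_zero' h))
  have hri : ∀ i, Integrable (rot u i j) := fun i => (pd_int hu hc i j).sub (pd_int hu hc j i)
  have hd := osc hε k j (div_cont hu) hR.le (fun x hx => div_zero' (hRs x hx)) hdi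
    (h := fun x => ENNReal.ofReal (dat u x))
    (fun x => ENNReal.ofReal_le_ofReal (by unfold dat; linarith [norm_nonneg (vcurl u x)])) hz hH hzH
  have hr := fun i => osc hε k i (rot_cont hu i j) hR.le
    (fun x hx => by simp [rot, pd_zero (hRs x hx)]) (hri i)
    (h := fun x => ENNReal.ofReal (dat u x))
    (fun x => ENNReal.ofReal_le_ofReal (by unfold dat; linarith [rot_le u i j x, abs_nonneg (vdiv u x)])) hz hH hzH
  obtain ⟨q, hq⟩ := hd
  choose r hr using hr
  have hII := II_pos
  refine ⟨-(q + ∑ i, r i) / (3 * II), ?_⟩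
  set V := volume (ball c (s / 2)) with hV
  set A := ball c s ∩ {x | Co * H < |cv (KK ε k j) (vdiv u) x - q|} with hA
  set B := fun i => ball c s ∩ {x | Co * H < |cv (KK ε k i) (rot u i j) x - r i|} with hB
  have hsub : ball c s ∩ {x | C2 * H < |pd u k j x - -(q + ∑ i, r i) / (3 * II)|} ⊆ A ∪ (B 0 ∪ (B 1 ∪ B 2)) := by
    rintro x ⟨hx, hx2⟩
    by_contra hn
    simp only [hA, hB, Set.mem_union, Set.mem_inter_iff, hx, true_and, not_or, Set.mem_ofPred_eq, not_lt] at hn hx2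
    obtain ⟨n1, n2, n3, n4⟩ := hn
    have h5 := hrep x
    rw [Fin.sum_univ_three] at h5 hx2
    have e1 : pd u k j x - -(q + (r 0 + r 1 + r 2)) / (3 * II) = (3 * II * pd u k j x + (q + (r 0 + r 1 + r 2))) / (3 * II) := by
      field_simp; ring
    rw [e1, abs_div, abs_of_pos (by positivity : 0 < 3 * II), C2, div_mul_eq_mul_div, div_lt_div_iff_of_pos_right (by positivity)] at hx2
    rw [abs_le] at n1 n2 n3 n4 h5
    rw [lt_abs] at hx2
    rcases hx2 with h | h <;> linarith [n1.1, n1.2, n2.1, n2.2, n3.1, n3.2, n4.1, n4.2, h5.1, h5.2]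
  have hU : volume (ball c s ∩ {x | C2 * H < |pd u k j x - -(q + ∑ i, r i) / (3 * II)|}) ≤
      volume A + (volume (B 0) + (volume (B 1) + volume (B 2))) := by
    refine (measure_mono hsub).trans ((measure_union_le _ _).trans (add_le_add le_rfl ?_))
    refine (measure_union_le _ _).trans (add_le_add le_rfl (measure_union_le _ _))
  have h4 : (4 : ℝ≥0∞) * (512 * volume (ball c s ∩ {x | C2 * H < |pd u k j x - -(q + ∑ i, r i) / (3 * II)|})) ≤ 4 * V := by
    calc _ ≤ (4 : ℝ≥0∞) * (512 * (volume A + (volume (B 0) + (volume (B 1) + volume (B 2))))) := by gcongr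
      _ = 2048 * volume A + (2048 * volume (B 0) + (2048 * volume (B 1) + 2048 * volume (B 2))) := by
          have : (2048 : ℝ≥0∞) = 4 * 512 := by norm_num
          rw [this]; ring
      _ ≤ V + (V + (V + V)) := by
          exact add_le_add hq (add_le_add (hr 0) (add_le_add (hr 1) (hr 2)))
      _ = 4 * V := by ring
  exact (ENNReal.mul_le_mul_iff_right (by norm_num) (by norm_num)).1 h4

lemma dat_null {u : E3 → E3} (hu : ContDiff ℝ (⊤ : ℕ∞) u) (hc : HasCompactSupport u)
    (h0 : ∀ x, dat u x = 0) (k j : Fin 3) (x : E3) : pd u k j x = 0 := by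
  have h1 : vdiv u = fun _ => 0 := by
    ext y; have := h0 y; unfold dat at this
    have := norm_nonneg (vcurl u y); have := abs_nonneg (vdiv u y)
    exact abs_eq_zero.1 (by linarith)
  have h2 : ∀ i, rot u i j = fun _ => 0 := by
    intro i; ext y; have := h0 y; unfold dat at this
    have h3 := rot_le u i j y; have := abs_nonneg (vdiv u y); have := abs_nonneg (rot u i j y)
    exact abs_eq_zero.1 (by linarith)
  have hII := II_pos
  have h3 : ∀ H, 0 < H → |3 * II * pd u k j x| ≤ 0 + H := by
    intro H hH
    obtain ⟨ε, hε, hr⟩ := rep3 hu hc k j hH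
    have := hr x
    simp only [h1, h2, cv, mul_zero, integral_zero, Finset.sum_const_zero, add_zero] at this
    linarith
  have h4 := le_of_forall_pos_le_add h3
  have h5 : 3 * II * pd u k j x = 0 := abs_eq_zero.1 (le_antisymm h4 (abs_nonneg _))
  rcases mul_eq_zero.1 h5 with h | h
  · exfalso; linarith
  · exact h


lemma absorb {X Y : ℝ≥0∞} {p q : ℝ} (hpq : p.HolderConjugate q) (hX : X ≠ ∞) (h : X ≤ Y * X ^ (1 / q)) : X ≤ Y ^ p := by
  have hp := hpq.pos
  have hq := hpq.symm.pos
  by_cases h0 : X = 0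
  · rw [h0]; exact zero_le
  have h1 : X = X ^ (1 / p) * X ^ (1 / q) := by
    rw [← ENNReal.rpow_add _ _ h0 hX, one_div, one_div, hpq.inv_add_inv_eq_one, ENNReal.rpow_one]
  have hne : X ^ (1 / q) ≠ 0 := by
    rw [Ne, ENNReal.rpow_eq_zero_iff]; push Not
    exact ⟨fun h => absurd h h0, fun h => absurd h hX⟩
  have hnt : X ^ (1 / q) ≠ ∞ := ENNReal.rpow_ne_top_of_nonneg (by positivity) hX
  have h2 : X ^ (1 / p) ≤ Y := by
    rw [← ENNReal.mul_le_mul_iff_left hne hnt, ← h1]; exact h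
  calc X = (X ^ (1 / p)) ^ p := by rw [← ENNReal.rpow_mul, one_div_mul_cancel hp.ne', ENNReal.rpow_one]
    _ ≤ Y ^ p := ENNReal.rpow_le_rpow h2 hp.le

lemma MM_le_bd {ν : Measure E3} {h : E3 → ℝ≥0∞} {G : ℝ≥0∞} (hh : ∀ x, h x ≤ G) (z : E3) : MM ν h z ≤ G := by
  refine iSup_le fun c => iSup_le fun r => iSup_le fun _ => ?_
  refine ENNReal.div_le_of_le_mul ?_
  calc ∫⁻ y in ball c r, h y ∂ν ≤ ∫⁻ y in ball c r, G ∂ν := lintegral_mono hh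
    _ = G * ν (ball c r) := by simp

lemma pick {h : E3 → ℝ≥0∞} {G : ℝ} {R : ℝ} (hG : ∀ x, h x ≤ ENNReal.ofReal G) (hsup : ∀ x, R < ‖x‖ → h x = 0)
    (h0 : ∫⁻ x, h x ≠ 0) {Q : Set E3} {c : E3} {s : ℝ} (hQ : Q ⊆ ball c s) (hc : c ∈ Q) :
    ∃ z ∈ Q, MM volume h z ≠ 0 ∧ ∀ x ∈ Q, MM volume h z ≤ 2 * MM volume h x := by
  have hs : 0 < s := Metric.pos_of_mem_ball (hQ hc)
  set r := s + |R| + ‖c‖ with hr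
  set δ := (∫⁻ y in ball c r, h y) / volume (ball c r) with hδ
  have hrp : 0 < r := by positivity
  have hall : ∫⁻ y in ball c r, h y = ∫⁻ y, h y := by
    apply setLIntegral_eq_of_support_subset
    intro y hy
    have h1 : ‖y‖ ≤ R := by
      by_contra hn; exact hy (hsup y (not_le.1 hn))
    rw [Metric.mem_ball, dist_eq_norm]
    have := norm_sub_le y c
    have := le_abs_self R
    linarith
  have hδ0 : δ ≠ 0 := by
    rw [hδ, hall]
    exact ENNReal.div_ne_zero.2 ⟨h0, measure_ball_lt_top.ne⟩
  have hδle : ∀ x ∈ Q, δ ≤ MM volume h x := fun x hx => le_MM volume h (Metric.ball_subset_ball (by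
    have := norm_nonneg c; have := abs_nonneg R; linarith) (hQ hx))
  set I := ⨅ x ∈ Q, MM volume h x with hI
  have hIδ : δ ≤ I := le_iInf₂ hδle
  have hI0 : I ≠ 0 := fun h => hδ0 (le_antisymm (h ▸ hIδ) zero_le)
  have hIt : I ≠ ∞ := ((iInf₂_le c hc).trans_lt ((MM_le_bd hG c).trans_lt ENNReal.ofReal_lt_top)).ne
  have hlt : I < 2 * I := by
    rw [two_mul]; exact ENNReal.lt_add_right hIt hI0
  obtain ⟨z, hz⟩ := iInf_lt_iff.1 hlt
  obtain ⟨hzQ, hz⟩ := iInf_lt_iff.1 hz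
  refine ⟨z, hzQ, fun h => hδ0 (le_antisymm (h ▸ hδle z hzQ) zero_le), fun x hx => hz.le.trans ?_⟩
  gcongr
  exact iInf₂_le x hx

theorem main_w {ω : E3 → ℝ≥0∞} {p : ℝ} {A : ℝ≥0∞} (hW : Wt ω p A) :
    ∃ C : ℝ≥0∞, C ≠ ∞ ∧ ∀ u : E3 → E3, ContDiff ℝ (⊤ : ℕ∞) u → HasCompactSupport u → ∀ k j,
      ∫⁻ x, ENNReal.ofReal |pd u k j x| ^ p ∂(volume.withDensity ω) ≤
        C * ∫⁻ x, ENNReal.ofReal (dat u x) ^ p ∂(volume.withDensity ω) := by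
  have hp := hW.hp
  have hp1 : 0 < p - 1 := by linarith
  have hpq := Real.HolderConjugate.conjExponent hp
  set q := p.conjExponent with hq
  have hq1 : 1 < q := hpq.symm.lt
  have hD := hW.dblW
  obtain ⟨Cm, hCm, hmuck⟩ := hW.muck
  obtain ⟨Cs, hCs, hstr⟩ := MM_strong hD hq1
  set μ := volume.withDensity ω with hμ
  set B := A * (16 : ℝ≥0∞) ^ p with hB
  have hBt : B ≠ ∞ := ENNReal.mul_ne_top hW.At (ENNReal.rpow_ne_top_of_nonneg (by linarith) (by simp))
  set K := 2 * B * (2 * ENNReal.ofReal C2) * (Cm ^ (1 / p) * Cs ^ (1 / q)) with hK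
  have hKt : K ≠ ∞ := by
    have h1 : Cm ^ (1 / p) ≠ ∞ := ENNReal.rpow_ne_top_of_nonneg (by positivity) hCm
    have h2 : Cs ^ (1 / q) ≠ ∞ := ENNReal.rpow_ne_top_of_nonneg (by positivity) hCs
    rw [hK]; finiteness
  refine ⟨K ^ p, ENNReal.rpow_ne_top_of_nonneg (by linarith) hKt, fun u hu hc k j => ?_⟩
  set F := pd u k j with hF
  set h : E3 → ℝ≥0∞ := fun x => ENNReal.ofReal (dat u x) with hh
  have hFc : Continuous F := (pd_smooth hu k j).continuous
  have hhm : Measurable h := (dat_cont hu).measurable.ennreal_ofReal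
  by_cases hz : ∀ x, dat u x = 0
  · have : ∀ x, F x = 0 := dat_null hu hc hz k j
    have e : ∫⁻ x, ENNReal.ofReal |F x| ^ p ∂μ = 0 := by
      simp only [this, abs_zero, ENNReal.ofReal_zero, ENNReal.zero_rpow_of_pos (by linarith : 0 < p), lintegral_zero]
    rw [e]; exact zero_le
  push Not at hz
  obtain ⟨x0, hx0⟩ := hz
  have hint0 : ∫⁻ x, h x ≠ 0 := by
    intro h0
    rw [lintegral_eq_zero_iff hhm] at h0
    have hcont : Continuous h := ENNReal.continuous_ofReal.comp (dat_cont hu)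
    have := (Continuous.ae_eq_iff_eq (volume : Measure E3) hcont continuous_const).1 h0
    have h1 := congrFun this x0
    simp only [hh] at h1
    have h2 : ENNReal.ofReal (dat u x0) = 0 := h1
    rw [ENNReal.ofReal_eq_zero] at h2
    exact hx0 (le_antisymm h2 (dat_nonneg u x0))
  obtain ⟨R, hR, hRs⟩ := supp_R hc
  obtain ⟨G0, hG0⟩ := (dat_cont hu).bounded_above_of_compact_support
    (HasCompactSupport.of_support_subset_isCompact hc.isCompact fun x hx => by
      by_contra h; exact hx (dat_zero h))
  obtain ⟨M0, hM0⟩ := hFc.bounded_above_of_compact_support (pd_cpt hc k j)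
  have hhG : ∀ x, h x ≤ ENNReal.ofReal G0 := fun x => ENNReal.ofReal_le_ofReal ((le_abs_self _).trans (hG0 x))
  have hG00 : 0 ≤ G0 := (norm_nonneg _).trans (hG0 0)
  have hhs : ∀ x, R < ‖x‖ → h x = 0 := fun x hx => by simp only [hh, dat_zero (hRs x hx), ENNReal.ofReal_zero]
  set L := 8 * R with hLd
  have hL : 0 < L := by positivity
  have hpick : ∀ (k : ℕ) (m : Fin 3 → ℤ), ∃ z ∈ cell L k m, MM volume h z ≠ 0 ∧ ∀ x ∈ cell L k m, MM volume h z ≤ 2 * MM volume h x :=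
    fun k m => pick hhG hhs hint0 (cell_sub_ball hL k m) (ctr_mem hL k m)
  choose z hzm hz0 hz2 using hpick
  have hzt : ∀ k m, MM volume h (z k m) ≠ ∞ := fun k m => ((MM_le_bd hhG _).trans_lt ENNReal.ofReal_lt_top).ne
  have hosc : ∀ (n : ℕ) (m : Fin 3 → ℤ), ∃ c : ℝ, 512 * volume (cell L n m ∩ {x | C2 * (MM volume h (z n m)).toReal < |F x - c|}) ≤ volume (cell L n m) := by
    intro n m
    obtain ⟨c, hc'⟩ := osc2 hu hc k j (cell_sub_ball hL n m (hzm n m)) (ENNReal.toReal_pos (hz0 n m) (hzt n m))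
      (by rw [ENNReal.ofReal_toReal (hzt n m)])
    refine ⟨c, (mul_le_mul_right (measure_mono ?_) _).trans (hc'.trans (measure_mono (ball_sub_cell hL n m)))⟩
    exact Set.inter_subset_inter_left _ (cell_sub_ball hL n m)
  choose cc hcc using hosc
  set aa : ℕ → (Fin 3 → ℤ) → ℝ := fun n m => C2 * (MM volume h (z n m)).toReal with haa
  have hC2 := C2_pos
  have hBB : ∀ n m E, E ⊆ cell L n m → MeasurableSet E → volume (cell L n m) ≤ 2 * volume E →
      μ (ball (ctr L n m) (sd L n)) ≤ B * μ E := by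
    intro n m E hE hEm hEv
    rw [hμ, withDensity_apply _ measurableSet_ball, withDensity_apply _ hEm]
    refine hW.compW (sd_pos hL n) (hE.trans (cell_sub_ball hL n m)) ?_
    have := ball_le_cell hL n m (ctr L n m) 2 (by norm_num)
    rw [Nat.cast_ofNat, mul_div_cancel₀ _ (two_ne_zero)] at this
    refine this.trans ?_
    calc ((2 ^ 3 : ℕ) : ℝ≥0∞) * volume (cell L n m) ≤ ((2 ^ 3 : ℕ) : ℝ≥0∞) * (2 * volume E) := by gcongr
      _ = 16 * volume E := by rw [← mul_assoc]; norm_num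
  set g : E3 → ℝ≥0∞ := fun x => ENNReal.ofReal |F x| ^ (p - 1) with hg
  have hgm : Measurable g := by
    have := hFc.measurable
    simp only [hg]; fun_prop
  have hMm := MM_measurable volume h
  have hfs := fefferman_stein hL hBt hD.fin hD.pos hBB hFc (cc := cc) (aa := aa) (M := max M0 (C2 * G0))
    (fun x => (hM0 x).trans (le_max_left _ _))
    (fun n m => by
      refine le_trans ?_ (le_max_right _ _)
      simp only [haa]
      gcongr
      exact ENNReal.toReal_le_of_le_ofReal hG00 (MM_le_bd hhG _))
    (fun n m => by simp only [haa]; positivity) hcc (g := g) (H := fun x => 2 * ENNReal.ofReal C2 * MM volume h x)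
    hgm (by fun_prop) (G := ENNReal.ofReal M0 ^ (p - 1)) (ENNReal.rpow_ne_top_of_nonneg hp1.le ENNReal.ofReal_ne_top)
    (fun x => ENNReal.rpow_le_rpow (ENNReal.ofReal_le_ofReal (hM0 x)) hp1.le)
    (fun n m x hx => by
      simp only [haa]
      rw [ENNReal.ofReal_mul hC2.le, ENNReal.ofReal_toReal (hzt n m)]
      calc _ ≤ ENNReal.ofReal C2 * (2 * MM volume h x) := by gcongr; exact hz2 n m x hx
        _ = _ := by ring) 0 0
  -- the top constant
  have hsub : closedBall (0 : E3) R ⊆ ball 0 (2 * R) := Metric.closedBall_subset_ball (by linarith)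
  have hFz : ∀ x, R < ‖x‖ → F x = 0 := fun x hx => pd_zero (hRs x hx) k j
  have hsuppF : ∀ x, F x ≠ 0 → x ∈ ball (0 : E3) (2 * R) := by
    intro x hx
    apply hsub
    rw [mem_closedBall_zero_iff]
    by_contra hn
    exact hx (hFz x (not_le.1 hn))
  have hcell : ball (0 : E3) (4 * R) ⊆ cell L 0 0 := by
    have := ball_sub_top hL
    rwa [show L / 2 = 4 * R by rw [hLd]; ring] at this
  have hsuppc : ∀ x, F x ≠ 0 → x ∈ cell L 0 0 := fun x hx =>
    hcell (Metric.ball_subset_ball (by linarith) (hsuppF x hx))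
  have hctop : |cc 0 0 - 0| ≤ aa 0 0 + 0 := by
    refine const_close (F := F) hL (k := 0) (m := 0) ?_ ?_
    · refine le_trans ?_ (hcc 0 0)
      gcongr
      norm_num
    · have hv := vol_ball_mul (0 : E3) 0 (by positivity : 0 < 2 * R) 2 (by norm_num)
      rw [Nat.cast_ofNat, show (2:ℝ) * (2 * R) = 4 * R by ring] at hv
      calc 4 * volume (cell L 0 0 ∩ {x | 0 < |F x - 0|}) ≤ 4 * volume (ball (0 : E3) (2 * R)) := by
            refine mul_le_mul_right (measure_mono ?_) _
            rintro x ⟨_, hx⟩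
            rw [Set.mem_ofPred_eq, sub_zero, abs_pos] at hx
            exact hsuppF x hx
        _ ≤ (2 ^ 3 : ℕ) * volume (ball (0 : E3) (2 * R)) := by
            gcongr; norm_num
        _ = volume (ball (0 : E3) (4 * R)) := hv.symm
        _ ≤ _ := measure_mono hcell
  rw [sub_zero, add_zero] at hctop
  set X := ∫⁻ x, ENNReal.ofReal |F x| ^ p ∂μ with hX
  have hpe : ∀ a : ℝ≥0∞, a ≠ ∞ → a * a ^ (p - 1) = a ^ p := by
    intro a ha
    by_cases h0 : a = 0
    · rw [h0, zero_mul, ENNReal.zero_rpow_of_pos (by linarith)]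
    · nth_rewrite 1 [← ENNReal.rpow_one a]
      rw [← ENNReal.rpow_add _ _ h0 ha]; congr 1; ring
  have hX1 : X ≤ 2 * B * ∫⁻ x in cell L 0 0, 2 * ENNReal.ofReal C2 * MM volume h x * MM μ g x ∂μ := by
    refine le_trans ?_ hfs
    calc X = ∫⁻ x in cell L 0 0, ENNReal.ofReal |F x| ^ p ∂μ := by
          symm
          apply setLIntegral_eq_of_support_subset
          intro x hx
          apply hsuppc
          intro h0
          apply hx
          dsimp only
          rw [h0, abs_zero, ENNReal.ofReal_zero, ENNReal.zero_rpow_of_pos (by linarith)]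
      _ ≤ ∫⁻ x in cell L 0 0, (ENNReal.ofReal |F x - cc 0 0| * g x + ENNReal.ofReal (aa 0 0) * g x) ∂μ := by
          apply lintegral_mono; intro x
          dsimp only
          rw [← hpe _ ENNReal.ofReal_ne_top, ← add_mul]
          refine mul_le_mul_left ?_ _
          rw [← ENNReal.ofReal_add (abs_nonneg _) (by simp only [haa]; positivity)]
          apply ENNReal.ofReal_le_ofReal
          have := abs_add_le (F x - cc 0 0) (cc 0 0)
          rw [sub_add_cancel] at this
          linarith
      _ = _ := by
          rw [lintegral_add_right _ (by fun_prop), lintegral_const_mul _ hgm]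
  have hMMg := MM_measurable μ g
  have hgq : ∀ x, g x ^ q = ENNReal.ofReal |F x| ^ p := by
    intro x
    simp only [hg]
    rw [← ENNReal.rpow_mul]; congr 1
    rw [hq, Real.conjExponent]; field_simp
  set Dd := ∫⁻ x, h x ^ p ∂μ with hDd
  have hX2 : ∫⁻ x in cell L 0 0, 2 * ENNReal.ofReal C2 * MM volume h x * MM μ g x ∂μ ≤
      2 * ENNReal.ofReal C2 * ((Cm * Dd) ^ (1 / p) * (Cs * X) ^ (1 / q)) := by
    calc _ ≤ ∫⁻ x, 2 * ENNReal.ofReal C2 * MM volume h x * MM μ g x ∂μ := setLIntegral_le_lintegral _ _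
      _ = 2 * ENNReal.ofReal C2 * ∫⁻ x, (MM volume h * MM μ g) x ∂μ := by
          rw [← lintegral_const_mul _ (hMm.mul hMMg)]
          congr 1; ext x; simp only [Pi.mul_apply]; ring
      _ ≤ _ := by
          gcongr
          refine (ENNReal.lintegral_mul_le_Lp_mul_Lq μ hpq hMm.aemeasurable hMMg.aemeasurable).trans ?_
          gcongr
          · exact hmuck h hhm
          · refine (hstr g hgm).trans (le_of_eq ?_)
            simp only [hgq]; rfl
  have hXt : X ≠ ∞ := by
    have : X ≤ ENNReal.ofReal M0 ^ p * μ (ball 0 (2 * R)) := by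
      calc X = ∫⁻ x in ball (0 : E3) (2 * R), ENNReal.ofReal |F x| ^ p ∂μ := by
            symm
            apply setLIntegral_eq_of_support_subset
            intro x hx
            apply hsuppF
            intro h0
            apply hx
            dsimp only
            rw [h0, abs_zero, ENNReal.ofReal_zero, ENNReal.zero_rpow_of_pos (by linarith)]
        _ ≤ ∫⁻ x in ball (0 : E3) (2 * R), ENNReal.ofReal M0 ^ p ∂μ := lintegral_mono fun x =>
            ENNReal.rpow_le_rpow (ENNReal.ofReal_le_ofReal (hM0 x)) (by linarith)
        _ = _ := by simp
    refine (this.trans_lt (ENNReal.mul_lt_top (ENNReal.rpow_lt_top_of_nonneg (by linarith) ENNReal.ofReal_ne_top) (hD.fin _ _))).ne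
  have hX3 : X ≤ (K * Dd ^ (1 / p)) * X ^ (1 / q) := by
    refine hX1.trans ((mul_le_mul_right hX2 _).trans (le_of_eq ?_))
    rw [ENNReal.mul_rpow_of_nonneg _ _ (by positivity), ENNReal.mul_rpow_of_nonneg _ _ (by have := hpq.symm.pos; positivity), hK]
    ring
  refine (absorb hpq hXt hX3).trans (le_of_eq ?_)
  rw [ENNReal.mul_rpow_of_nonneg _ _ (by linarith), ← ENNReal.rpow_mul, one_div_mul_cancel (by linarith), ENNReal.rpow_one]


lemma ball_sub_cube (c : E3) (r : ℝ) : ball c r ⊆ cube c r := by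
  intro x hx i
  rw [Metric.mem_ball, dist_eq_norm] at hx
  have := PiLp.norm_apply_le (x - c) i
  rw [PiLp.sub_apply, Real.norm_eq_abs] at this
  linarith

lemma cube_sub_ball (c : E3) {r : ℝ} (hr : 0 < r) : cube c r ⊆ ball c (2 * r) := by
  intro x hx
  rw [Metric.mem_ball, dist_eq_norm, EuclideanSpace.norm_eq, Real.sqrt_lt' (by positivity)]
  have h : ∀ i, ‖(x - c) i‖ ^ 2 ≤ r ^ 2 := by
    intro i
    have := hx i
    rw [PiLp.sub_apply, Real.norm_eq_abs]
    exact pow_le_pow_left₀ (abs_nonneg _) this 2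
  rw [Fin.sum_univ_three]
  nlinarith [h 0, h 1, h 2]

lemma exists_Wt {p : ℝ} (hp : 1 < p) {w : E3 → ℝ}
    (hwpos : ∀ᵐ x ∂(volume : Measure E3), 0 < w x)
    (hwloc : LocallyIntegrable w (volume : Measure E3))
    (hap : IsMuckenhouptAp w p) :
    ∃ (ω : E3 → ℝ≥0∞) (A : ℝ≥0∞), Wt ω p A ∧ ∀ᵐ x ∂(volume : Measure E3), ω x = ENNReal.ofReal (w x) := by
  obtain ⟨C, hC⟩ := hap
  have hp1 : 0 < p - 1 := by linarith
  set w1 := hwloc.aestronglyMeasurable.mk w with hw1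
  have hw1m : Measurable w1 := hwloc.aestronglyMeasurable.stronglyMeasurable_mk.measurable
  have hw1e : ∀ᵐ x ∂(volume : Measure E3), w x = w1 x := hwloc.aestronglyMeasurable.ae_eq_mk
  set ω : E3 → ℝ≥0∞ := fun x => if 0 < w1 x then ENNReal.ofReal (w1 x) else 1 with hω
  have hωe : ∀ᵐ x ∂(volume : Measure E3), ω x = ENNReal.ofReal (w x) := by
    filter_upwards [hwpos, hw1e] with x h1 h2
    rw [hω]; dsimp only
    rw [h2] at h1 ⊢
    rw [if_pos h1]
  have hσe : ∀ᵐ x ∂(volume : Measure E3), ω x ^ (-1 / (p - 1)) = ENNReal.ofReal (w x ^ (-1 / (p - 1))) := by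
    filter_upwards [hwpos, hωe] with x h1 h2
    rw [h2, ENNReal.ofReal_rpow_of_pos h1]
  refine ⟨ω, ENNReal.ofReal C * 8 ^ p, ?_, hωe⟩
  constructor
  · exact hp
  · exact Measurable.ite (measurableSet_lt measurable_const hw1m) hw1m.ennreal_ofReal measurable_const
  · intro x
    rw [hω]; dsimp only
    split_ifs with h
    · exact (ENNReal.ofReal_pos.2 h).ne'
    · exact one_ne_zero
  · intro x
    rw [hω]; dsimp only
    split_ifs with h
    · exact ENNReal.ofReal_ne_top
    · exact ENNReal.one_ne_top
  · exact ENNReal.mul_ne_top ENNReal.ofReal_ne_top (ENNReal.rpow_ne_top_of_nonneg (by linarith) (by simp))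
  · intro c r
    have hi : IntegrableOn w (closedBall c r) := hwloc.integrableOn_isCompact (isCompact_closedBall c r)
    have hi2 : IntegrableOn w (ball c r) := hi.mono_set Metric.ball_subset_closedBall
    rw [lintegral_congr_ae (ae_restrict_of_ae hωe)]
    exact hi2.lintegral_lt_top
  · intro c r hr
    have hV2 : volume (ball c (2 * r)) = 8 * volume (ball c r) := by
      have := vol_ball_mul c c hr 2 (by norm_num)
      rw [Nat.cast_ofNat] at this
      rw [this]; norm_num
    have hVle : volume (cube c r) ≤ 8 * volume (ball c r) := hV2 ▸ measure_mono (cube_sub_ball c hr)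
    have hVt : volume (cube c r) ≠ ∞ := ne_top_of_le_ne_top (ENNReal.mul_ne_top (by simp) measure_ball_lt_top.ne) hVle
    have hV0 : volume (cube c r) ≠ 0 :=
      ((Metric.measure_ball_pos volume c hr).trans_le (measure_mono (ball_sub_cube c r))).ne'
    set V := volume (cube c r) with hV
    have h := hC c r hr
    set a := lavg (cube c r) w with ha
    set b := lavg (cube c r) (fun x => w x ^ (-1 / (p - 1))) with hb
    have hI : (∫⁻ x in cube c r, ω x) = a * V := by
      rw [lintegral_congr_ae (ae_restrict_of_ae hωe), ha, lavg, ENNReal.div_mul_cancel hV0 hVt]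
    have hJ : (∫⁻ x in cube c r, ω x ^ (-1 / (p - 1))) = b * V := by
      rw [lintegral_congr_ae (ae_restrict_of_ae hσe), hb, lavg, ENNReal.div_mul_cancel hV0 hVt]
    calc (∫⁻ x in ball c r, ω x) * (∫⁻ x in ball c r, ω x ^ (-1 / (p - 1))) ^ (p - 1)
        ≤ (∫⁻ x in cube c r, ω x) * (∫⁻ x in cube c r, ω x ^ (-1 / (p - 1))) ^ (p - 1) :=
          mul_le_mul' (lintegral_mono_set (ball_sub_cube c r))
            (ENNReal.rpow_le_rpow (lintegral_mono_set (ball_sub_cube c r)) hp1.le)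
      _ = (a * b ^ (p - 1)) * (V * V ^ (p - 1)) := by
          rw [hI, hJ, ENNReal.mul_rpow_of_nonneg _ _ hp1.le]; ring
      _ = (a * b ^ (p - 1)) * V ^ p := by
          congr 1
          nth_rewrite 1 [← ENNReal.rpow_one V]
          rw [← ENNReal.rpow_add _ _ hV0 hVt]; congr 1; ring
      _ ≤ ENNReal.ofReal C * (8 * volume (ball c r)) ^ p :=
          mul_le_mul' h (ENNReal.rpow_le_rpow hVle (by linarith))
      _ = _ := by rw [ENNReal.mul_rpow_of_nonneg _ _ (by linarith : (0:ℝ) ≤ p)]; ring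

lemma conv_int {Ω : Set E3} {p : ℝ} {w : E3 → ℝ} {ω : E3 → ℝ≥0∞} {A : ℝ≥0∞} (hW : Wt ω p A)
    (hw0 : ∀ x, 0 ≤ w x) (hwm : AEStronglyMeasurable w (volume : Measure E3))
    (hωe : ∀ᵐ x ∂(volume : Measure E3), ω x = ENNReal.ofReal (w x))
    {u : E3 → E3} (hc : HasCompactSupport u) (hs : tsupport u ⊆ Ω)
    {φ : E3 → ℝ} (hφ : Continuous φ) (hφ0 : ∀ x, 0 ≤ φ x) (hφs : ∀ x, x ∉ tsupport u → φ x = 0) :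
    (∫ x in Ω, w x * φ x ^ p) = (∫⁻ x, ENNReal.ofReal (φ x) ^ p ∂(volume.withDensity ω)).toReal ∧
    (∫⁻ x, ENNReal.ofReal (φ x) ^ p ∂(volume.withDensity ω)) ≠ ∞ := by
  have hp := hW.hp
  have hp0 : 0 < p := by linarith
  constructor
  · rw [setIntegral_eq_integral_of_forall_compl_eq_zero]
    · rw [integral_eq_lintegral_of_nonneg_ae]
      · congr 1
        have hm : Measurable (fun x => ENNReal.ofReal (φ x) ^ p) := by
          have := hφ.measurable
          fun_prop
        rw [lintegral_withDensity_eq_lintegral_mul volume hW.meas hm]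
        apply lintegral_congr_ae
        filter_upwards [hωe] with x hx
        rw [Pi.mul_apply, hx, ENNReal.ofReal_mul (hw0 x), ENNReal.ofReal_rpow_of_nonneg (hφ0 x) hp0.le]
      · exact Eventually.of_forall fun x => mul_nonneg (hw0 x) (Real.rpow_nonneg (hφ0 x) _)
      · exact hwm.mul (hφ.rpow_const fun _ => Or.inr hp0.le).aestronglyMeasurable
    · intro x hx
      rw [hφs x (fun h => hx (hs h)), Real.zero_rpow hp0.ne', mul_zero]
  · obtain ⟨R, hR, hsR⟩ := supp_R hc
    have hφc : HasCompactSupport φ := HasCompactSupport.intro hc.isCompact hφs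
    obtain ⟨M, hM⟩ := hφ.bounded_above_of_compact_support hφc
    have h1 : ∀ x, ENNReal.ofReal (φ x) ^ p ≤ (ball (0 : E3) (2 * R)).indicator (fun _ => ENNReal.ofReal M ^ p) x := by
      intro x
      by_cases hx : x ∈ ball (0 : E3) (2 * R)
      · rw [Set.indicator_of_mem hx]
        exact ENNReal.rpow_le_rpow (ENNReal.ofReal_le_ofReal ((le_abs_self _).trans (hM x))) hp0.le
      · rw [mem_ball_zero_iff, not_lt] at hx
        rw [hφs x (hsR x (by linarith)), ENNReal.ofReal_zero, ENNReal.zero_rpow_of_pos hp0]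
        exact zero_le
    refine ne_top_of_le_ne_top ?_ (lintegral_mono h1)
    rw [lintegral_indicator measurableSet_ball, setLIntegral_const]
    exact ENNReal.mul_ne_top (ENNReal.rpow_ne_top_of_nonneg hp0.le ENNReal.ofReal_ne_top) (hW.dblW.fin 0 _).ne

lemma frob_le (M : Fin 3 → Fin 3 → ℝ) : frob M ≤ ∑ q : Fin 3 × Fin 3, |M q.1 q.2| := by
  unfold frob
  apply Real.sqrt_le_iff.2
  refine ⟨Finset.sum_nonneg fun _ _ => abs_nonneg _, ?_⟩
  rw [← Fintype.sum_prod_type' (fun i j => M i j ^ 2)]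
  calc ∑ q : Fin 3 × Fin 3, M q.1 q.2 ^ 2 = ∑ q : Fin 3 × Fin 3, |M q.1 q.2| ^ 2 := by simp only [sq_abs]
    _ ≤ _ := Finset.sum_sq_le_sq_sum_of_nonneg fun _ _ => abs_nonneg _

lemma frob_cont {u : E3 → E3} (hu : ContDiff ℝ (⊤ : ℕ∞) u) : Continuous fun x => frob (gradv u x) := by
  have h := fun i j => (pd_smooth hu i j).continuous
  unfold frob gradv
  exact (continuous_finsetSum _ fun i _ => continuous_finsetSum _ fun j _ => (h i j).pow 2).sqrt

lemma frob_zero {u : E3 → E3} {x : E3} (hx : x ∉ tsupport u) : frob (gradv u x) = 0 := by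
  simp [frob, gradv, pd_zero hx]

lemma final_ineq {ω : E3 → ℝ≥0∞} {p : ℝ} {A : ℝ≥0∞} (hW : Wt ω p A) :
    ∃ C : ℝ≥0∞, C ≠ ∞ ∧ ∀ u : E3 → E3, ContDiff ℝ (⊤ : ℕ∞) u → HasCompactSupport u →
      (∫⁻ x, ENNReal.ofReal (frob (gradv u x)) ^ p ∂(volume.withDensity ω)) ^ (1 / p) ≤
        C * ((∫⁻ x, ENNReal.ofReal |vdiv u x| ^ p ∂(volume.withDensity ω)) ^ (1 / p)
          + (∫⁻ x, ENNReal.ofReal ‖vcurl u x‖ ^ p ∂(volume.withDensity ω)) ^ (1 / p)) := by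
  have hp := hW.hp
  have hp0 : 0 < p := by linarith
  obtain ⟨C, hC, H⟩ := main_w hW
  set μ := volume.withDensity ω with hμ
  have h9 : (9 : ℝ≥0∞) ^ (p - 1) ≠ ∞ := ENNReal.rpow_ne_top_of_nonneg (by linarith) (by simp)
  refine ⟨(9 ^ (p - 1) * (9 * C)) ^ (1 / p), ENNReal.rpow_ne_top_of_nonneg (by positivity)
    (ENNReal.mul_ne_top h9 (ENNReal.mul_ne_top (by simp) hC)), fun u hu hc => ?_⟩
  have hpd : ∀ i j, Measurable (pd u i j) := fun i j => (pd_smooth hu i j).continuous.measurable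
  have hpt : ∀ x, ENNReal.ofReal (frob (gradv u x)) ^ p ≤
      9 ^ (p - 1) * ∑ q : Fin 3 × Fin 3, ENNReal.ofReal |pd u q.1 q.2 x| ^ p := by
    intro x
    have h1 : ENNReal.ofReal (frob (gradv u x)) ≤ ∑ q : Fin 3 × Fin 3, ENNReal.ofReal |pd u q.1 q.2 x| := by
      rw [← ENNReal.ofReal_sum_of_nonneg fun _ _ => abs_nonneg _]
      exact ENNReal.ofReal_le_ofReal (frob_le _)
    refine (ENNReal.rpow_le_rpow h1 hp0.le).trans ?_
    have h2 := ENNReal.rpow_sum_le_const_mul_sum_rpow (Finset.univ : Finset (Fin 3 × Fin 3))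
      (fun q => ENNReal.ofReal |pd u q.1 q.2 x|) hp.le
    have h3 : ((Finset.univ : Finset (Fin 3 × Fin 3)).card : ℝ≥0∞) = 9 := by simp
    rw [h3] at h2
    exact h2
  have hN : (∫⁻ x, ENNReal.ofReal (frob (gradv u x)) ^ p ∂μ) ≤
      9 ^ (p - 1) * (9 * C) * ∫⁻ x, ENNReal.ofReal (dat u x) ^ p ∂μ := by
    refine (lintegral_mono hpt).trans ?_
    rw [lintegral_const_mul _ (by fun_prop), lintegral_finsetSum _ (by intro q _; fun_prop), mul_assoc]
    refine mul_le_mul_right ?_ _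
    refine (Finset.sum_le_sum fun q _ => H u hu hc q.1 q.2).trans ?_
    rw [Finset.sum_const, nsmul_eq_mul, mul_assoc]
    simp
  refine (ENNReal.rpow_le_rpow hN (by positivity)).trans ?_
  rw [ENNReal.mul_rpow_of_nonneg _ _ (by positivity)]
  refine mul_le_mul_right ?_ _
  have hd := (div_cont hu).measurable
  have hcu := (curl_cont hu).measurable
  have hmk := ENNReal.lintegral_Lp_add_le (μ := μ) (f := fun x => ENNReal.ofReal |vdiv u x|)
    (g := fun x => ENNReal.ofReal ‖vcurl u x‖)
    (by have := (div_cont hu).abs.measurable; exact this.ennreal_ofReal.aemeasurable)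
    (by have := (curl_cont hu).norm.measurable; exact this.ennreal_ofReal.aemeasurable) hp.le
  refine le_trans (le_of_eq ?_) hmk
  congr 1
  apply lintegral_congr
  intro x
  rw [Pi.add_apply, ← ENNReal.ofReal_add (abs_nonneg _) (norm_nonneg _)]
  rfl

/-- Weighted div–curl inequality for Muckenhoupt `A_p` weights:
`‖∇u‖_{L^p_w} ≤ C (‖div u‖_{L^p_w} + ‖curl u‖_{L^p_w})` for all `u ∈ C_c^∞(Ω; ℝ³)`. -/
theorem muckenhoupt_div_curl_inequality
    (Ω : Set E3) (hΩ : IsOpen Ω) (p : ℝ) (hp : 1 < p)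
    (w : E3 → ℝ) (hw0 : ∀ x, 0 ≤ w x)
    (hwpos : ∀ᵐ x ∂(volume : Measure E3), 0 < w x)
    (hwloc : LocallyIntegrable w (volume : Measure E3))
    (hap : IsMuckenhouptAp w p) :
    ∃ C : ℝ, ∀ u : E3 → E3,
      ContDiff ℝ (⊤ : ℕ∞) u → HasCompactSupport u → tsupport u ⊆ Ω →
      (∫ x in Ω, w x * frob (gradv u x) ^ p) ^ (1/p)
        ≤ C * ((∫ x in Ω, w x * |vdiv u x| ^ p) ^ (1/p)
          + (∫ x in Ω, w x * ‖vcurl u x‖ ^ p) ^ (1/p)) := by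
  obtain ⟨ω, A, hW, hωe⟩ := exists_Wt hp hwpos hwloc hap
  obtain ⟨C, hC, H⟩ := final_ineq hW
  have hwm := hwloc.aestronglyMeasurable
  refine ⟨C.toReal, fun u hu hc hs => ?_⟩
  obtain ⟨e1, -⟩ := conv_int hW hw0 hwm hωe hc hs (frob_cont hu) (fun x => Real.sqrt_nonneg _)
    (fun x hx => frob_zero hx)
  obtain ⟨e2, f2⟩ := conv_int hW hw0 hwm hωe hc hs (φ := fun x => |vdiv u x|) (div_cont hu).abs
    (fun x => abs_nonneg _) (fun x hx => by rw [div_zero' hx, abs_zero])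
  obtain ⟨e3, f3⟩ := conv_int hW hw0 hwm hωe hc hs (φ := fun x => ‖vcurl u x‖) (curl_cont hu).norm
    (fun x => norm_nonneg _) (fun x hx => by rw [curl_zero hx, norm_zero])
  have hp0 : 0 ≤ 1 / p := by positivity
  have g2 := ENNReal.rpow_ne_top_of_nonneg hp0 f2
  have g3 := ENNReal.rpow_ne_top_of_nonneg hp0 f3
  rw [e1, e2, e3, ENNReal.toReal_rpow, ENNReal.toReal_rpow, ENNReal.toReal_rpow, ← ENNReal.toReal_add g2 g3,
    ← ENNReal.toReal_mul]
  exact ENNReal.toReal_mono (ENNReal.mul_ne_top hC (ENNReal.add_ne_top.2 ⟨g2, g3⟩)) (H u hu hc)
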